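/- arXiv:1410.0430 — 5 statements merged into one kernel-verified Lean document; each statement's English description precedes it below -/
import Mathlib

section
/- There exists an absolute constant c > 0 such that for every natural number k ≥ 1, every non-bipartite 2-connected finite simple graph G with average degree at least c·k contains cycles of all odd lengths modulo k; that is, for every odd integer m there is a cycle in G whose length is congruent to m modulo k, and moreover, if k is odd, then for every integer m there is a cycle in G whose length is congruent to m modulo k. -/
/-- `G` contains a cycle of length `n`. -/
def HasCycleOfLength {V : Type*} (G : SimpleGraph V) (n : ℕ) : Prop :=
  ∃ (v : V) (c : G.Walk v v), c.IsCycle ∧ c.length = n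

/-- `G` is 2-connected: it has at least 3 vertices and stays connected after the
deletion of any single vertex. -/
def TwoConnected {V : Type*} [Fintype V] (G : SimpleGraph V) : Prop :=
  3 ≤ Fintype.card V ∧ ∀ v : V, (G.induce ({v}ᶜ : Set V)).Connected

namespace SimpleGraph

variable {V : Type*}

/-- `G.PathOn S u v n`: the graph `G` contains a path of length `n` from `u` to `v` whose set of
vertices is exactly `S`. -/
inductive PathOn (G : SimpleGraph V) : Set V → V → V → ℕ → Prop
  | nil (u : V) : PathOn G {u} u u 0
  | cons {S : Set V} {u v w : V} {n : ℕ} (h : G.Adj u v) (p : PathOn G S v w n) (hu : u ∉ S) :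
      PathOn G (insert u S) u w (n + 1)

namespace PathOn

variable {G H : SimpleGraph V} {S T : Set V} {u v w : V} {m n : ℕ}

theorem left_mem (p : G.PathOn S u v n) : u ∈ S := by
  cases p <;> simp

theorem right_mem (p : G.PathOn S u v n) : v ∈ S := by
  induction p with
  | nil => simp
  | cons h p hu ih => exact Set.mem_insert_of_mem _ ih

theorem of_adj (h : G.Adj u v) : G.PathOn {u, v} u v 1 :=
  cons h (nil v) (by simpa using h.ne)

theorem append (p : G.PathOn S u w m) (q : G.PathOn T w v n)
    (hST : ∀ z ∈ S, z ∈ T → z = w) : G.PathOn (S ∪ T) u v (m + n) := by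
  induction p with
  | nil u =>
    have : ({u} : Set V) ∪ T = T := by
      rw [Set.union_eq_right]; simpa using q.left_mem
    rw [this, zero_add]; exact q
  | @cons S a b c n' h p hu ih =>
    have := cons h (ih q fun z hz => hST z (Set.mem_insert_of_mem _ hz)) (u := a) (by
      rintro (h1 | h1)
      · exact hu h1
      · have := hST a (by simp) h1
        subst this
        exact hu p.right_mem)
    rw [Set.insert_union, add_right_comm]
    exact this

theorem reverse (p : G.PathOn S u v n) : G.PathOn S v u n := by
  induction p with
  | nil u => exact nil u
  | @cons S a b c n' h p hu ih =>
    have := ih.append (of_adj h.symm) (by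
      rintro z hz (rfl | rfl)
      · rfl
      · exact absurd hz hu)
    convert this using 1
    have := p.left_mem
    grind

theorem mono (p : G.PathOn S u v n) (h : ∀ a ∈ S, ∀ b ∈ S, G.Adj a b → H.Adj a b) :
    H.PathOn S u v n := by
  induction p with
  | nil u => exact nil u
  | cons hab p hu ih =>
    exact cons (h _ (by simp) _ (by simp [p.left_mem]) hab)
      (ih fun a ha b hb => h a (by simp [ha]) b (by simp [hb])) hu

theorem split (p : G.PathOn S u v n) (hw : w ∈ S) :
    ∃ S₁ S₂ n₁ n₂, S₁ ∪ S₂ = S ∧ (∀ z ∈ S₁, z ∈ S₂ → z = w) ∧ n₁ + n₂ = n ∧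
      G.PathOn S₁ u w n₁ ∧ G.PathOn S₂ w v n₂ := by
  induction p with
  | nil u =>
    obtain rfl : w = u := hw
    exact ⟨{w}, {w}, 0, 0, by simp, by simp, rfl, nil w, nil w⟩
  | @cons S a b c n' h p hu ih =>
    by_cases hwa : w = a
    · subst hwa
      exact ⟨{w}, _, 0, _, by simp, by simp, zero_add _, nil w, cons h p hu⟩
    · obtain ⟨S₁, S₂, n₁, n₂, rfl, h2, rfl, p₁, p₂⟩ := ih (by grind)
      exact ⟨insert a S₁, S₂, n₁ + 1, n₂, by grind, by grind, by omega,
        cons h p₁ (by grind), p₂⟩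

theorem first_hit (p : G.PathOn S u v n) {Y : Set V} (hv : v ∈ Y) :
    ∃ b ∈ Y, ∃ S' ⊆ S, ∃ n' ≤ n, G.PathOn S' u b n' ∧ ∀ z ∈ S', z ∈ Y → z = b := by
  induction p with
  | nil u => exact ⟨u, hv, {u}, le_rfl, 0, le_rfl, nil u, by simp⟩
  | @cons S a b c n' h p hu ih =>
    by_cases ha : a ∈ Y
    · exact ⟨a, ha, {a}, by simp, 0, by simp, nil a, by simp⟩
    · obtain ⟨d, hd, S', hS', n₁, hn₁, q, hq⟩ := ih hv
      exact ⟨d, hd, insert a S', Set.insert_subset_insert hS', n₁ + 1, by omega,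
        cons h q fun h1 => hu (hS' h1), by grind⟩

theorem color_eq (p : G.PathOn S u v n) {χ : V → ZMod 2}
    (h : ∀ a ∈ S, ∀ b ∈ S, G.Adj a b → χ b = χ a + 1) : χ v = χ u + n := by
  induction p with
  | nil u => simp
  | cons hab p hu ih =>
    rw [ih fun a ha b hb => h a (by simp [ha]) b (by simp [hb]),
      h _ (by simp) _ (by simp [p.left_mem]) hab]
    push_cast; ring

theorem exists_walk (p : G.PathOn S u v n) :
    ∃ q : G.Walk u v, q.IsPath ∧ q.length = n ∧ ∀ z ∈ q.support, z ∈ S := by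
  induction p with
  | nil u => exact ⟨.nil, by simp⟩
  | cons h p hu ih =>
    obtain ⟨q, hq, hl, hs⟩ := ih
    exact ⟨.cons h q, by simpa [hq] using fun h' => hu (hs _ h'), by simp [hl],
      by simpa using fun z hz => Or.inr (hs z hz)⟩

theorem hasCycleOfLength_succ (p : G.PathOn S u v n) (hn : 2 ≤ n) (h : G.Adj v u) :
    HasCycleOfLength G (n + 1) := by
  obtain ⟨q, hq, rfl, -⟩ := p.exists_walk
  refine ⟨v, .cons h q, ?_, by simp⟩
  rw [Walk.cons_isCycle_iff]
  refine ⟨hq, fun he => ?_⟩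
  have := hq.length_eq_one_of_mem_edges (Sym2.eq_swap ▸ he)
  omega

theorem hasCycleOfLength_add (p : G.PathOn S u v m) (q : G.PathOn T u v n) (huv : u ≠ v)
    (hST : ∀ z ∈ S, z ∈ T → z = u ∨ z = v) (hmn : 3 ≤ m + n) :
    HasCycleOfLength G (m + n) := by
  cases q with
  | nil => exact absurd rfl huv
  | @cons T a b c n' h q hu =>
    have := (q.append p.reverse (by grind)).hasCycleOfLength_succ (by omega) h
    convert this using 1
    omega

theorem of_reflTransGen {z : V}
    (h : Relation.ReflTransGen (fun a b => G.Adj a b ∧ a ≠ z ∧ b ≠ z) u v) (hu : u ≠ z) :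
    ∃ S n, G.PathOn S u v n ∧ z ∉ S := by
  induction h using Relation.ReflTransGen.head_induction_on with
  | refl => exact ⟨_, _, nil v, by simpa using hu.symm⟩
  | @head a b hab _ ih =>
    obtain ⟨S, n, p, hz⟩ := ih hab.2.2
    by_cases ha : a ∈ S
    · obtain ⟨S₁, S₂, n₁, n₂, rfl, -, -, -, p₂⟩ := p.split ha
      exact ⟨_, _, p₂, fun h' => hz (Or.inr h')⟩
    · exact ⟨_, _, cons hab.1 p ha, by grind⟩

theorem reflTransGen (p : G.PathOn S u v n) {z : V} (hz : z ∉ S) :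
    Relation.ReflTransGen (fun a b => G.Adj a b ∧ a ≠ z ∧ b ≠ z) u v := by
  induction p with
  | nil => exact .refl
  | cons h p hu ih =>
    refine .head ⟨h, ?_, ?_⟩ (ih ?_) <;> have := p.left_mem <;> grind

end PathOn

end SimpleGraph

namespace SimpleGraph

variable {V : Type*}

/-- Any two vertices of `W` are joined in `H` by a walk that avoids any prescribed third vertex. -/
def BlockOn (H : SimpleGraph V) (W : Set V) : Prop :=
  ∀ z, ∀ u ∈ W, ∀ v ∈ W, u ≠ z → v ≠ z →
    Relation.ReflTransGen (fun a b => H.Adj a b ∧ a ≠ z ∧ b ≠ z) u v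

theorem PathOn.subset {H : SimpleGraph V} {S W : Set V} {u v : V} {n : ℕ} (p : H.PathOn S u v n)
    (hW : ∀ a b, H.Adj a b → a ∈ W ∧ b ∈ W) (hu : u ∈ W) : S ⊆ W := by
  induction p with
  | nil => simpa using hu
  | cons h p hu' ih => exact Set.insert_subset hu (ih (hW _ _ h).2)

theorem BlockOn.exists_pathOn {H : SimpleGraph V} {W Y : Set V} {u v z : V} (h : H.BlockOn W)
    (hu : u ∈ W) (hv : v ∈ W) (huz : u ≠ z) (hvz : v ≠ z) (hvY : v ∈ Y) :
    ∃ b ∈ Y, ∃ S n, H.PathOn S u b n ∧ z ∉ S ∧ ∀ a ∈ S, a ∈ Y → a = b := by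
  obtain ⟨S, n, p, hz⟩ := PathOn.of_reflTransGen (h z u hu v hv huz hvz) huz
  obtain ⟨b, hb, S', hS', n', -, p', hp'⟩ := p.first_hit hvY
  exact ⟨b, hb, S', n', p', fun h => hz (hS' h), hp'⟩

theorem PathOn.reroute {G H : SimpleGraph V} {χ : V → ZMod 2} {N M : Set V} {r b u w : V}
    {n m : ℕ} (hHG : H ≤ G) (hχ : ∀ a b, H.Adj a b → χ b = χ a + 1)
    (p : H.PathOn N r b n) (q : G.PathOn M w u m) (hw : w ∈ N) (hu : u ∈ N)
    (hMN : ∀ z ∈ M, z ∈ N → z = w ∨ z = u) (hodd : χ u = χ w + m + 1) :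
    ∃ N' ⊆ N ∪ M, ∃ l : ℕ, G.PathOn N' r b l ∧ χ b = χ r + l + 1 := by
  have key : ∀ {S a c k}, H.PathOn S a c k → G.PathOn S a c k ∧ χ c = χ a + k := fun p =>
    ⟨p.mono fun _ _ _ _ h => hHG h, p.color_eq fun _ _ _ _ h => hχ _ _ h⟩
  have hwu : w ≠ u := by
    rintro rfl
    cases q with
    | nil => simp at hodd
    | cons h q hq => exact hq q.right_mem
  obtain ⟨N₁, N₂, n₁, n₂, rfl, h12, rfl, p₁, p₂⟩ := p.split hw
  obtain hu | hu := hu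
  · obtain ⟨N₃, N₄, n₃, n₄, rfl, h34, rfl, p₃, p₄⟩ := p₁.split hu
    have e2 := key p₂
    have e3 := key p₃
    have := p₄.right_mem
    have := p₃.right_mem
    refine ⟨_, ?_, _, (e3.1.append q.reverse ?_).append e2.1 ?_, ?_⟩
    · grind
    · intro z h1 h2
      have := hMN z h2
      grind
    · intro z h1 h2
      have := hMN z
      grind
    · have two : (2 : ZMod 2) = 0 := by decide
      push_cast
      linear_combination e2.2 + e3.2 - hodd - (1 + m) * two
  · obtain ⟨N₃, N₄, n₃, n₄, rfl, h34, rfl, p₃, p₄⟩ := p₂.split hu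
    have e1 := key p₁
    have e4 := key p₄
    have := p₃.left_mem
    have := p₄.left_mem
    refine ⟨_, ?_, _, (e1.1.append q ?_).append e4.1 ?_, ?_⟩
    · grind
    · intro z h1 h2
      have := hMN z h2
      grind
    · intro z h1 h2
      have := hMN z
      grind
    · push_cast
      linear_combination e1.2 + e4.2 + hodd

theorem exists_odd_handle {G H : SimpleGraph V} {W P : Set V} {χ : V → ZMod 2} {x y : V} {q : ℕ}
    (hHG : H ≤ G) (hW : ∀ a b, H.Adj a b → a ∈ W ∧ b ∈ W)
    (hχ : ∀ a b, H.Adj a b → χ b = χ a + 1) (hB : H.BlockOn W) (hy : y ∈ W)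
    (hxy : x ≠ y) (hP : G.PathOn P x y q) (hPW : ∀ z ∈ P, z ∈ W → z = x ∨ z = y)
    (hodd : χ y = χ x + q + 1) (n : ℕ) :
    ∀ (Y : Set V) (r : V), Y ⊆ W → r ∈ Y → (∃ b ∈ Y, b ≠ r) →
      ∀ R, H.PathOn R r x n → (∀ z ∈ R, z ∈ Y → z = r) →
        ∃ b ∈ Y, b ≠ r ∧ ∃ (M : Set V) (m : ℕ), G.PathOn M r b m ∧
          (∀ z ∈ M, z ∈ Y → z = r ∨ z = b) ∧ χ b = χ r + m + 1 := by
  have key : ∀ {S a c k}, H.PathOn S a c k → G.PathOn S a c k ∧ χ c = χ a + k := fun p =>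
    ⟨p.mono fun _ _ _ _ h => hHG h, p.color_eq fun _ _ _ _ h => hχ _ _ h⟩
  induction n using Nat.strong_induction_on with
  | _ n ih =>
  rintro Y r hYW hr ⟨b, hb, hbr⟩ R pR hR
  cases pR with
  | nil =>
    obtain ⟨b₁, hb₁, Q, l, pQ, hrQ, hQ⟩ :=
      hB.exists_pathOn (Y := Y \ {x}) hy (hYW hb) hxy.symm hbr (by grind)
    have hQW := pQ.subset hW hy
    have e := key pQ
    have := hP.right_mem
    have := pQ.left_mem
    refine ⟨b₁, hb₁.1, hb₁.2, _, _, hP.append e.1 ?_, ?_, ?_⟩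
    · intro z h1 h2
      have := hPW z h1 (hQW h2)
      grind
    · intro z h1 h2
      have := hPW z
      have := hQ z
      have := hYW h2
      grind
    · push_cast
      linear_combination e.2 + hodd
  | @cons R _ r' _ n' hrr' pR hrR =>
    have hr'R := pR.left_mem
    have hr'Y : r' ∉ Y := fun h => by
      have := hR r' (by grind) h
      grind
    obtain ⟨b₀, hb₀, Q, l, pQ, hrQ, hQ⟩ :=
      hB.exists_pathOn (Y := Y \ {r}) (hW _ _ hrr').2 (hYW hb) hrr'.ne' hbr (by grind)
    have pN := PathOn.cons hrr' pQ hrQ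
    have hNY : ∀ z ∈ insert r Q, z ∈ Y → z = r ∨ z = b₀ := by grind
    have hr'Q := pQ.left_mem
    set N := insert r Q with hN
    have hNW : N ⊆ W := pN.subset hW (hYW hr)
    obtain ⟨w, hwN, R', hR'R, l', hl', pR', hR'⟩ := pR.reverse.first_hit (Y := N) (by grind)
    have hw := pR'.right_mem
    have hwY : w ∉ Y := fun h => by
      have := hR w (by grind) h
      grind
    obtain ⟨b₁, hb₁, hb₁w, M, m, pM, hM, hMo⟩ := ih l' (by omega) (Y ∪ N) w
      (Set.union_subset hYW hNW) (by grind) ⟨r, by grind, by grind⟩ R' pR'.reverse (by grind)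
    by_cases hbN : b₁ ∈ N
    · obtain ⟨N', hN', k, pN', hk⟩ := pN.reroute hHG hχ pM hwN hbN (by grind) hMo
      exact ⟨b₀, hb₀.1, hb₀.2, N', k, pN', by grind, hk⟩
    · obtain ⟨N₁, N₂, n₁, n₂, h12', h12, -, p₁, p₂⟩ := pN.split hwN
      have := p₂.right_mem
      have e := key p₁
      refine ⟨b₁, by grind, by grind, _, _, e.1.append pM ?_, ?_, ?_⟩
      · grind
      · grind
      · push_cast
        linear_combination e.2 + hMo

end SimpleGraph

theorem iff_of_theta_shifts {g : ℕ → Prop} {n m t e : ℕ} (hm : Odd m) (hn : Even n) (ht : Even t)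
    (ht0 : 0 < t) (htm : t ≤ m) (hmt : m + t ≤ n)
    (path : ∀ i, i % 2 = e → i + t < n → (g i ↔ g (i + t)))
    (cycle : ∀ i, i % 2 = e → i < n → n ≤ i + t → (g i ↔ g (i + t - n)))
    (short : ∀ i, i % 2 = e → i ≤ m → m < i + t → (g i ↔ g (i + t - (m + 1))))
    (zero : e = 0 → (g 0 ↔ g (m - 1 + t)))
    (long : ∀ j, 0 < j → j < t → (n - j) % 2 = e → (g (n - j) ↔ g (m - 1 + t - j)))
    {i j : ℕ} (hi : i < n) (hj : j < n) (hie : i % 2 = e) (hje : j % 2 = e) : g i ↔ g j := by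
  obtain ⟨m', rfl⟩ := hm
  obtain ⟨n', rfl⟩ := hn
  obtain ⟨t', rfl⟩ := ht
  set F : ℤ → Prop := fun x => g (x % (t' + t' : ℕ)).toNat with hF
  have congrF : ∀ x y : ℤ, x % (t' + t' : ℕ) = y % (t' + t' : ℕ) → (F x ↔ F y) := by
    intro x y h
    simp only [hF, h]
  have Fg : ∀ i : ℕ, i % 2 = e → i < n' + n' → (F i ↔ g i) := by
    intro i
    induction i using Nat.strong_induction_on with
    | _ i ih =>
      intro hi hin
      by_cases h : i < t' + t'
      · simp only [hF]
        rw [Int.emod_eq_of_lt (by omega) (by omega)]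
        simp
      · have h1 := ih (i - (t' + t')) (by omega) (by omega) (by omega)
        have h2 := path (i - (t' + t')) (by omega) (by omega)
        rw [Nat.sub_add_cancel (by omega)] at h2
        rw [← h2, ← h1]
        apply congrF
        rw [Nat.cast_sub (by omega), Int.sub_emod_right]
  have rep : ∀ (x a : ℤ), ∃ y, a ≤ y ∧ y < a + (t' + t' : ℕ) ∧
      (∀ z : ℤ, F (x + z) ↔ F (y + z)) ∧ y % 2 = x % 2 := by
    intro x a
    have h1 := Int.emod_add_mul_ediv (x - a) (t' + t' : ℕ)
    have h2 := Int.emod_nonneg (x - a) (b := (t' + t' : ℕ)) (by omega)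
    have h3 := Int.emod_lt_of_pos (x - a) (b := (t' + t' : ℕ)) (by omega)
    have hxy : x = a + (x - a) % (t' + t' : ℕ) + (t' + t' : ℕ) * ((x - a) / (t' + t' : ℕ)) := by
      linarith
    refine ⟨a + (x - a) % (t' + t' : ℕ), by omega, by omega, fun z => ?_, ?_⟩
    · apply congrF
      conv_lhs => rw [hxy, add_right_comm, Int.add_mul_emod_self_left]
    · conv_rhs => rw [hxy]
      have : ((t' + t' : ℕ) : ℤ) * ((x - a) / (t' + t' : ℕ)) =
        2 * (t' * ((x - a) / (t' + t' : ℕ))) := by push_cast; ring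
      omega
  have perT : ∀ x : ℤ, F (x + (t' + t' : ℕ)) ↔ F x := fun x => congrF _ _ (by simp)
  have perN : ∀ x : ℤ, x % 2 = e → (F x ↔ F (x - (n' + n' : ℕ))) := by
    intro x hx
    obtain ⟨y, hy1, hy2, hy, hy3⟩ := rep x ((n' + n' : ℕ) - (t' + t' : ℕ))
    have h0 := hy 0
    rw [add_zero, add_zero] at h0
    rw [h0, sub_eq_add_neg, hy, ← perT (y + _)]
    lift y to ℕ using by omega
    have := cycle y (by omega) (by omega) (by omega)
    rw [Fg y (by omega) (by omega), this, ← Fg _ (by omega) (by omega)]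
    apply congrF
    congr 1
    omega
  have perS : ∀ x : ℤ, x % 2 = e → (F x ↔ F (x - (2 * m' + 1 + 1 : ℕ))) := by
    intro x hx
    obtain ⟨y, hy1, hy2, hy, hy3⟩ := rep x ((2 * m' + 1 + 1 : ℕ) - (t' + t' : ℕ))
    have h0 := hy 0
    rw [add_zero, add_zero] at h0
    rw [h0, sub_eq_add_neg, hy, ← perT (y + _)]
    lift y to ℕ using by omega
    have := short y (by omega) (by omega) (by omega)
    rw [Fg y (by omega) (by omega), this, ← Fg _ (by omega) (by omega)]
    apply congrF
    congr 1
    omega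
  have perL : ∀ x : ℤ, x % 2 = e → (F x ↔ F (x + (2 * m' : ℕ))) := by
    intro x hx
    obtain ⟨y, hy1, hy2, hy, hy3⟩ := rep x (1 - (t' + t' : ℕ))
    have h0 := hy 0
    rw [add_zero, add_zero] at h0
    rw [h0, hy, ← perT (y + _)]
    obtain ⟨j, rfl⟩ : ∃ j : ℕ, y = -j := ⟨(-y).toNat, by omega⟩
    have e2 : F (-j + (2 * m' : ℕ) + (t' + t' : ℕ)) ↔ g (2 * m' + 1 - 1 + (t' + t') - j) := by
      rw [← Fg _ (by omega) (by omega)]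
      apply congrF
      congr 1
      omega
    rw [e2]
    rcases Nat.eq_zero_or_pos j with rfl | hj
    · have e0 : F (-((0 : ℕ) : ℤ)) ↔ g 0 := by
        rw [← Fg 0 (by omega) (by omega)]
        exact congrF _ _ (by simp)
      rw [e0, zero (by omega)]
      rfl
    · rw [← long j hj (by omega) (by omega), ← Fg _ (by omega) (by omega),
        perN (n' + n' - j : ℕ) (by omega)]
      apply congrF
      congr 1
      omega
  have per2 : ∀ x : ℤ, x % 2 = e → (F x ↔ F (x + 2)) := by
    intro x hx
    rw [perL (x + 2) (by omega), perS (x + 2 + (2 * m' : ℕ)) (by omega)]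
    apply congrF
    congr 1
    omega
  have all : ∀ (k : ℕ) (x : ℤ), x % 2 = e → (F x ↔ F (x + 2 * k)) := by
    intro k
    induction k with
    | zero => simp
    | succ k ih =>
      intro x hx
      rw [ih x hx, per2 _ (by omega)]
      apply congrF
      congr 1
      push_cast; ring
  have main : ∀ i, i < n' + n' → i % 2 = e → (F e ↔ g i) := by
    intro i hi hie
    rw [← Fg i hie hi, all (i / 2) e (by omega)]
    apply congrF
    congr 1
    omega
  rw [← main i hi hie, ← main j hj hje]

namespace SimpleGraph

variable {V : Type*} {G : SimpleGraph V}

theorem PathOn.append_adj {S T : Set V} {u v a b : V} {m n : ℕ} (p : G.PathOn S u a m)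
    (h : G.Adj a b) (q : G.PathOn T b v n) (hST : ∀ z ∈ S, z ∉ T) :
    G.PathOn (S ∪ T) u v (m + n + 1) := by
  have ha := p.right_mem
  have := p.append (cons h q (hST a ha)) (by grind)
  convert this using 1
  · grind
  · omega

theorem PathOn.segment {p : ℕ → V} {n : ℕ} (hinj : Set.InjOn p (Set.Iio n))
    (hadj : ∀ i, i + 1 < n → G.Adj (p i) (p (i + 1))) {i j : ℕ} (hij : i ≤ j) (hj : j < n) :
    G.PathOn (p '' Set.Icc i j) (p i) (p j) (j - i) := by
  induction j, hij using Nat.le_induction with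
  | base => simpa using nil (p i)
  | succ j hij ih =>
    have := (ih (by omega)).append_adj (hadj j hj) (nil _) (by
      rintro _ ⟨a, ha, rfl⟩ h
      have := hinj (by grind) (by grind) h
      grind)
    convert this using 1
    · ext z
      simp only [Set.mem_image, Set.mem_Icc, Set.mem_union, Set.mem_singleton_iff]
      constructor
      · rintro ⟨a, ha, rfl⟩
        by_cases h : a ≤ j
        · exact Or.inl ⟨a, by omega, rfl⟩
        · right; congr 1; omega
      · rintro (⟨a, ha, rfl⟩ | rfl)
        · exact ⟨a, by omega, rfl⟩
        · exact ⟨j + 1, by omega, rfl⟩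
    · omega

/-- `G.IsTheta p n m`: the vertices `p 0, …, p (n - 1)` form a cycle of `G` in this order, with a
chord joining `p 0` to `p m`. -/
structure IsTheta (G : SimpleGraph V) (p : ℕ → V) (n m : ℕ) : Prop where
  injOn : Set.InjOn p (Set.Iio n)
  adj : ∀ i, i + 1 < n → G.Adj (p i) (p (i + 1))
  chord : G.Adj (p 0) (p m)
  close : G.Adj (p 0) (p (n - 1))

theorem IsTheta.exists_path_of_coloring {p : ℕ → V} {n m t e : ℕ} (h : G.IsTheta p n m)
    (hm : Odd m) (hn : Even n) (ht : Even t) (ht0 : 0 < t) (htm : t ≤ m) (hmt : m + t ≤ n)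
    {f : V → Prop} {i j : ℕ} (hi : i < n) (hj : j < n) (hie : i % 2 = e) (hje : j % 2 = e)
    (hfi : f (p i)) (hfj : ¬ f (p j)) :
    ∃ i j, i < n ∧ j < n ∧ i % 2 = e ∧ j % 2 = e ∧ f (p i) ∧ ¬ f (p j) ∧
      ∃ S ⊆ p '' Set.Iio n, G.PathOn S (p i) (p j) t := by
  by_contra hcon
  have key : ∀ i j S, i < n → j < n → i % 2 = e → j % 2 = e → S ⊆ p '' Set.Iio n →
      G.PathOn S (p i) (p j) t → (f (p i) ↔ f (p j)) := by
    intro i j S hi hj hie hje hS q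
    by_contra hne
    by_cases hfi : f (p i)
    · exact hcon ⟨i, j, hi, hj, hie, hje, hfi, by tauto, S, hS, q⟩
    · exact hcon ⟨j, i, hj, hi, hje, hie, by tauto, hfi, S, hS, q.reverse⟩
  have sub : ∀ i j, j < n → p '' Set.Icc i j ⊆ p '' Set.Iio n := by
    intro i j hj
    exact Set.image_mono fun x hx => lt_of_le_of_lt hx.2 hj
  have seg := fun {i j} => PathOn.segment (i := i) (j := j) h.injOn h.adj
  have disj : ∀ i j i' j', j < n → j' < n → (j < i' ∨ j' < i) →
      ∀ z ∈ p '' Set.Icc i j, z ∉ p '' Set.Icc i' j' := by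
    rintro i j i' j' hj hj' hd _ ⟨a, ha, rfl⟩ ⟨b, hb, hab⟩
    simp only [Set.mem_Icc] at ha hb
    have := h.injOn (by simp; omega) (by simp; omega) hab
    omega
  have hne' := Nat.even_iff.mp hn
  have ht' := Nat.even_iff.mp ht
  have hm' := Nat.odd_iff.mp hm
  refine hfj ((iff_of_theta_shifts (g := fun i => f (p i)) (e := e) hm hn ht ht0 htm hmt
    ?_ ?_ ?_ ?_ ?_ hi hj hie hje).mp hfi)
  · intro i hi hit
    refine key i (i + t) _ (by omega) hit hi (by omega) (sub i _ hit) ?_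
    convert seg (Nat.le_add_right i t) hit using 1
    omega
  · intro i hi hin hit
    refine key i (i + t - n) _ hin (by omega) hi (by omega)
      (Set.union_subset (sub i (n - 1) (by omega)) (sub 0 (i + t - n) (by omega))) ?_
    convert (seg (i := i) (j := n - 1) (by omega) (by omega)).append_adj h.close.symm
      (seg (i := 0) (j := i + t - n) (by omega) (by omega))
      (disj _ _ _ _ (by omega) (by omega) (by omega)) using 1
    omega
  · intro i hi him hit
    refine key i (i + t - (m + 1)) _ (by omega) (by omega) hi (by omega)
      (Set.union_subset (sub i m (by omega)) (sub 0 (i + t - (m + 1)) (by omega))) ?_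
    convert (seg (i := i) (j := m) (by omega) (by omega)).append_adj h.chord.symm
      (seg (i := 0) (j := i + t - (m + 1)) (by omega) (by omega))
      (disj _ _ _ _ (by omega) (by omega) (by omega)) using 1
    omega
  · intro he
    refine key 0 (m - 1 + t) _ (by omega) (by omega) (by omega) (by omega)
      (Set.union_subset (sub 0 0 (by omega)) (sub m (m - 1 + t) (by omega))) ?_
    convert (seg (i := 0) (j := 0) (by omega) (by omega)).append_adj h.chord
      (seg (i := m) (j := m - 1 + t) (by omega) (by omega))
      (disj _ _ _ _ (by omega) (by omega) (by omega)) using 1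
    omega
  · intro j hj hjt hje
    refine key (n - j) (m - 1 + t - j) _ (by omega) (by omega) hje (by omega)
      (Set.union_subset (Set.union_subset (sub (n - j) (n - 1) (by omega)) (sub 0 0 (by omega)))
        (sub m (m - 1 + t - j) (by omega))) ?_
    convert ((seg (i := n - j) (j := n - 1) (by omega) (by omega)).append_adj h.close.symm
      (seg (i := 0) (j := 0) (by omega) (by omega))
      (disj _ _ _ _ (by omega) (by omega) (by omega))).append_adj h.chord
      (seg (i := m) (j := m - 1 + t - j) (by omega) (by omega)) ?_ using 1
    · omega
    · rintro z (hz | hz)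
      · exact disj _ _ _ _ (by omega) (by omega) (by omega) z hz
      · exact disj _ _ _ _ (by omega) (by omega) (by omega) z hz

theorem exists_isTheta_of_le_degree [DecidableEq V] [DecidableRel G.Adj] {U : Finset V} {k : ℕ}
    (hk : 0 < k) (hU : U.Nonempty) (hdeg : ∀ u ∈ U, 4 * k ≤ (U.filter (G.Adj u)).card) :
    ∃ p n m, G.IsTheta p n m ∧ (∀ i < n, p i ∈ U) ∧ 2 * k ≤ m ∧ m + 2 * k ≤ n := by
  let Q : ℕ → Prop := fun N => ∃ p : ℕ → V, Set.InjOn p (Set.Iio N) ∧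
    (∀ i < N, p i ∈ U) ∧ ∀ i, i + 1 < N → G.Adj (p i) (p (i + 1))
  have hbd : ∀ N, Q N → N ≤ U.card := by
    rintro N ⟨p, hp, hpU, -⟩
    have := Finset.card_le_card_of_injOn (s := Finset.range N) p
      (fun i hi => hpU i (by simpa using hi))
      (by simpa using hp)
    simpa using this
  have hQ1 : Q 1 := by
    obtain ⟨u, hu⟩ := hU
    exact ⟨fun _ => u, by
      intro i hi j hj _
      simp only [Set.mem_Iio] at hi hj
      omega, fun _ _ => hu, fun i hi => by omega⟩
  obtain ⟨N, hN, hmax⟩ : ∃ N, Q N ∧ ∀ N', Q N' → N' ≤ N := by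
    classical
    refine ⟨Nat.findGreatest Q U.card, Nat.findGreatest_spec (hbd 1 hQ1) hQ1, fun N' h => ?_⟩
    exact Nat.le_findGreatest (hbd _ h) h
  have hN1 := hmax 1 hQ1
  obtain ⟨p, hp, hpU, hadj⟩ := hN
  set I := (Finset.range N).filter fun i => G.Adj (p 0) (p i) with hI
  have hnbr : U.filter (G.Adj (p 0)) ⊆ I.image p := by
    intro v hv
    rw [Finset.mem_filter] at hv
    by_contra hvI
    have hv' : ∀ i < N, p i ≠ v := by
      rintro i hi rfl
      exact hvI (Finset.mem_image_of_mem _ (by simp [hI, hi, hv.2]))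
    have : Q (N + 1) := by
      refine ⟨fun i => Nat.casesOn i v p, ?_, ?_, ?_⟩
      · rintro (_ | i) hi (_ | j) hj hij
        · rfl
        · exact absurd hij.symm (hv' j (by simpa using hj))
        · exact absurd hij (hv' i (by simpa using hi))
        · exact congrArg _ (hp (by simpa using hi) (by simpa using hj) hij)
      · rintro (_ | i) hi
        · exact hv.1
        · exact hpU i (by omega)
      · rintro (_ | i) hi
        · exact hv.2.symm
        · exact hadj i (by omega)
    have := hmax _ this
    omega
  have hIcard : 4 * k ≤ I.card :=
    (hdeg _ (hpU 0 (by omega))).trans ((Finset.card_le_card hnbr).trans Finset.card_image_le)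
  have h0 : 0 ∉ I := by simp [hI]
  have hlow : (I.filter (· < 2 * k)).card + 1 ≤ 2 * k := by
    have : (I.filter (· < 2 * k)) ⊆ Finset.Ico 1 (2 * k) := by
      intro i hi
      rw [Finset.mem_filter] at hi
      have : i ≠ 0 := fun h => h0 (h ▸ hi.1)
      simp; omega
    have := Finset.card_le_card this
    simp at this
    omega
  set I' := I.filter (¬ · < 2 * k) with hI'
  have hsum : (I.filter (· < 2 * k)).card + I'.card = I.card :=
    Finset.card_filter_add_card_filter_not _
  have hne : I'.Nonempty := Finset.card_pos.mp (by omega)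
  have hmin := I'.min'_mem hne
  set m := I'.min' hne with hm
  obtain ⟨q, hq, hqm⟩ : ∃ q ∈ I', m + 2 * k ≤ q := by
    by_contra! hcon
    have : I' ⊆ Finset.Ico m (m + 2 * k) := fun q hq => by
      simp only [Finset.mem_Ico]
      exact ⟨I'.min'_le q hq, hcon q hq⟩
    have := Finset.card_le_card this
    simp at this
    omega
  simp only [hI', hI, Finset.mem_filter, Finset.mem_range] at hq hmin
  refine ⟨p, q + 1, m, ⟨hp.mono ?_, fun i hi => hadj i (by omega), hmin.1.2, by simpa using hq.1.2⟩,
    fun i hi => hpU i (by omega), by omega, by omega⟩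
  intro i hi
  simp only [Set.mem_Iio] at hi ⊢
  omega

end SimpleGraph

namespace SimpleGraph

variable {V : Type*} {G H : SimpleGraph V}

/-- The bipartite graph on `W` consisting of the edges of `G` whose ends have different colors. -/
def cut (G : SimpleGraph V) (W : Set V) (χ : V → ZMod 2) : SimpleGraph V where
  Adj a b := G.Adj a b ∧ a ∈ W ∧ b ∈ W ∧ χ b = χ a + 1
  symm := ⟨by
    rintro a b ⟨h, ha, hb, hab⟩
    refine ⟨h.symm, hb, ha, ?_⟩
    have two : (2 : ZMod 2) = 0 := by decide
    linear_combination -hab - two⟩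
  loopless := ⟨fun a h => G.irrefl h.1⟩

theorem cut_le (W : Set V) (χ : V → ZMod 2) : G.cut W χ ≤ G := fun _ _ h => h.1

theorem BlockOn.union {W P : Set V} {x y : V} {q : ℕ} (h : H.BlockOn W) (hHG : H ≤ G)
    (hP : G.PathOn P x y q) (hx : x ∈ W) (hy : y ∈ W) : G.BlockOn (W ∪ P) := by
  intro z u hu v hv huz hvz
  have symm : ∀ {a b}, Relation.ReflTransGen (fun a b => G.Adj a b ∧ a ≠ z ∧ b ≠ z) a b →
      Relation.ReflTransGen (fun a b => G.Adj a b ∧ a ≠ z ∧ b ≠ z) b a := by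
    intro a b hab
    induction hab with
    | refl => exact .refl
    | tail _ h ih => exact .head ⟨h.1.symm, h.2.2, h.2.1⟩ ih
  have key : ∀ u ∈ W ∪ P, u ≠ z → ∃ w ∈ W, w ≠ z ∧
      Relation.ReflTransGen (fun a b => G.Adj a b ∧ a ≠ z ∧ b ≠ z) u w := by
    rintro u (hu | hu) huz
    · exact ⟨u, hu, huz, .refl⟩
    · obtain ⟨P₁, P₂, n₁, n₂, -, h12, -, p₁, p₂⟩ := hP.split hu
      by_cases hz : z ∈ P₁
      · have hz2 : z ∉ P₂ := fun h => huz (h12 z hz h).symm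
        exact ⟨y, hy, fun h => hz2 (h ▸ p₂.right_mem), p₂.reflTransGen hz2⟩
      · exact ⟨x, hx, fun h => hz (h ▸ p₁.left_mem), symm (p₁.reflTransGen hz)⟩
  obtain ⟨u', hu', huz', hu''⟩ := key u hu huz
  obtain ⟨v', hv', hvz', hv''⟩ := key v hv hvz
  exact (hu''.trans (Relation.ReflTransGen.mono (fun a b h => ⟨hHG h.1, h.2⟩) _ _
    (h z u' hu' v' hv' huz' hvz'))).trans
    (symm hv'')

theorem PathOn.exists_coloring {S : Set V} {u v : V} {n : ℕ} (p : G.PathOn S u v n) (c : ZMod 2) :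
    ∃ χ : V → ZMod 2, χ u = c ∧ (G.cut S χ).PathOn S u v n := by
  classical
  induction p generalizing c with
  | nil u => exact ⟨fun _ => c, rfl, nil u⟩
  | @cons S a b d n' h p hu ih =>
    obtain ⟨χ, hχ, p'⟩ := ih (c + 1)
    have hne : ∀ z ∈ S, z ≠ a := fun z hz hza => hu (hza ▸ hz)
    refine ⟨Function.update χ a c, by simp, cons ?_ (p'.mono ?_) hu⟩
    · refine ⟨h, by simp, by simp [p.left_mem], ?_⟩
      simp [Function.update_of_ne (hne b p.left_mem), hχ]
    · intro x hx y hy hxy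
      refine ⟨hxy.1, by simp [hx], by simp [hy], ?_⟩
      rw [Function.update_of_ne (hne x hx), Function.update_of_ne (hne y hy)]
      exact hxy.2.2.2

theorem exists_ear {W : Set V} (hG : G.BlockOn Set.univ) {s s' v : V} (hs : s ∈ W) (hs' : s' ∈ W)
    (hss' : s ≠ s') (hv : v ∉ W) :
    ∃ x ∈ W, ∃ y ∈ W, x ≠ y ∧ ∃ P q, G.PathOn P x y q ∧ (∀ z ∈ P, z ∈ W → z = x ∨ z = y) ∧
      ∃ u ∈ P, u ∉ W := by
  obtain ⟨x, hx, S, n, p, -, hS⟩ := hG.exists_pathOn (z := s') (Set.mem_univ v) (Set.mem_univ s)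
    (fun h => hv (h ▸ hs')) hss' hs
  have p' := p.reverse
  cases p' with
  | nil => exact absurd hx hv
  | @cons S _ u _ n h p' hxS =>
    have hu : u ∉ W := fun h => hxS (hS u (Or.inr p'.left_mem) h ▸ p'.left_mem)
    obtain ⟨t, ht, htx⟩ : ∃ t ∈ W, t ≠ x := by
      by_cases h : s = x
      · exact ⟨s', hs', h ▸ hss'.symm⟩
      · exact ⟨s, hs, h⟩
    obtain ⟨y, hy, Q, m, pQ, hxQ, hQ⟩ := hG.exists_pathOn (Y := W) (Set.mem_univ u)
      (Set.mem_univ t) h.ne' htx ht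
    refine ⟨x, hx, y, hy, fun h => hxQ (h ▸ pQ.right_mem), _, _, pQ.cons h hxQ, ?_, u,
      Or.inr pQ.left_mem, hu⟩
    rintro z (rfl | hz) hzW
    · exact Or.inl rfl
    · exact Or.inr (hQ z hz hzW)

theorem exists_block_with_odd_ear [Finite V] (hG : G.BlockOn Set.univ) (hG2 : ¬ G.Colorable 2)
    {S : Set V} {χ₀ : V → ZMod 2} (hS : S.Nontrivial) (hB : (G.cut S χ₀).BlockOn S) :
    ∃ (W : Set V) (χ : V → ZMod 2), S ⊆ W ∧ (∀ a ∈ S, χ a = χ₀ a) ∧ (G.cut W χ).BlockOn W ∧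
      ∃ x ∈ W, ∃ y ∈ W, x ≠ y ∧ ∃ (P : Set V) (q : ℕ), G.PathOn P x y q ∧
        (∀ z ∈ P, z ∈ W → z = x ∨ z = y) ∧ χ y = χ x + q + 1 := by
  classical
  let 𝒲 : Set (Set V) := {W | ∃ χ : V → ZMod 2, S ⊆ W ∧ (∀ a ∈ S, χ a = χ₀ a) ∧
    (G.cut W χ).BlockOn W}
  obtain ⟨W, ⟨χ, hSW, hχ, hW⟩, hmax⟩ := (Set.toFinite 𝒲).exists_maximal
    ⟨S, χ₀, le_rfl, fun _ _ => rfl, hB⟩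
  refine ⟨W, χ, hSW, hχ, hW, ?_⟩
  by_cases hWu : W = Set.univ
  · subst hWu
    by_contra hcon
    refine hG2 ⟨Coloring.mk (fun v => (χ v : ZMod 2)) fun {x y} hxy he => hcon ?_⟩
    refine ⟨x, trivial, y, trivial, hxy.ne, _, _, .of_adj hxy, fun z hz _ => hz, ?_⟩
    have two : (2 : ZMod 2) = 0 := by decide
    replace he : χ x = χ y := he
    push_cast
    linear_combination -he - two
  · obtain ⟨v, hv⟩ := (Set.ne_univ_iff_exists_notMem _).mp hWu
    obtain ⟨s, hs, s', hs', hss'⟩ := hS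
    obtain ⟨x, hx, y, hy, hxy, P, q, pP, hP, u, hu, huW⟩ :=
      exists_ear hG (hSW hs) (hSW hs') hss' hv
    refine ⟨x, hx, y, hy, hxy, P, q, pP, hP, ?_⟩
    by_contra hne
    have heven : χ y = χ x + q := by
      have : ∀ a b : ZMod 2, a ≠ b + 1 → a = b := by decide
      exact this _ _ hne
    obtain ⟨χ', hχx, pP'⟩ := pP.exists_coloring (χ x)
    have hχy : χ' y = χ y := by
      rw [heven, ← hχx]
      exact pP'.color_eq fun _ _ _ _ h => h.2.2.2
    set χ'' : V → ZMod 2 := fun z => if z ∈ W then χ z else χ' z with hχ''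
    have eW : ∀ z ∈ W, χ'' z = χ z := fun z hz => if_pos hz
    have eP : ∀ z ∈ P, χ'' z = χ' z := by
      intro z hz
      by_cases hzW : z ∈ W
      · rw [eW z hzW]
        obtain rfl | rfl := hP z hz hzW
        · exact hχx.symm
        · exact hχy.symm
      · exact if_neg hzW
    have hmem : W ∪ P ∈ 𝒲 := by
      refine ⟨χ'', hSW.trans Set.subset_union_left, fun a ha => ?_, ?_⟩
      · rw [eW a (hSW ha), hχ a ha]
      · refine hW.union ?_ (pP'.mono ?_) hx hy
        · rintro a b ⟨h, ha, hb, hab⟩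
          exact ⟨h, Or.inl ha, Or.inl hb, by rw [eW a ha, eW b hb, hab]⟩
        · rintro a ha b hb ⟨h, -, -, hab⟩
          exact ⟨h, Or.inr ha, Or.inr hb, by rw [eP a ha, eP b hb, hab]⟩
    exact huW (hmax hmem Set.subset_union_left (Or.inr hu))

open Classical in
/-- The number of ordered pairs of adjacent vertices of `S`. -/
noncomputable def dartCount (G : SimpleGraph V) (S : Finset V) : ℕ :=
  ((S ×ˢ S).filter fun p => G.Adj p.1 p.2).card

open Classical in
theorem dartCount_le_of_degenerate {S : Finset V} {d : ℕ}
    (h : ∀ U ⊆ S, U.Nonempty → ∃ u ∈ U, (U.filter (G.Adj u)).card < d) :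
    G.dartCount S ≤ 2 * d * S.card := by
  induction S using Finset.strongInduction with
  | H S ih =>
    rcases S.eq_empty_or_nonempty with rfl | hS
    · simp [dartCount]
    · obtain ⟨u, hu, hd⟩ := h S le_rfl hS
      have h1 := ih _ (Finset.erase_ssubset hu) fun U hU => h U (hU.trans (Finset.erase_subset _ _))
      have h2 : ((S ×ˢ S).filter fun p => G.Adj p.1 p.2) ⊆
          (((S.erase u ×ˢ S.erase u).filter fun p => G.Adj p.1 p.2) ∪
            (S.filter (G.Adj u)).image fun v => (u, v)) ∪
            (S.filter (G.Adj u)).image fun v => (v, u) := by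
        rintro ⟨a, b⟩ hab
        simp only [Finset.mem_filter, Finset.mem_product, Finset.mem_union, Finset.mem_erase,
          Finset.mem_image, Prod.mk.injEq] at hab ⊢
        by_cases ha : a = u
        · subst ha
          exact Or.inl (Or.inr ⟨b, ⟨hab.1.2, hab.2⟩, rfl, rfl⟩)
        · by_cases hb : b = u
          · subst hb
            exact Or.inr ⟨a, ⟨hab.1.1, hab.2.symm⟩, rfl, rfl⟩
          · exact Or.inl (Or.inl ⟨⟨⟨ha, hab.1.1⟩, hb, hab.1.2⟩, hab.2⟩)
      have h3 := Finset.card_le_card h2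
      have h4 := Finset.card_union_le (((S.erase u ×ˢ S.erase u).filter fun p => G.Adj p.1 p.2) ∪
            (S.filter (G.Adj u)).image fun v => (u, v)) ((S.filter (G.Adj u)).image fun v => (v, u))
      have h5 := Finset.card_union_le ((S.erase u ×ˢ S.erase u).filter fun p => G.Adj p.1 p.2)
            ((S.filter (G.Adj u)).image fun v => (u, v))
      have h6 := Finset.card_image_le (s := S.filter (G.Adj u)) (f := fun v => (u, v))
      have h7 := Finset.card_image_le (s := S.filter (G.Adj u)) (f := fun v => (v, u))
      have h8 := Finset.card_erase_add_one hu
      rw [dartCount] at h1 ⊢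
      rw [← h8, mul_add, mul_one]
      omega

theorem exists_blockOn_of_dartCount [Fintype V] {K : ℕ} (hK : 0 < K) [Nonempty V]
    {χ : V → ZMod 2} (h : 2 * K * Fintype.card V ≤ (G.cut Set.univ χ).dartCount Finset.univ) :
    ∃ S : Finset V, (S : Set V).Nontrivial ∧ K * S.card < (G.cut Set.univ χ).dartCount S ∧
      (G.cut S χ).BlockOn S := by
  classical
  set B := G.cut Set.univ χ with hBdef
  let 𝒮 : Set (Finset V) := {S | S.Nonempty ∧ 2 * K * S.card < B.dartCount S + 2 * K}
  obtain ⟨S, ⟨hne, hS⟩, hmin⟩ := (Set.toFinite 𝒮).exists_minimal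
    ⟨Finset.univ, Finset.univ_nonempty, by rw [Finset.card_univ]; omega⟩
  have hlt : ∀ T ⊂ S, T.Nonempty → B.dartCount T + 2 * K ≤ 2 * K * T.card := by
    intro T hT hTne
    by_contra! hcon
    exact hT.2 (hmin ⟨hTne, hcon⟩ hT.1)
  have hcard : 2 ≤ S.card := by
    by_contra! hlt
    have : S.card = 1 := by have := hne.card_pos; omega
    obtain ⟨a, rfl⟩ := Finset.card_eq_one.mp this
    have : B.dartCount {a} = 0 := by simp [dartCount, Finset.filter_singleton]
    simp [this] at hS
  refine ⟨S, ?_, ?_, ?_⟩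
  · exact Finset.nontrivial_coe.mp (Finset.one_lt_card_iff_nontrivial.mp (by omega))
  · nlinarith
  · intro z u hu v hv huz hvz
    by_contra hR
    set R := Relation.ReflTransGen fun a b => (G.cut S χ).Adj a b ∧ a ≠ z ∧ b ≠ z with hRdef
    have hRz : ∀ w, R u w → w ≠ z := by
      intro w hw
      rcases Relation.ReflTransGen.cases_tail hw with h | ⟨_, _, h⟩
      · exact h ▸ huz
      · exact h.2.2
    have hstep : ∀ a ∈ S, ∀ b ∈ S, B.Adj a b → R u a → b = z ∨ R u b := by
      intro a ha b hb hab hua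
      by_cases hbz : b = z
      · exact Or.inl hbz
      · exact Or.inr (hua.tail ⟨⟨hab.1, ha, hb, hab.2.2.2⟩, hRz a hua, hbz⟩)
    set T₁ := S.filter fun w => w = z ∨ R u w
    set T₂ := S.filter fun w => ¬ R u w
    have h1 := hlt T₁ (Finset.filter_ssubset.mpr ⟨v, hv, by tauto⟩)
      ⟨u, Finset.mem_filter.mpr ⟨hu, Or.inr .refl⟩⟩
    have h2 := hlt T₂ (Finset.filter_ssubset.mpr ⟨u, hu, not_not.mpr .refl⟩)
      ⟨v, Finset.mem_filter.mpr ⟨hv, hR⟩⟩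
    have h3 : B.dartCount S ≤ B.dartCount T₁ + B.dartCount T₂ := by
      refine le_trans (Finset.card_le_card ?_) (Finset.card_union_le _ _)
      rintro ⟨a, b⟩ hab
      simp only [T₁, T₂, Finset.mem_filter, Finset.mem_product, Finset.mem_union] at hab ⊢
      have := hstep a hab.1.1 b hab.1.2 hab.2
      have := hstep b hab.1.2 a hab.1.1 hab.2.symm
      tauto
    have h4 : T₁.card + T₂.card ≤ S.card + 1 := by
      rw [← Finset.card_union_add_card_inter]
      refine add_le_add (Finset.card_le_card (by grind)) ?_
      rw [← Finset.card_singleton z]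
      exact Finset.card_le_card (by grind)
    have h5 := Nat.mul_le_mul_left (2 * K) h4
    rw [mul_add, mul_add] at h5
    omega

open Classical in
theorem exists_layers {S : Finset V} {d : V → ℕ} {D : ℕ}
    (hd : ∀ a ∈ S, ∀ b ∈ S, G.Adj a b → d b = d a + 1 ∨ d a = d b + 1)
    (h : 4 * D * S.card < G.dartCount S) :
    ∃ i, ∃ U ⊆ S, U.Nonempty ∧ (∀ u ∈ U, d u = i ∨ d u = i + 1) ∧
      ∀ u ∈ U, D ≤ (U.filter (G.Adj u)).card := by
  by_contra! hcon
  set N := S.sup d + 1 with hN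
  have hdN : ∀ a ∈ S, d a < N := fun a ha => Nat.lt_succ_of_le (Finset.le_sup ha)
  set L := fun i => S.filter fun a => d a = i ∨ d a = i + 1 with hL
  have h1 : ∀ i, G.dartCount (L i) ≤ 2 * D * (L i).card := by
    intro i
    refine dartCount_le_of_degenerate fun U hU hne => ?_
    exact hcon i U (hU.trans (Finset.filter_subset _ _)) hne
      fun u hu => (Finset.mem_filter.mp (hU hu)).2
  have h2 : G.dartCount S ≤ ∑ i ∈ Finset.range N, G.dartCount (L i) := by
    refine le_trans (Finset.card_le_card ?_) Finset.card_biUnion_le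
    rintro ⟨a, b⟩ hab
    simp only [hL, Finset.mem_filter, Finset.mem_product, Finset.mem_biUnion,
      Finset.mem_range] at hab ⊢
    have := hdN a hab.1.1
    have := hdN b hab.1.2
    rcases hd a hab.1.1 b hab.1.2 hab.2 with h | h
    · exact ⟨d a, by omega, ⟨⟨hab.1.1, by omega⟩, hab.1.2, by omega⟩, hab.2⟩
    · exact ⟨d b, by omega, ⟨⟨hab.1.1, by omega⟩, hab.1.2, by omega⟩, hab.2⟩
  have h3 : ∀ i, (L i).card ≤
      (S.filter fun a => d a = i).card + (S.filter fun a => d a = i + 1).card := by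
    intro i
    rw [hL]
    simp only [Finset.filter_or]
    exact Finset.card_union_le _ _
  have h4 : ∀ c, ∑ i ∈ Finset.range N, (S.filter fun a => d a = i + c).card ≤ S.card := by
    intro c
    rw [← Finset.card_biUnion]
    · exact Finset.card_le_card (Finset.biUnion_subset.mpr fun i _ => Finset.filter_subset _ _)
    · intro i _ j _ hij
      rw [Function.onFun, Finset.disjoint_left]
      intro a ha ha'
      simp only [Finset.mem_filter] at ha ha'
      omega
  have h5 : ∑ i ∈ Finset.range N, (L i).card ≤ 2 * S.card := by
    refine (Finset.sum_le_sum fun i _ => h3 i).trans ?_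
    rw [Finset.sum_add_distrib]
    have := h4 0
    have := h4 1
    simp only [add_zero] at *
    omega
  have h6 : ∑ i ∈ Finset.range N, G.dartCount (L i) ≤ 2 * D * ∑ i ∈ Finset.range N, (L i).card := by
    rw [Finset.mul_sum]
    exact Finset.sum_le_sum fun i _ => h1 i
  have h7 := Nat.mul_le_mul_left (2 * D) h5
  have h8 : 2 * D * (2 * S.card) = 4 * D * S.card := by ring
  omega

end SimpleGraph

namespace SimpleGraph

variable {V : Type*} {G H : SimpleGraph V}

open Classical in
theorem dartCount_insert {S : Finset V} {u : V} (hu : u ∉ S) :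
    G.dartCount (insert u S) = G.dartCount S + 2 * (S.filter (G.Adj u)).card := by
  have h : (((insert u S) ×ˢ (insert u S)).filter fun p => G.Adj p.1 p.2) =
      ((S ×ˢ S).filter fun p => G.Adj p.1 p.2) ∪
        (((S.filter (G.Adj u)).image fun v => (u, v)) ∪
          (S.filter (G.Adj u)).image fun v => (v, u)) := by
    ext ⟨a, b⟩
    simp only [Finset.mem_filter, Finset.mem_product, Finset.mem_union, Finset.mem_insert,
      Finset.mem_image, Prod.mk.injEq]
    have h1 := G.adj_comm a b
    have h2 := G.irrefl (v := u)
    grind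
  rw [dartCount, h, Finset.card_union_of_disjoint, Finset.card_union_of_disjoint,
    Finset.card_image_of_injective, Finset.card_image_of_injective, dartCount]
  · ring
  · intro a b; simp
  · intro a b; simp
  · rw [Finset.disjoint_left]
    grind
  · rw [Finset.disjoint_left]
    grind

theorem dartCount_congr {S : Finset V} (h : ∀ a ∈ S, ∀ b ∈ S, G.Adj a b ↔ H.Adj a b) :
    G.dartCount S = H.dartCount S := by
  classical
  refine congrArg Finset.card (Finset.filter_congr fun p hp => ?_)
  rw [Finset.mem_product] at hp
  exact h _ hp.1 _ hp.2

theorem exists_dartCount_le_cut (G : SimpleGraph V) (S : Finset V) :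
    ∃ χ : V → ZMod 2, G.dartCount S ≤ 2 * (G.cut Set.univ χ).dartCount S := by
  classical
  induction S using Finset.induction_on with
  | empty => exact ⟨0, by simp [dartCount]⟩
  | insert u S hu ih =>
    obtain ⟨χ, hχ⟩ := ih
    have hc : ∃ c : ZMod 2, (S.filter (G.Adj u)).card ≤
        2 * ((S.filter (G.Adj u)).filter fun v => χ v = c + 1).card := by
      have h1 := Finset.card_filter_add_card_filter_not (s := S.filter (G.Adj u))
        (fun v => χ v = 0 + 1)
      have h2 : ((S.filter (G.Adj u)).filter fun v => ¬ χ v = 0 + 1) =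
          (S.filter (G.Adj u)).filter fun v => χ v = 1 + 1 := by
        refine Finset.filter_congr fun v _ => ?_
        generalize χ v = c
        revert c; decide
      rw [h2] at h1
      by_contra! hcon
      have := hcon 0
      have := hcon 1
      omega
    obtain ⟨c, hc⟩ := hc
    refine ⟨Function.update χ u c, ?_⟩
    have hne : ∀ v ∈ S, v ≠ u := fun v hv h => hu (h ▸ hv)
    rw [dartCount_insert hu, dartCount_insert hu,
      dartCount_congr (G := G.cut Set.univ (Function.update χ u c)) (H := G.cut Set.univ χ)]
    · have : (S.filter ((G.cut Set.univ (Function.update χ u c)).Adj u)) =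
          (S.filter (G.Adj u)).filter fun v => χ v = c + 1 := by
        rw [Finset.filter_filter]
        refine Finset.filter_congr fun v hv => ?_
        simp [cut, Function.update_of_ne (hne v hv)]
      rw [this]
      omega
    · intro a ha b hb
      simp [cut, Function.update_of_ne (hne a ha), Function.update_of_ne (hne b hb)]

theorem dartCount_univ [Fintype V] : G.dartCount Finset.univ = 2 * Nat.card G.edgeSet := by
  classical
  rw [Nat.card_eq_fintype_card, ← edgeFinset_card, ← sum_degrees_eq_twice_card_edges, dartCount,
    Finset.card_filter, Finset.univ_product_univ, Fintype.sum_prod_type]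
  refine Finset.sum_congr rfl fun v _ => ?_
  rw [← card_neighborFinset_eq_degree, neighborFinset_eq_filter, Finset.card_filter]

theorem blockOn_univ_of_twoConnected [Fintype V] (h : TwoConnected G) : G.BlockOn Set.univ := by
  intro z u _ v _ hu hv
  have key : ∀ a b : ({z}ᶜ : Set V), Relation.ReflTransGen (G.induce ({z}ᶜ : Set V)).Adj a b →
      Relation.ReflTransGen (fun a b => G.Adj a b ∧ a ≠ z ∧ b ≠ z) a.1 b.1 := by
    intro a b hab
    induction hab with
    | refl => exact .refl
    | @tail b c _ h ih => exact ih.tail ⟨h, b.2, c.2⟩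
  exact key ⟨u, hu⟩ ⟨v, hv⟩ ((reachable_iff_reflTransGen _ _).mp ((h.2 z).preconnected _ _))

end SimpleGraph

namespace SimpleGraph

variable {V : Type*} {G H : SimpleGraph V}

theorem exists_parent {x : V} {χ : V → ZMod 2} (hχ : ∀ a b, H.Adj a b → χ b = χ a + 1) :
    ∃ (d : V → ℕ) (π : V → V), (∀ v, H.Reachable x v → d v = 0 → v = x) ∧
      (∀ v, d v ≠ 0 → H.Adj v (π v) ∧ d v = d (π v) + 1) ∧
      ∀ a b, H.Reachable x a → H.Adj a b → d b = d a + 1 ∨ d a = d b + 1 := by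
  have hwalk : ∀ {a b : V} (p : H.Walk a b), χ b = χ a + p.length := by
    intro a b p
    induction p with
    | nil => simp
    | cons h p ih =>
      rw [ih, hχ _ _ h]
      simp only [Walk.length_cons]
      push_cast; ring
  have hpar : ∀ v, H.dist x v ≠ 0 → ∃ w, H.Adj v w ∧ H.dist x v = H.dist x w + 1 := by
    intro v hv
    obtain ⟨-, hr⟩ := dist_ne_zero_iff_ne_and_reachable.mp hv
    obtain ⟨p, hp⟩ := hr.symm.exists_walk_length_eq_dist
    rw [dist_comm] at hp
    cases p with
    | nil => exact absurd dist_self hv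
    | @cons _ w _ h p =>
      refine ⟨w, h, ?_⟩
      have h1 := dist_le p.reverse
      have h2 := (h.symm).diff_dist_adj (u := x)
      simp at h1 hp
      omega
  choose! π hπ using hpar
  refine ⟨H.dist x, π, fun v hv h => (hv.dist_eq_zero_iff.mp h).symm, hπ, fun a b ha hab => ?_⟩
  have h1 := hab.diff_dist_adj (u := x)
  obtain ⟨p, hp⟩ := ha.exists_walk_length_eq_dist
  obtain ⟨q, hq⟩ := (ha.trans hab.reachable).exists_walk_length_eq_dist
  have h2 := hwalk p
  have h3 := hwalk q
  have h4 := hχ _ _ hab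
  rw [hp] at h2
  rw [hq] at h3
  rcases h1 with h1 | h1 | h1
  · rw [h1] at h3
    rw [h4, ← h2] at h3
    simp at h3
  · exact Or.inl h1
  · right
    have : H.dist x a ≠ 0 := by
      intro h0
      rw [h0] at h2
      rw [h1, h0] at h3
      simp only [Nat.zero_sub, Nat.cast_zero, add_zero] at h2 h3
      rw [h4, h2] at h3
      simp at h3
    omega

theorem iterate_depth {d : V → ℕ} {π : V → V}
    (hπ : ∀ v, d v ≠ 0 → H.Adj v (π v) ∧ d v = d (π v) + 1) {v : V} {a : ℕ} (ha : a ≤ d v) :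
    d (π^[a] v) + a = d v := by
  induction a with
  | zero => rfl
  | succ a ih =>
    have := ih (by omega)
    rw [Function.iterate_succ_apply']
    have := (hπ (π^[a] v) (by omega)).2
    omega

theorem pathOn_iterate {d : V → ℕ} {π : V → V}
    (hπ : ∀ v, d v ≠ 0 → H.Adj v (π v) ∧ d v = d (π v) + 1) {v : V} {a : ℕ} (ha : a ≤ d v) :
    H.PathOn ((fun c => π^[c] v) '' Set.Icc 0 a) v (π^[a] v) a := by
  refine PathOn.segment (p := fun c => π^[c] v) (n := a + 1) (i := 0) (j := a) ?_ ?_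
    a.zero_le a.lt_succ_self
  · intro b hb c hc hbc
    have h1 := iterate_depth hπ (v := v) (a := b) (by grind)
    have h2 := iterate_depth hπ (v := v) (a := c) (by grind)
    simp only at hbc
    rw [hbc] at h1
    omega
  · intro c hc
    have h1 := iterate_depth hπ (v := v) (a := c) (by omega)
    rw [Function.iterate_succ_apply']
    exact (hπ _ (by omega)).1

theorem IsTheta.parity {p : ℕ → V} {n m : ℕ} {χ : V → ZMod 2}
    (h : H.IsTheta p n m) (hχ : ∀ a b, H.Adj a b → χ b = χ a + 1) (hm : m < n) :
    Odd m ∧ Even n := by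
  have key : ∀ i < n, χ (p i) = χ (p 0) + i := by
    intro i
    induction i with
    | zero => simp
    | succ i ih =>
      intro hi
      rw [hχ _ _ (h.adj i hi), ih (by omega)]
      push_cast; ring
  constructor
  · have h1 := hχ _ _ h.chord
    rw [key m hm] at h1
    rw [← ZMod.natCast_eq_one_iff_odd]
    exact add_left_cancel h1
  · have h1 := hχ _ _ h.close
    rw [key (n - 1) (by omega)] at h1
    have h2 := ZMod.natCast_eq_one_iff_odd.mp (add_left_cancel h1)
    have : n = (n - 1) + 1 := by omega
    rw [this]
    exact h2.add_one

theorem IsTheta.exists_layer_parity {p : ℕ → V} {n m i : ℕ} {d : V → ℕ} (h : H.IsTheta p n m)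
    (hn : 0 < n) (hd : ∀ a b, H.Adj a b → d b = d a + 1 ∨ d a = d b + 1)
    (hpd : ∀ t < n, d (p t) = i ∨ d (p t) = i + 1) :
    ∃ e < 2, ∀ t < n, d (p t) = i ↔ t % 2 = e := by
  have key : ∀ t < n, d (p t) + t % 2 = d (p 0) ∨ d (p 0) + t % 2 = d (p t) := by
    intro t
    induction t with
    | zero => simp
    | succ t ih =>
      intro ht
      have h1 := ih (by omega)
      have h2 := hd _ _ (h.adj t ht)
      have h3 := hpd t (by omega)
      have h4 := hpd (t + 1) ht
      have h5 := hpd 0 (by omega)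
      omega
  refine ⟨d (p 0) - i, ?_, fun t ht => ?_⟩
  · have h3 := hpd 0 hn
    omega
  · have h1 := key t ht
    have h2 := hpd t ht
    have h3 := hpd 0 (by omega)
    omega

theorem IsTheta.exists_root {p : ℕ → V} {n m k i : ℕ} {W : Set V} {x : V} (hk : 0 < k)
    {d : V → ℕ} {π : V → V} (h : H.IsTheta p n m) (hm : Odd m) (hn : Even n) (hkm : 2 * k ≤ m)
    (hmn : m + 2 * k ≤ n) (hW : ∀ a b, H.Adj a b → a ∈ W ∧ b ∈ W)
    (hx : ∀ v ∈ W, d v = 0 → v = x) (hπ : ∀ v, d v ≠ 0 → H.Adj v (π v) ∧ d v = d (π v) + 1)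
    (hd : ∀ a b, H.Adj a b → d b = d a + 1 ∨ d a = d b + 1)
    (hpW : ∀ t < n, p t ∈ W) (hpd : ∀ t < n, d (p t) = i ∨ d (p t) = i + 1) :
    ∃ (Y : Set V) (r : V), Y ⊆ W ∧ r ∈ Y ∧ (∃ b ∈ Y, b ≠ r) ∧
      (∃ R l, H.PathOn R r x l ∧ ∀ z ∈ R, z ∈ Y → z = r) ∧
      ∀ b ∈ Y, b ≠ r → ∃ C, ∀ s, 0 < s → s ≤ k → ∃ T ⊆ Y, H.PathOn T r b (C + 2 * s) := by
  obtain ⟨e, he, hde⟩ := h.exists_layer_parity (by omega) hd hpd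
  have hdL : ∀ t < n, t % 2 = e → ∀ a ≤ i, d (π^[a] (p t)) + a = i := by
    intro t ht hte a ha
    have := (hde t ht).mpr hte
    rw [iterate_depth hπ (by omega), this]
  have hWi : ∀ t < n, t % 2 = e → ∀ a ≤ i, π^[a] (p t) ∈ W := by
    intro t ht hte a ha
    cases a with
    | zero => exact hpW t ht
    | succ a =>
      rw [Function.iterate_succ_apply']
      have := hdL t ht hte a (by omega)
      exact (hW _ _ (hπ (π^[a] (p t)) (by omega)).1).2
  let const : ℕ → Prop := fun j => ∀ t < n, t % 2 = e → ∀ t' < n, t' % 2 = e →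
    π^[j] (p t) = π^[j] (p t')
  have hconst : const i := by
    intro t ht hte t' ht' hte'
    have h1 := hdL t ht hte i le_rfl
    have h2 := hdL t' ht' hte' i le_rfl
    rw [hx _ (hWi t ht hte i le_rfl) (by omega), hx _ (hWi t' ht' hte' i le_rfl) (by omega)]
  classical
  obtain ⟨j, hj, hjmin⟩ : ∃ j, const j ∧ ∀ a < j, ¬ const a :=
    ⟨Nat.find ⟨i, hconst⟩, Nat.find_spec _, fun a ha => Nat.find_min _ ha⟩
  have hji : j ≤ i := by
    by_contra! hlt
    exact hjmin i hlt hconst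
  have hj0 : j ≠ 0 := by
    rintro rfl
    have h1 := hj e (by omega) (by omega) (e + 2) (by omega) (by omega)
    have h2 := h.injOn (show e < n by omega) (show e + 2 < n by omega) h1
    omega
  set r := π^[j] (p e) with hr
  have hrt : ∀ t < n, t % 2 = e → π^[j] (p t) = r :=
    fun t ht hte => hj t ht hte e (by omega) (by omega)
  have hdr : d r + j = i := hdL e (by omega) (by omega) j hji
  set Y : Set V := {v | (∃ t < n, v = p t) ∨ ∃ t < n, t % 2 = e ∧ ∃ a ≤ j, v = π^[a] (p t)}
    with hY
  have hFY : p '' Set.Iio n ⊆ Y := by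
    rintro _ ⟨t, ht, rfl⟩
    exact Or.inl ⟨t, ht, rfl⟩
  have hup : ∀ t < n, t % 2 = e → ∀ a ≤ j, H.PathOn ((fun c => π^[c] (p t)) '' Set.Icc 0 a)
      (p t) (π^[a] (p t)) a := by
    intro t ht hte a ha
    exact pathOn_iterate hπ (by rw [(hde t ht).mpr hte]; omega)
  have hupY : ∀ t < n, t % 2 = e → ∀ a ≤ j, (fun c => π^[c] (p t)) '' Set.Icc 0 a ⊆ Y := by
    rintro t ht hte a ha _ ⟨c, hc, rfl⟩
    exact Or.inr ⟨t, ht, hte, c, hc.2.trans ha, rfl⟩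
  have hupF : ∀ t < n, t % 2 = e → ∀ a ≤ j, ∀ z ∈ (fun c => π^[c] (p t)) '' Set.Icc 0 a,
      z ∈ p '' Set.Iio n → z = p t := by
    rintro t ht hte a ha _ ⟨c, hc, rfl⟩ ⟨t', ht', hc'⟩
    have h1 := hdL t ht hte c (hc.2.trans (ha.trans hji))
    have h2 := hpd t' ht'
    simp only at hc'
    rw [hc'] at h2
    obtain rfl : c = 0 := by omega
    rfl
  refine ⟨Y, r, ?_, Or.inr ⟨e, by omega, by omega, j, le_rfl, rfl⟩, ?_, ?_, ?_⟩
  · rintro _ (⟨t, ht, rfl⟩ | ⟨t, ht, hte, a, ha, rfl⟩)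
    · exact hpW t ht
    · exact hWi t ht hte a (ha.trans hji)
  · refine ⟨p (1 - e), Or.inl ⟨_, by omega, rfl⟩, fun hb => ?_⟩
    have h1 := hpd (1 - e) (by omega)
    rw [hb] at h1
    omega
  · have h1 : d (π^[d r] r) = 0 := by
      have := iterate_depth hπ (le_refl (d r))
      omega
    have h2 : π^[d r] r = x := by
      refine hx _ ?_ h1
      have h3 := hWi e (by omega) (by omega) (d r + j) hdr.le
      rwa [Function.iterate_add_apply] at h3
    have h3 := pathOn_iterate hπ (le_refl (d r))
    rw [h2] at h3
    refine ⟨_, _, h3, ?_⟩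
    · rintro _ ⟨c, hc, rfl⟩ hcY
      have h1 := iterate_depth hπ hc.2
      have h2 : i ≤ d (π^[c] r) + j := by
        rcases hcY with ⟨t, ht, hc⟩ | ⟨t, ht, hte, a, ha, hc⟩
        · have := hpd t ht
          simp only at hc
          rw [hc]; omega
        · have := hdL t ht hte a (by omega)
          simp only at hc
          rw [hc]; omega
      obtain rfl : c = 0 := by omega
      rfl
  · intro b hb hbr
    have hb' : (∃ t < n, t % 2 ≠ e ∧ b = p t) ∨
        ∃ t < n, t % 2 = e ∧ ∃ a < j, b = π^[a] (p t) := by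
      rcases hb with ⟨t, ht, rfl⟩ | ⟨t, ht, hte, a, ha, rfl⟩
      · by_cases hte : t % 2 = e
        · exact Or.inr ⟨t, ht, hte, 0, by omega, rfl⟩
        · exact Or.inl ⟨t, ht, hte, rfl⟩
      · refine Or.inr ⟨t, ht, hte, a, lt_of_le_of_ne ha ?_, rfl⟩
        rintro rfl
        exact hbr (hrt t ht hte)
    rcases hb' with ⟨t, ht, hte, rfl⟩ | ⟨t, ht, hte, a, ha, rfl⟩
    · refine ⟨j - 1, fun s hs hsk => ?_⟩
      obtain ⟨t', ht', hte', S, hS, q⟩ : ∃ t' < n, t' % 2 = e ∧ ∃ S ⊆ p '' Set.Iio n,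
          H.PathOn S (p t') (p t) (2 * s - 1) := by
        by_cases hts : t + (2 * s - 1) < n
        · refine ⟨t + (2 * s - 1), hts, by omega, p '' Set.Icc t (t + (2 * s - 1)),
            Set.image_mono fun c hc => hc.2.trans_lt hts, ?_⟩
          convert (PathOn.segment h.injOn h.adj (i := t) (by omega) hts).reverse using 1
          omega
        · refine ⟨t - (2 * s - 1), by omega, by omega, p '' Set.Icc (t - (2 * s - 1)) t,
            Set.image_mono fun c hc => hc.2.trans_lt ht, ?_⟩
          convert PathOn.segment h.injOn h.adj (i := t - (2 * s - 1)) (by omega) ht using 1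
          omega
      have q' := hup t' ht' hte' j le_rfl
      rw [hrt t' ht' hte'] at q'
      have q₁ := q'.reverse.append q fun z hz hzS => hupF t' ht' hte' j le_rfl z hz (hS hzS)
      refine ⟨_, Set.union_subset (hupY t' ht' hte' j le_rfl) (hS.trans hFY), ?_⟩
      convert q₁ using 1
      omega
    · refine ⟨a + j, fun s hs hsk => ?_⟩
      set b := π^[a] (p t) with hb_def
      obtain ⟨t', ht', hte', htb⟩ : ∃ t' < n, t' % 2 = e ∧ ¬ π^[a] (p t') = b := by
        by_contra! hcon
        refine hjmin a ha fun t₁ h₁ e₁ t₂ h₂ e₂ => ?_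
        rw [hcon t₁ h₁ e₁, hcon t₂ h₂ e₂]
      obtain ⟨t₁, t₂, h₁, h₂, e₁, e₂, f₁, f₂, S, hS, q⟩ :=
        h.exists_path_of_coloring (f := fun v => π^[a] v = b) hm hn (t := 2 * s) (even_two_mul s)
          (by omega) (by omega) (by omega) ht ht' hte hte' hb_def.symm htb
      have q₁ := hup t₁ h₁ e₁ a ha.le
      have q₂ := hup t₂ h₂ e₂ j le_rfl
      rw [f₁] at q₁
      rw [hrt t₂ h₂ e₂] at q₂
      have q₃ := (q₁.reverse.append q fun z hz hzS => hupF t₁ h₁ e₁ a ha.le z hz (hS hzS)).append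
        q₂ (by
          rintro z (⟨c, hc, rfl⟩ | hz) hz'
          · exfalso
            obtain ⟨c', hc', hcc⟩ := hz'
            simp only at hcc
            have g₁ := hdL t₁ h₁ e₁ c (by grind)
            have g₂ := hdL t₂ h₂ e₂ c' (by grind)
            rw [hcc] at g₂
            obtain rfl : c' = c := by omega
            refine f₂ ?_
            obtain ⟨w, hw⟩ := Nat.exists_eq_add_of_le' hc.2
            rw [hw, Function.iterate_add_apply, hcc, ← Function.iterate_add_apply, ← hw, f₁]
          · exact hupF t₂ h₂ e₂ j le_rfl z hz' (hS hz))
      refine ⟨_, Set.union_subset (Set.union_subset (hupY t₁ h₁ e₁ a ha.le) (hS.trans hFY))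
        (hupY t₂ h₂ e₂ j le_rfl), ?_⟩
      convert q₃.reverse using 1
      omega

theorem exists_cycles_in_progression [Fintype V] (hG : TwoConnected G) (hG2 : ¬ G.Colorable 2)
    {k : ℕ} (hk : 0 < k) (hE : 32 * k * Fintype.card V ≤ Nat.card G.edgeSet) :
    ∃ N, Odd N ∧ ∀ s, 0 < s → s ≤ k → HasCycleOfLength G (N + 2 * s) := by
  classical
  have hcard := hG.1
  have : Nonempty V := Fintype.card_pos_iff.mp (by omega)
  obtain ⟨χ₀, hχ₀⟩ := G.exists_dartCount_le_cut Finset.univ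
  rw [dartCount_univ] at hχ₀
  obtain ⟨S, hS, hSd, hSB⟩ := exists_blockOn_of_dartCount (G := G) (χ := χ₀) (K := 16 * k)
    (by omega) (by have : 2 * (16 * k) * Fintype.card V = 32 * k * Fintype.card V := by ring
                   omega)
  obtain ⟨W, χ, hSW, hχS, hWB, x, hxW, y, hyW, hxy, P, q, hP, hPW, hodd⟩ :=
    exists_block_with_odd_ear (blockOn_univ_of_twoConnected hG) hG2 hS hSB
  set H := G.cut W χ with hH
  have hHG : H ≤ G := cut_le W χ
  have hW : ∀ a b, H.Adj a b → a ∈ W ∧ b ∈ W := fun a b h => ⟨h.2.1, h.2.2.1⟩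
  have hχ : ∀ a b, H.Adj a b → χ b = χ a + 1 := fun a b h => h.2.2.2
  have hHd : 4 * (4 * k) * S.card < H.dartCount S := by
    rw [← dartCount_congr (G := G.cut Set.univ χ₀)]
    · convert hSd using 2; ring
    · intro a ha b hb
      simp [hH, cut, hχS a ha, hχS b hb, hSW ha, hSW hb]
  have hreach : ∀ v ∈ W, H.Reachable x v := by
    intro v hv
    obtain ⟨z, hz⟩ : ∃ z, z ∉ ({x, v} : Finset V) := by
      by_contra! hcon
      have h1 := Finset.card_le_card (fun z _ => hcon z : Finset.univ ⊆ ({x, v} : Finset V))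
      have h2 := Finset.card_le_two (a := x) (b := v)
      rw [Finset.card_univ] at h1
      omega
    simp only [Finset.mem_insert, Finset.mem_singleton, not_or] at hz
    rw [reachable_iff_reflTransGen]
    exact Relation.ReflTransGen.mono (fun a b h => h.1) _ _
      (hWB z x hxW v hv (Ne.symm hz.1) (Ne.symm hz.2))
  obtain ⟨d, π, hdx, hπ, hd⟩ := exists_parent (x := x) hχ
  have hd' : ∀ a b, H.Adj a b → d b = d a + 1 ∨ d a = d b + 1 :=
    fun a b hab => hd a b (hreach a (hW a b hab).1) hab
  obtain ⟨i, U, hUS, hU, hUi, hUdeg⟩ := exists_layers (fun a _ b _ hab => hd' a b hab) hHd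
  obtain ⟨p, n, m, hp, hpU, hkm, hmn⟩ := exists_isTheta_of_le_degree hk hU (by convert hUdeg)
  obtain ⟨hm, hn⟩ := hp.parity hχ (by omega)
  obtain ⟨Y, r, hYW, hrY, hYr, ⟨R, l, hR, hRY⟩, hpath⟩ := hp.exists_root hk hm hn hkm hmn hW
    (fun v hv => hdx v (hreach v hv)) hπ hd' (fun t ht => hSW (hUS (hpU t ht)))
    (fun t ht => hUi _ (hpU t ht))
  obtain ⟨b, hb, hbr, M, μ, hM, hMY, hμ⟩ := exists_odd_handle hHG hW hχ hWB hyW hxy hP hPW hodd l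
    Y r hYW hrY hYr R hR hRY
  obtain ⟨C, hC⟩ := hpath b hb hbr
  have hoddC : Odd (μ + C) := by
    obtain ⟨T, -, hT⟩ := hC 1 (by omega) (by omega)
    have h1 := hT.color_eq fun a _ b _ => hχ a b
    rw [h1] at hμ
    rw [← ZMod.natCast_eq_one_iff_odd]
    have two : (2 : ZMod 2) = 0 := by decide
    push_cast at hμ ⊢
    linear_combination C * two - hμ
  refine ⟨μ + C, hoddC, fun s hs hsk => ?_⟩
  obtain ⟨T, hTY, hT⟩ := hC s hs hsk
  have := hM.hasCycleOfLength_add (hT.mono fun _ _ _ _ h => hHG h) hbr.symm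
    (fun z hz hz' => hMY z hz (hTY hz')) (by have := hoddC.pos; omega)
  rwa [← add_assoc] at this

end SimpleGraph

theorem cycles_of_all_odd_lengths_mod_k :
    ∃ c : ℝ, 0 < c ∧ ∀ k : ℕ, 1 ≤ k →
      ∀ (V : Type) [Fintype V] (G : SimpleGraph V),
        ¬ G.Colorable 2 →                       -- `G` is not bipartite
        TwoConnected G →
        c * k * (Fintype.card V) ≤ 2 * (Nat.card G.edgeSet) →  -- average degree ≥ c * k
        (∀ m : ℤ, Odd m →
          ∃ n : ℕ, HasCycleOfLength G n ∧ (n : ℤ) ≡ m [ZMOD (k : ℤ)]) ∧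
        (Odd k → ∀ m : ℤ,
          ∃ n : ℕ, HasCycleOfLength G n ∧ (n : ℤ) ≡ m [ZMOD (k : ℤ)]) := by
  refine ⟨64, by norm_num, fun k hk V _ G hG2 hG hE => ?_⟩
  have hE' : 32 * k * Fintype.card V ≤ Nat.card G.edgeSet := by
    have : (32 * k * Fintype.card V : ℝ) ≤ Nat.card G.edgeSet := by linarith
    exact_mod_cast this
  obtain ⟨N, hN, hcyc⟩ := SimpleGraph.exists_cycles_in_progression hG hG2 hk hE'
  have hk0 : (0 : ℤ) < k := by exact_mod_cast hk
  have hodd : ∀ m : ℤ, Odd m →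
      ∃ n : ℕ, HasCycleOfLength G n ∧ (n : ℤ) ≡ m [ZMOD (k : ℤ)] := by
    intro m hm
    obtain ⟨w, hw⟩ := hm.sub_odd (show Odd (N : ℤ) by exact_mod_cast hN)
    have h0 := Int.emod_nonneg (w - 1) hk0.ne'
    have h1 := Int.emod_lt_of_pos (w - 1) hk0
    refine ⟨N + 2 * (((w - 1) % k).toNat + 1), hcyc _ (by omega) (by omega), ?_⟩
    push_cast
    rw [Int.toNat_of_nonneg h0]
    have h2 : (w - 1) % k ≡ w - 1 [ZMOD (k : ℤ)] := Int.mod_modEq _ _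
    have h3 := ((h2.add_right 1).mul_left 2).add_left (N : ℤ)
    have h4 : (N : ℤ) + 2 * (w - 1 + 1) = m := by linarith
    rwa [h4] at h3
  refine ⟨hodd, fun hk_odd m => ?_⟩
  rcases Int.even_or_odd m with hm | hm
  · obtain ⟨n, hn, hnm⟩ := hodd (m + k) (hm.add_odd (by exact_mod_cast hk_odd))
    exact ⟨n, hn, hnm.trans (by simp)⟩
  · exact hodd m hm
end

section
/- There exists an absolute constant d > 0 such that for every natural number k ≥ 1, every non-bipartite 2-connected finite simple graph with minimum degree at least d·k contains cycles of all lengths modulo k; that is, for every integer m there is a cycle whose length is congruent to m modulo k. -/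
namespace SimpleGraph

open Finset Classical

/-- There is a path of length `n` from `u` to `v` in `G` all of whose vertices lie in `S`. -/
def PathIn {V : Type*} (G : SimpleGraph V) (S : Set V) (u v : V) (n : ℕ) : Prop :=
  ∃ p : G.Walk u v, p.IsPath ∧ p.length = n ∧ ∀ w ∈ p.support, w ∈ S

/-- The vertex set `K` induces a connected (or empty) subgraph of `G`, expressed through cuts. -/
def ConnIn {V : Type*} (G : SimpleGraph V) (K : Finset V) : Prop :=
  ∀ S ⊆ K, S.Nonempty → (∀ u ∈ S, ∀ v ∈ K, G.Adj u v → v ∈ S) → S = K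

section Paths

variable {V : Type*} {G : SimpleGraph V} {S T : Set V} {u v w x : V} {m n : ℕ}

theorem PathIn.mono (h : G.PathIn S u v n) (hST : S ⊆ T) : G.PathIn T u v n := by
  obtain ⟨p, hp, hn, hS⟩ := h
  exact ⟨p, hp, hn, fun w hw => hST (hS w hw)⟩

theorem PathIn.mono_graph {H : SimpleGraph V} (h : G.PathIn S u v n) (hGH : G ≤ H) :
    H.PathIn S u v n := by
  obtain ⟨p, hp, hn, hS⟩ := h
  exact ⟨p.mapLe hGH, hp.mapLe hGH, by simpa using hn, by simpa using hS⟩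

theorem PathIn.refl (hu : u ∈ S) : G.PathIn S u u 0 :=
  ⟨Walk.nil, Walk.IsPath.nil, rfl, by simpa using hu⟩

theorem PathIn.symm (h : G.PathIn S u v n) : G.PathIn S v u n := by
  obtain ⟨p, hp, hn, hS⟩ := h
  exact ⟨p.reverse, hp.reverse, by simpa using hn, by simpa using hS⟩

theorem PathIn.left_mem (h : G.PathIn S u v n) : u ∈ S := by
  obtain ⟨p, hp, hn, hS⟩ := h
  exact hS u p.start_mem_support

theorem PathIn.right_mem (h : G.PathIn S u v n) : v ∈ S := h.symm.left_mem

theorem Walk.IsPath.append_of_inter {p : G.Walk u v} {q : G.Walk v w} (hp : p.IsPath)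
    (hq : q.IsPath) (h : ∀ x ∈ p.support, x ∈ q.support → x = v) : (p.append q).IsPath := by
  induction p with
  | nil => simpa using hq
  | cons e p ih =>
    rw [Walk.cons_isPath_iff] at hp
    rw [Walk.cons_append, Walk.cons_isPath_iff]
    refine ⟨ih hp.1 hq fun x hx => h x (by simp [hx]), fun hmem => ?_⟩
    rw [Walk.mem_support_append_iff] at hmem
    rcases hmem with hmem | hmem
    · exact hp.2 hmem
    · have := h _ (by simp) hmem
      subst this
      exact hp.2 p.end_mem_support

theorem PathIn.trans (h : G.PathIn S u v n) (h' : G.PathIn T v w m) (hST : S ∩ T ⊆ {v}) :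
    G.PathIn (S ∪ T) u w (n + m) := by
  obtain ⟨p, hp, hn, hS⟩ := h
  obtain ⟨q, hq, hm, hT⟩ := h'
  refine ⟨p.append q, hp.append_of_inter hq fun x hx hx' => hST ⟨hS x hx, hT x hx'⟩,
    by simp [hn, hm], fun x hx => ?_⟩
  rw [Walk.mem_support_append_iff] at hx
  exact hx.imp (hS x) (hT x)

theorem PathIn.of_adj (h : G.Adj u v) : G.PathIn {u, v} u v 1 :=
  ⟨Walk.cons h Walk.nil, by simp [h.ne], rfl, by simp⟩

theorem PathIn.trans_adj (h : G.PathIn S u v n) (hvw : G.Adj v w) (h' : G.PathIn T w x m)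
    (hST : Disjoint S T) : G.PathIn (S ∪ T) u x (n + m + 1) := by
  have h1 : G.PathIn ({v} ∪ T) v x (1 + m) := by
    refine ((PathIn.of_adj hvw).trans h' ?_).mono ?_
    · rintro y ⟨hy | hy, hy'⟩
      · exact absurd (hy ▸ hy') (Set.disjoint_left.1 hST h.right_mem)
      · exact hy
    · rintro y ((hy | hy) | hy)
      · exact Or.inl hy
      · exact Or.inr (by rw [Set.mem_singleton_iff.1 hy]; exact h'.left_mem)
      · exact Or.inr hy
  have h2 := (h.trans h1 ?_).mono (T := S ∪ T) ?_
  · rwa [show n + m + 1 = n + (1 + m) by ring]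
  · rintro y ⟨hy, hy' | hy'⟩
    · exact hy'
    · exact absurd hy' (Set.disjoint_left.1 hST hy)
  · rintro y (hy | hy | hy)
    · exact Or.inl hy
    · exact Or.inl (by rw [Set.mem_singleton_iff.1 hy]; exact h.right_mem)
    · exact Or.inr hy

theorem PathIn.hasCycleOfLength (h : G.PathIn S u v n) (h' : G.PathIn T v u m) (hn : 2 ≤ n)
    (hST : S ∩ T ⊆ {u, v}) : HasCycleOfLength G (n + m) := by
  obtain ⟨p, hp, rfl, hS⟩ := h
  obtain ⟨q, hq, rfl, hT⟩ := h'
  cases p with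
  | nil => simp at hn
  | @cons _ w _ e p =>
    rw [Walk.cons_isPath_iff] at hp
    have hwv : w ≠ v := by
      rintro rfl
      have := Walk.length_eq_zero_iff.2 (Walk.isPath_iff_nil.1 hp.1)
      simp [this] at hn
    have hr : (p.append q).IsPath := by
      refine hp.1.append_of_inter hq fun x hx hx' => ?_
      rcases hST ⟨hS x (by simp [hx]), hT x hx'⟩ with h | h
      · exact absurd (h ▸ hx) hp.2
      · exact h
    refine ⟨u, Walk.cons e (p.append q), ?_, by simp; ring⟩
    rw [Walk.cons_isCycle_iff]
    refine ⟨hr, fun he => ?_⟩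
    rw [Walk.edges_append, List.mem_append] at he
    rcases he with he | he
    · exact hp.2 (p.fst_mem_support_of_mem_edges he)
    · rcases hST ⟨hS w (by simp), hT w (q.snd_mem_support_of_mem_edges he)⟩ with h | h
      · exact e.ne h.symm
      · exact hwv h

theorem PathIn.even_iff {χ : V → Bool} (hχ : ∀ u v, G.Adj u v → χ u ≠ χ v)
    (h : G.PathIn S u v n) : Even n ↔ χ u = χ v := by
  obtain ⟨p, -, rfl, -⟩ := h
  induction p with
  | nil => simp
  | cons e p ih =>
    have := hχ _ _ e
    rw [Walk.length_cons, Nat.even_add_one, ih]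
    cases h1 : χ _ <;> cases h2 : χ _ <;> simp_all

/-- From a vertex `b` next to a connected set `K` one can walk through `K` up to the neighbourhood
of a nonempty subset `X`, without entering `X` and meeting the neighbourhood only at the end. -/
theorem ConnIn.exists_pathIn {K X : Finset V} {b : V} (hK : G.ConnIn K)
    (hadj : ∃ u ∈ K, G.Adj b u) (hXK : X ⊆ K) (hX : X.Nonempty) :
    ∃ (b' : V) (Q : Set V) (n : ℕ), G.PathIn Q b b' n ∧ (∀ w ∈ Q, w = b ∨ w ∈ K ∧ w ∉ X) ∧
      (∃ x ∈ X, G.Adj b' x) ∧ ∀ w ∈ Q, w ≠ b' → ∀ x ∈ X, ¬ G.Adj w x := by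
  have key : ∃ (n : ℕ) (b' : V) (p : G.Walk b b'), p.length = n ∧
      (∀ w ∈ p.support, w = b ∨ w ∈ K ∧ w ∉ X) ∧ ∃ x ∈ X, G.Adj b' x := by
    by_contra! hcon
    let R := K.filter fun v => v ∉ X ∧
      ∃ p : G.Walk b v, ∀ w ∈ p.support, w = b ∨ w ∈ K ∧ w ∉ X
    have hR : R = K := by
      refine hK R (filter_subset _ _) ?_ ?_
      · obtain ⟨u, hu, hbu⟩ := hadj
        have huX : u ∉ X := fun h => hcon 0 b Walk.nil rfl (by simp) u h hbu
        refine ⟨u, mem_filter.2 ⟨hu, huX, Walk.cons hbu Walk.nil, ?_⟩⟩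
        simp [hu, huX]
      · intro u hu v hv huv
        obtain ⟨huK, huX, p, hp⟩ := mem_filter.1 hu
        have hvX : v ∉ X := fun h => hcon _ u p rfl hp v h huv
        refine mem_filter.2 ⟨hv, hvX, p.concat huv, ?_⟩
        intro w hw
        rw [Walk.support_concat, List.mem_append, List.mem_singleton] at hw
        rcases hw with hw | rfl
        · exact hp w hw
        · exact Or.inr ⟨hv, hvX⟩
    obtain ⟨x, hx⟩ := hX
    have := hXK hx
    rw [← hR] at this
    exact (mem_filter.1 this).2.1 hx
  obtain ⟨b', p, hlen, hp, hb'⟩ := Nat.find_spec key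
  refine ⟨b', {w | w ∈ p.bypass.support}, _, ⟨p.bypass, p.bypass_isPath, rfl, fun w hw => hw⟩,
    fun w hw => hp w (p.support_bypass_subset_support hw), hb', ?_⟩
  intro w hw hne x hx hwx
  have hmin := Nat.find_min' key ⟨w, p.bypass.takeUntil w hw, rfl,
    fun z hz => hp z (p.support_bypass_subset_support (Walk.support_takeUntil_subset_support _ _ hz)), x, hx, hwx⟩
  have h1 := Walk.length_takeUntil_lt_length hw hne
  have h2 := p.length_bypass_le_length
  omega

/-- If every vertex of `X` has at least `m` neighbours in `X` on the other side of the cut given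
by `R`, then `X` contains paths of all lengths `n < m` alternating across the cut. -/
theorem exists_alternating_pathIn {X : Finset V} (R : Finset V) {m : ℕ}
    (hX : ∀ v ∈ X, m ≤ #{w ∈ X | G.Adj v w ∧ (v ∈ R ↔ w ∉ R)}) {v : V} (hv : v ∈ X) (n : ℕ)
    (hn : n ≤ m) : ∃ u, G.PathIn X v u n ∧ ((u ∈ R ↔ v ∈ R) ↔ Even n) := by
  induction n with
  | zero => exact ⟨v, PathIn.refl hv, by simp⟩
  | succ n ih =>
    obtain ⟨u, ⟨p, hp, hlen, hpX⟩, hpar⟩ := ih (by omega)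
    have hu : u ∈ X := hpX u p.end_mem_support
    have hcard : #(p.support.toFinset.erase u) < #{w ∈ X | G.Adj u w ∧ (u ∈ R ↔ w ∉ R)} := by
      rw [card_erase_of_mem (by simp), List.toFinset_card_of_nodup hp.support_nodup,
        Walk.length_support]
      have := hX u hu
      omega
    obtain ⟨w, hw, hw'⟩ := exists_mem_notMem_of_card_lt_card hcard
    obtain ⟨hwX, huw, hR⟩ := mem_filter.1 hw
    have hwp : w ∉ p.support := fun h => hw' (by simp [h, huw.ne'])
    refine ⟨w, ⟨p.concat huw, hp.concat hwp huw, by simp [hlen], ?_⟩, ?_⟩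
    · intro z hz
      rw [Walk.support_concat, List.mem_append, List.mem_singleton] at hz
      rcases hz with hz | rfl
      · exact hpX z hz
      · exact hwX
    · rw [Nat.even_add_one, ← hpar]
      tauto

end Paths

section Counting

variable {V : Type*}

/-- Either a symmetric relation has a nonempty subset of `K` of minimum degree at least `m`, or it
has at most `m * #K` edges on `K`. -/
theorem exists_min_degree_or_sum_le {r : V → V → Prop} (hr : ∀ u v, r u v → r v u) (m : ℕ)
    (K : Finset V) :
    (∃ X ⊆ K, X.Nonempty ∧ ∀ v ∈ X, m ≤ #{w ∈ X | r v w}) ∨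
      ∑ v ∈ K, #{w ∈ K | r v w} ≤ 2 * m * #K := by
  induction K using Finset.strongInduction with
  | H K ih =>
  rcases K.eq_empty_or_nonempty with rfl | hK
  · simp
  by_cases hmin : ∀ v ∈ K, m ≤ #{w ∈ K | r v w}
  · exact Or.inl ⟨K, Subset.rfl, hK, hmin⟩
  push Not at hmin
  obtain ⟨v, hv, hdeg⟩ := hmin
  rcases ih (K.erase v) (erase_ssubset hv) with ⟨X, hXK, hX⟩ | hsum
  · exact Or.inl ⟨X, hXK.trans (erase_subset _ _), hX⟩
  refine Or.inr ?_
  have hstep : ∀ u ∈ K.erase v,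
      #{w ∈ K | r u w} ≤ #{w ∈ K.erase v | r u w} + if r v u then 1 else 0 := by
    intro u _
    split_ifs with h
    · rw [filter_erase]
      have := pred_card_le_card_erase (s := {w ∈ K | r u w}) (a := v)
      omega
    · refine card_le_card fun w hw => ?_
      rw [mem_filter] at hw
      rw [mem_filter, mem_erase]
      refine ⟨⟨?_, hw.1⟩, hw.2⟩
      rintro rfl
      exact h (hr _ _ hw.2)
  have hsum' := sum_le_sum hstep
  rw [sum_add_distrib, ← card_filter] at hsum'
  have hle : #{u ∈ K.erase v | r v u} ≤ #{w ∈ K | r v w} :=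
    card_le_card (filter_subset_filter _ (erase_subset _ _))
  rw [← add_sum_erase _ _ hv]
  have hcard : #K = #(K.erase v) + 1 := (card_erase_add_one hv).symm
  rw [hcard]
  linarith

theorem exists_connIn_sum_le (G : SimpleGraph V) (f : V → ℕ) (C : ℕ) (K : Finset V)
    (hK : K.Nonempty) (hsum : ∑ v ∈ K, f v ≤ C * #K) :
    ∃ K' ⊆ K, K'.Nonempty ∧ G.ConnIn K' ∧ (∀ u ∈ K', ∀ v ∈ K, G.Adj u v → v ∈ K') ∧
      ∑ v ∈ K', f v ≤ C * #K' := by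
  induction K using Finset.strongInduction with
  | H K ih =>
  by_cases hconn : G.ConnIn K
  · exact ⟨K, Subset.rfl, hK, hconn, fun _ _ _ hv _ => hv, hsum⟩
  simp only [ConnIn, not_forall] at hconn
  obtain ⟨S, hSK, hS, hclosed, hne⟩ := hconn
  have hclosed' : ∀ u ∈ K \ S, ∀ v ∈ K, G.Adj u v → v ∈ K \ S := by
    intro u hu v hv huv
    rw [mem_sdiff] at hu ⊢
    exact ⟨hv, fun h => hu.2 (hclosed v h u hu.1 huv.symm)⟩
  have hrec : ∀ T ⊂ K, T.Nonempty → (∀ u ∈ T, ∀ v ∈ K, G.Adj u v → v ∈ T) →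
      ∑ v ∈ T, f v ≤ C * #T → ∃ K' ⊆ K, K'.Nonempty ∧ G.ConnIn K' ∧
        (∀ u ∈ K', ∀ v ∈ K, G.Adj u v → v ∈ K') ∧ ∑ v ∈ K', f v ≤ C * #K' := by
    intro T hTK hT hTc hTs
    obtain ⟨K', hK'T, hK', hconn, hc, hs⟩ := ih T hTK hT hTs
    exact ⟨K', hK'T.trans hTK.1, hK', hconn,
      fun u hu v hv huv => hc u hu v (hTc u (hK'T hu) v hv huv) huv, hs⟩
  by_cases hle : ∑ v ∈ S, f v ≤ C * #S
  · exact hrec S (hSK.ssubset_of_ne hne) hS hclosed hle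
  · have h1 := sum_sdiff hSK (f := f)
    have h2 := card_sdiff_add_card_eq_card hSK
    refine hrec (K \ S) (sdiff_ssubset hSK hS) ?_ hclosed' ?_
    · rw [sdiff_nonempty]
      exact fun h => hne (hSK.antisymm h)
    · rw [← h2, mul_add] at hsum
      omega

end Counting

section ArithmeticProgressions

variable {V : Type*} {B : SimpleGraph V}

/-- If the edges from `R` to `K \ R` contain a subgraph of large minimum degree, where `R` consists
of the vertices of `K` with a neighbour in `A`, then there are paths from `b` to `A` through `K`
whose lengths form an arithmetic progression of difference two. -/
theorem exists_pathIn_of_min_degree {k : ℕ} {K A R X : Finset V} {b : V} (hconn : B.ConnIn K)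
    (hKA : Disjoint K A) (hbA : b ∉ A) (hbK : b ∉ K) (hb : ∃ u ∈ K, B.Adj b u)
    (hR : ∀ u ∈ R, ∃ a ∈ A, B.Adj u a) (hXK : X ⊆ K) (hX : X.Nonempty)
    (hdeg : ∀ v ∈ X, 2 * k ≤ #{w ∈ X | B.Adj v w ∧ (v ∈ R ↔ w ∉ R)}) :
    ∃ ℓ, 2 ≤ ℓ ∧ ∀ i < k, ∃ a ∈ A, B.PathIn ({b} ∪ K ∪ A : Set V) b a (ℓ + 2 * i) := by
  obtain ⟨b', Q, n, hQ, hQK, ⟨v, hv, hbv⟩, -⟩ := hconn.exists_pathIn hb hXK hX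
  obtain ⟨e, he, hpar⟩ : ∃ e, e ≤ 1 ∧ (v ∈ R ↔ Even e) := by
    by_cases h : v ∈ R
    · exact ⟨0, by simp, by simp [h]⟩
    · exact ⟨1, by simp, by simp [h]⟩
  refine ⟨n + e + 2, by omega, fun i hi => ?_⟩
  obtain ⟨u, hu, huR⟩ := exists_alternating_pathIn R hdeg hv (e + 2 * i) (by omega)
  have huR' : u ∈ R := by
    rw [Nat.even_add, hpar] at huR
    simp only [even_two, Even.mul_right, iff_true] at huR
    tauto
  obtain ⟨a, ha, hua⟩ := hR u huR'
  have hQX : Disjoint Q (X : Set V) := by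
    rw [Set.disjoint_left]
    intro w hw hwX
    rcases hQK w hw with rfl | h
    · exact hbK (hXK hwX)
    · exact h.2 hwX
  have hQXA : Disjoint (Q ∪ X) ({a} : Set V) := by
    rw [Set.disjoint_singleton_right]
    rintro (h | h)
    · rcases hQK a h with rfl | h
      · exact hbA ha
      · exact Finset.disjoint_left.1 hKA h.1 ha
    · exact Finset.disjoint_left.1 hKA (hXK h) ha
  refine ⟨a, ha, ?_⟩
  have := ((hQ.trans_adj hbv hu hQX).trans_adj hua (PathIn.refl (Set.mem_singleton a)) hQXA).mono
    (T := ({b} ∪ K ∪ A : Set V)) ?_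
  · convert this using 1
    ring
  · rintro w ((hw | hw) | hw)
    · rcases hQK w hw with rfl | h
      · simp
      · simp [h.1]
    · simp [hXK hw]
    · rw [Set.mem_singleton_iff.1 hw]
      simp [ha]

/-- In a bipartite graph, let `K` be a connected set of vertices of large degree attached to the
rest of the graph only through `A`, which sends few edges to `K`, and a vertex `b`. If every
nonempty subset of `K` has at least two neighbours, then there are paths from `b` to `A` through
`K` whose lengths form an arithmetic progression of difference two. -/
theorem exists_pathIn_of_connIn [Fintype V] {χ : V → Bool} (hχ : ∀ u v, B.Adj u v → χ u ≠ χ v) {k : ℕ}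
    (K A : Finset V) (b : V) (c : Bool) (hK : K.Nonempty) (hconn : B.ConnIn K)
    (hKA : Disjoint K A) (hbK : b ∉ K) (hbA : b ∉ A)
    (hnbr : ∀ u ∈ K, ∀ w, B.Adj u w → w ∈ K ∨ w ∈ A ∨ w = b) (hb : ∃ u ∈ K, B.Adj b u)
    (hA : ∀ a ∈ A, χ a = c) (hdeg : ∀ v ∈ K, 12 * k + 2 ≤ #{w | B.Adj v w})
    (htwo : ∀ L ⊆ K, L.Nonempty → ∀ y, ∃ v ∈ L, ∃ w, w ∉ L ∧ w ≠ y ∧ B.Adj v w)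
    (hsparse : ∑ v ∈ K, #{a ∈ A | B.Adj v a} ≤ 4 * k * #K) :
    ∃ ℓ, 2 ≤ ℓ ∧ ∀ i < k, ∃ a ∈ A, B.PathIn ({b} ∪ K ∪ A : Set V) b a (ℓ + 2 * i) := by
  induction K using Finset.strongInduction generalizing A b c with
  | H K ih =>
  set R := K.filter fun v => ∃ a ∈ A, B.Adj v a with hRdef
  have hRK : R ⊆ K := filter_subset _ _
  have hRA : ∀ u ∈ R, ∃ a ∈ A, B.Adj u a := fun u hu => (mem_filter.1 hu).2
  rcases exists_min_degree_or_sum_le (r := fun v w => B.Adj v w ∧ (v ∈ R ↔ w ∉ R))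
    (fun u v h => ⟨h.1.symm, by tauto⟩) (2 * k) K with ⟨X, hXK, hX, hXdeg⟩ | hsum
  · exact exists_pathIn_of_min_degree hconn hKA hbA hbK hb hRA hXK hX (by convert hXdeg)
  replace hsum : ∑ v ∈ K, #{w ∈ K | B.Adj v w ∧ (v ∈ R ↔ w ∉ R)} ≤ 2 * (2 * k) * #K := by
    convert hsum
  have hRc : ∀ u ∈ R, χ u = !c := by
    intro u hu
    obtain ⟨a, ha, hua⟩ := hRA u hu
    have h1 := hχ _ _ hua
    rw [hA a ha] at h1
    exact Bool.eq_not.2 h1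
  have hR : R.Nonempty := by
    obtain ⟨v, hv, w, hwK, hwb, hvw⟩ := htwo K Subset.rfl hK b
    rcases hnbr v hv w hvw with h | h | h
    · exact absurd h hwK
    · exact ⟨v, mem_filter.2 ⟨hv, w, h, hvw⟩⟩
    · exact absurd h hwb
  have hcross : ∑ v ∈ K \ R, #{w ∈ R | B.Adj v w} = ∑ v ∈ R, #{w ∈ K \ R | B.Adj v w} := by
    simp only [card_filter]
    rw [sum_comm]
    simp only [B.adj_comm]
  have hcross_le : ∑ v ∈ K \ R, #{w ∈ R | B.Adj v w} ≤ 2 * k * #K := by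
    have h1 : ∑ v ∈ K \ R, #{w ∈ R | B.Adj v w} + ∑ v ∈ R, #{w ∈ K \ R | B.Adj v w} ≤
        ∑ v ∈ K, #{w ∈ K | B.Adj v w ∧ (v ∈ R ↔ w ∉ R)} := by
      rw [← sum_sdiff hRK]
      refine add_le_add (sum_le_sum fun v hv => card_le_card fun w hw => ?_)
        (sum_le_sum fun v hv => card_le_card fun w hw => ?_)
      · rw [mem_filter] at hw ⊢
        rw [mem_sdiff] at hv
        exact ⟨hRK hw.1, hw.2, by simp [hv.2, hw.1]⟩
      · rw [mem_filter, mem_sdiff] at hw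
        rw [mem_filter]
        exact ⟨hw.1.1, hw.2, by simp [hv, hw.1.2]⟩
    have h2 := h1.trans hsum
    rw [← hcross] at h2
    linarith
  have hRsum : (12 * k + 2) * #R ≤ 4 * k * #K + 2 * k * #K + #R := by
    have h1 : ∀ v ∈ R, 12 * k + 2 ≤ #{a ∈ A | B.Adj v a} + #{w ∈ K \ R | B.Adj v w} + 1 := by
      intro v hv
      refine (hdeg v (hRK hv)).trans ?_
      refine (card_le_card (t := ({a ∈ A | B.Adj v a} ∪ {w ∈ K \ R | B.Adj v w}) ∪ {b}) ?_).trans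
        ((card_union_le _ _).trans (add_le_add (card_union_le _ _) (by simp)))
      intro w hw
      have hvw := (mem_filter.1 hw).2
      simp only [mem_union, mem_filter, mem_sdiff, mem_singleton]
      rcases hnbr v (hRK hv) w hvw with h | h | h
      · refine Or.inl (Or.inr ⟨⟨h, fun hwR => hχ _ _ hvw ?_⟩, hvw⟩)
        rw [hRc v hv, hRc w hwR]
      · exact Or.inl (Or.inl ⟨h, hvw⟩)
      · exact Or.inr h
    have h2 := card_nsmul_le_sum _ _ _ h1
    rw [sum_add_distrib, sum_add_distrib, ← hcross, smul_eq_mul, sum_const, smul_eq_mul,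
      mul_one] at h2
    have h3 : ∑ v ∈ R, #{a ∈ A | B.Adj v a} ≤ ∑ v ∈ K, #{a ∈ A | B.Adj v a} :=
      sum_le_sum_of_subset hRK
    linarith
  have hcard := card_sdiff_add_card_eq_card hRK
  have hRsmall : 2 * #R < #K := by
    by_contra! h
    have := hR.card_pos
    nlinarith
  have hK2 : (K \ R).Nonempty := by
    rw [← card_pos]
    omega
  obtain ⟨L, hLK, hL, hLconn, hLclosed, hLsum⟩ :=
    exists_connIn_sum_le B (fun v => #{w ∈ R | B.Adj v w}) (4 * k) (K \ R) hK2 (by nlinarith)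
  have hLK' : L ⊆ K := hLK.trans sdiff_subset
  have hLR : ∀ v ∈ L, v ∉ R := fun v hv => (mem_sdiff.1 (hLK hv)).2
  obtain ⟨b', Q, n, hQ, hQK, ⟨x, hx, hbx⟩, hQL⟩ := hconn.exists_pathIn hb hLK' hL
  have hb'L : b' ∉ L := by
    rcases hQK b' hQ.right_mem with rfl | h
    · exact fun h => hbK (hLK' h)
    · exact h.2
  set A' := R.filter fun a => a ≠ b' ∧ ∃ v ∈ L, B.Adj v a with hA'def
  have hA'R : A' ⊆ R := filter_subset _ _
  have hLnbr : ∀ u ∈ L, ∀ w, B.Adj u w → w ∈ L ∨ w ∈ A' ∨ w = b' := by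
    intro u hu w huw
    by_cases hwb' : w = b'
    · exact Or.inr (Or.inr hwb')
    by_cases hwR : w ∈ R
    · exact Or.inr (Or.inl (mem_filter.2 ⟨hwR, hwb', u, hu, huw⟩))
    rcases hnbr u (hLK' hu) w huw with h | h | h
    · exact Or.inl (hLclosed u hu w (mem_sdiff.2 ⟨h, hwR⟩) huw)
    · exact absurd (mem_filter.2 ⟨hLK' hu, w, h, huw⟩) (hLR u hu)
    · subst h
      exact absurd huw.symm (hQL w hQ.left_mem hwb' u hu)
  obtain ⟨ℓ, hℓ, hpaths⟩ := ih L (hLK.trans_ssubset (sdiff_ssubset hRK hR)) A' b' (!c) hL hLconn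
    (Finset.disjoint_left.2 fun v hv hv' => hLR v hv (hA'R hv')) hb'L
    (fun h => (mem_filter.1 h).2.1 rfl) hLnbr ⟨x, hx, hbx⟩ (fun a ha => hRc a (hA'R ha))
    (fun v hv => hdeg v (hLK' hv)) (fun M hM => htwo M (hM.trans hLK'))
    ((sum_le_sum fun v _ => card_le_card (filter_subset_filter _ hA'R)).trans hLsum)
  refine ⟨n + ℓ + 1, by omega, fun i hi => ?_⟩
  obtain ⟨a', ha', hP⟩ := hpaths i hi
  obtain ⟨a, ha, haa⟩ := hRA a' (hA'R ha')
  have hinter : Q ∩ ({b'} ∪ L ∪ A' : Set V) ⊆ {b'} := by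
    rintro w ⟨hw, (h | h) | h⟩
    · exact h
    · rcases hQK w hw with rfl | h'
      · exact absurd (hLK' h) hbK
      · exact absurd h h'.2
    · obtain ⟨-, hne, v, hv, hvw⟩ := mem_filter.1 h
      exact absurd hvw.symm (hQL w hw hne v hv)
  have hsub : Q ∪ ({b'} ∪ L ∪ A' : Set V) ⊆ {b} ∪ K := by
    have hQ' : Q ⊆ {b} ∪ K := fun w hw => (hQK w hw).imp id And.left
    rintro w (h | (h | h) | h)
    · exact hQ' h
    · exact hQ' (Set.mem_singleton_iff.1 h ▸ hQ.right_mem)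
    · exact Or.inr (hLK' h)
    · exact Or.inr (hRK (hA'R h))
  refine ⟨a, ha, ?_⟩
  have := (((hQ.trans hP hinter).mono hsub).trans_adj haa (PathIn.refl (S := A) ha) ?_)
  · convert this using 1
    ring
  · rw [Set.disjoint_left]
    rintro w (h | h) hwA
    · exact hbA (Set.mem_singleton_iff.1 h ▸ hwA)
    · exact Finset.disjoint_left.1 hKA h hwA

end ArithmeticProgressions

section MaxCut

variable {V : Type*}

/-- The spanning bipartite subgraph of `G` formed by the edges across the cut `χ`. -/
def cutGraph (G : SimpleGraph V) (χ : V → Bool) : SimpleGraph V where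
  Adj u v := G.Adj u v ∧ χ u ≠ χ v
  symm := ⟨fun _ _ h => ⟨h.1.symm, h.2.symm⟩⟩
  loopless := ⟨fun _ h => h.2 rfl⟩

theorem cutGraph_adj {G : SimpleGraph V} {χ : V → Bool} {u v : V} :
    (G.cutGraph χ).Adj u v ↔ G.Adj u v ∧ χ u ≠ χ v := Iff.rfl

theorem cutGraph_le (G : SimpleGraph V) (χ : V → Bool) : G.cutGraph χ ≤ G :=
  fun _ _ h => h.1

theorem card_filter_eq_add_two_mul [Fintype V] (X : Finset V) {q : V → V → Prop}
    (hq : ∀ u v, q u v → q v u) :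
    #{p : V × V | q p.1 p.2} = #{p : V × V | (p.1 ∈ X ↔ p.2 ∈ X) ∧ q p.1 p.2} +
      2 * #{p : V × V | p.1 ∈ X ∧ p.2 ∉ X ∧ q p.1 p.2} := by
  have hswap : #{p : V × V | p.1 ∉ X ∧ p.2 ∈ X ∧ q p.1 p.2} =
      #{p : V × V | p.1 ∈ X ∧ p.2 ∉ X ∧ q p.1 p.2} := by
    refine card_equiv (Equiv.prodComm V V) fun p => ?_
    simp only [mem_filter, mem_univ, true_and, Equiv.prodComm_apply, Prod.fst_swap, Prod.snd_swap]
    exact ⟨fun h => ⟨h.2.1, h.1, hq _ _ h.2.2⟩, fun h => ⟨h.2.1, h.1, hq _ _ h.2.2⟩⟩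
  rw [two_mul]
  nth_rw 1 [← hswap]
  rw [← card_union_of_disjoint, ← card_union_of_disjoint]
  · congr 1
    ext p
    simp only [mem_filter, mem_univ, true_and, mem_union]
    tauto
  · rw [Finset.disjoint_left]
    intro p
    simp only [mem_filter, mem_univ, true_and, mem_union]
    tauto
  · rw [Finset.disjoint_left]
    intro p
    simp only [mem_filter, mem_univ, true_and]
    tauto

/-- A maximum cut separates at least half of the edges leaving any vertex set. -/
theorem exists_maxCut [Fintype V] (G : SimpleGraph V) : ∃ χ : V → Bool, ∀ X : Finset V,
    #{p : V × V | p.1 ∈ X ∧ p.2 ∉ X ∧ G.Adj p.1 p.2 ∧ χ p.1 = χ p.2} ≤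
      #{p : V × V | p.1 ∈ X ∧ p.2 ∉ X ∧ (G.cutGraph χ).Adj p.1 p.2} := by
  obtain ⟨χ, hχ⟩ := Finite.exists_max
    fun χ : V → Bool => #{p : V × V | (G.cutGraph χ).Adj p.1 p.2}
  refine ⟨χ, fun X => ?_⟩
  have h := hχ fun u => if u ∈ X then !χ u else χ u
  rw [card_filter_eq_add_two_mul X fun _ _ h => h.symm,
    card_filter_eq_add_two_mul X fun _ _ h => h.symm] at h
  have h1 : ∀ p : V × V, ((p.1 ∈ X ↔ p.2 ∈ X) ∧
      (G.cutGraph fun u => if u ∈ X then !χ u else χ u).Adj p.1 p.2) ↔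
      ((p.1 ∈ X ↔ p.2 ∈ X) ∧ (G.cutGraph χ).Adj p.1 p.2) := by
    intro p
    simp only [cutGraph_adj]
    by_cases h1 : p.1 ∈ X <;> by_cases h2 : p.2 ∈ X <;> simp [h1, h2]
  have h2 : ∀ p : V × V, (p.1 ∈ X ∧ p.2 ∉ X ∧
      (G.cutGraph fun u => if u ∈ X then !χ u else χ u).Adj p.1 p.2) ↔
      (p.1 ∈ X ∧ p.2 ∉ X ∧ G.Adj p.1 p.2 ∧ χ p.1 = χ p.2) := by
    intro p
    simp only [cutGraph_adj]
    by_cases h1 : p.1 ∈ X <;> by_cases h2 : p.2 ∈ X <;> simp [h1, h2]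
  simp only [h1, h2] at h
  omega

theorem card_adj_le_two_mul_card_cutGraph_adj [Fintype V] {G : SimpleGraph V} {χ : V → Bool}
    (hχ : ∀ X : Finset V,
      #{p : V × V | p.1 ∈ X ∧ p.2 ∉ X ∧ G.Adj p.1 p.2 ∧ χ p.1 = χ p.2} ≤
        #{p : V × V | p.1 ∈ X ∧ p.2 ∉ X ∧ (G.cutGraph χ).Adj p.1 p.2}) (v : V) :
    #{w | G.Adj v w} ≤ 2 * #{w | (G.cutGraph χ).Adj v w} := by
  have key : ∀ q : V → V → Prop, (∀ u, ¬ q u u) →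
      #{p : V × V | p.1 ∈ ({v} : Finset V) ∧ p.2 ∉ ({v} : Finset V) ∧ q p.1 p.2} =
        #{w | q v w} := by
    intro q hq
    symm
    refine card_bij (fun w _ => (v, w)) ?_ (by simp) ?_
    · intro w hw
      have hvw : q v w := by simpa using hw
      have hne : w ≠ v := by
        rintro rfl
        exact hq _ hvw
      simp [hvw, hne]
    · rintro ⟨u, w⟩ hp
      simp only [mem_filter, mem_univ, true_and, mem_singleton] at hp
      obtain ⟨rfl, -, h⟩ := hp
      exact ⟨w, by simpa using h, rfl⟩
  have h := hχ {v}
  have hmono : #{p : V × V | p.1 ∈ ({v} : Finset V) ∧ p.2 ∉ ({v} : Finset V) ∧ G.Adj p.1 p.2 ∧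
      χ p.1 = χ p.2} = #{w | G.Adj v w ∧ χ v = χ w} := by
    convert key (fun u w => G.Adj u w ∧ χ u = χ w) (by simp)
  rw [hmono, key _ (by simp)] at h
  have hsplit := card_filter_add_card_filter_not (s := {w | G.Adj v w}) (fun w => χ v = χ w)
  rw [filter_filter, filter_filter] at hsplit
  simp only [cutGraph_adj, ne_eq] at h ⊢
  omega

theorem exists_cutGraph_adj [Fintype V] {G : SimpleGraph V} {χ : V → Bool}
    (hχ : ∀ X : Finset V,
      #{p : V × V | p.1 ∈ X ∧ p.2 ∉ X ∧ G.Adj p.1 p.2 ∧ χ p.1 = χ p.2} ≤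
        #{p : V × V | p.1 ∈ X ∧ p.2 ∉ X ∧ (G.cutGraph χ).Adj p.1 p.2}) {X : Finset V}
    (hX : ∃ u ∈ X, ∃ w, w ∉ X ∧ G.Adj u w) :
    ∃ u ∈ X, ∃ w, w ∉ X ∧ (G.cutGraph χ).Adj u w := by
  by_contra! hcon
  obtain ⟨u, hu, w, hw, huw⟩ := hX
  have h0 : #{p : V × V | p.1 ∈ X ∧ p.2 ∉ X ∧ (G.cutGraph χ).Adj p.1 p.2} = 0 := by
    rw [card_eq_zero, filter_eq_empty_iff]
    exact fun p _ hp => hcon _ hp.1 _ hp.2.1 hp.2.2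
  have h1 := hχ X
  rw [h0, Nat.le_zero, card_eq_zero, filter_eq_empty_iff] at h1
  refine h1 (mem_univ (u, w)) ⟨hu, hw, huw, ?_⟩
  by_contra hne
  exact hcon u hu w hw ⟨huw, hne⟩

end MaxCut

end SimpleGraph

section TwoConnected

open Finset SimpleGraph Classical

variable {V : Type*} [Fintype V] {G : SimpleGraph V}

theorem TwoConnected.exists_adj_ne (hG : TwoConnected G) {X : Finset V} {y z : V}
    (hX : X.Nonempty) (hy : y ∉ X) (hz : z ∉ X) (hzy : z ≠ y) :
    ∃ u ∈ X, ∃ w, w ∉ X ∧ w ≠ y ∧ G.Adj u w := by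
  obtain ⟨x, hx⟩ := hX
  have hxy : x ≠ y := fun h => hy (h ▸ hx)
  obtain ⟨p⟩ := (hG.2 y).preconnected ⟨x, hxy⟩ ⟨z, hzy⟩
  obtain ⟨d, -, hd1, hd2⟩ := p.exists_boundary_dart {v | (v : V) ∈ X} hx hz
  exact ⟨d.fst, hd1, d.snd, hd2, d.snd.2, d.adj⟩

theorem TwoConnected.exists_adj (hG : TwoConnected G) {X : Finset V} (hX : X.Nonempty)
    (hX' : X ≠ univ) : ∃ u ∈ X, ∃ w, w ∉ X ∧ G.Adj u w := by
  obtain ⟨y, hy⟩ : ∃ y, y ∉ X := by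
    by_contra! h
    exact hX' (eq_univ_iff_forall.2 h)
  by_cases hz : ∃ z, z ∉ X ∧ z ≠ y
  · obtain ⟨z, hz, hzy⟩ := hz
    obtain ⟨u, hu, w, hw, -, huw⟩ := hG.exists_adj_ne hX hy hz hzy
    exact ⟨u, hu, w, hw, huw⟩
  · push Not at hz
    have hcard : 1 < #({y}ᶜ : Finset V) := by
      rw [card_compl, card_singleton]
      have := hG.1
      omega
    obtain ⟨a, ha, b, hb, hab⟩ := one_lt_card.1 hcard
    rw [mem_compl, mem_singleton] at ha hb
    obtain ⟨u, hu, w, hw, -, huw⟩ := hG.exists_adj_ne (X := {y}) (y := a) (z := b)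
      (singleton_nonempty y) (by simpa using ha) (by simpa using hb) hab.symm
    rw [mem_singleton] at hu hw
    subst hu
    exact ⟨w, by_contra fun h => hw (hz w h), u, hy, huw.symm⟩

/-- In a connected graph, if a vertex set `T` has no neighbour outside `T` other than `y`, then any
vertex outside `T` is reached from `y` by a path avoiding `T`. -/
theorem SimpleGraph.exists_pathIn_compl {B : SimpleGraph V}
    (hB : ∀ X : Finset V, X.Nonempty → X ≠ univ → ∃ u ∈ X, ∃ w, w ∉ X ∧ B.Adj u w) {T : Finset V}
    {y u : V} (hy : y ∉ T) (hT : ∀ u ∈ T, ∀ w, B.Adj u w → w ∈ T ∨ w = y) (hu : u ∉ T) :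
    ∃ n, B.PathIn {w | w ∉ T} y u n := by
  let R : Finset V := {v | ∃ p : B.Walk y v, ∀ w ∈ p.support, w ∉ T}
  have hyR : y ∈ R := mem_filter.2 ⟨mem_univ _, Walk.nil, by simpa using hy⟩
  have huniv : R ∪ T = univ := by
    by_contra hne
    obtain ⟨a, ha, w, hw, haw⟩ := hB (R ∪ T) ⟨y, mem_union_left _ hyR⟩ hne
    rw [mem_union, not_or] at hw
    rcases mem_union.1 ha with ha | ha
    · obtain ⟨p, hp⟩ := (mem_filter.1 ha).2
      refine hw.1 (mem_filter.2 ⟨mem_univ _, p.concat haw, fun z hz => ?_⟩)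
      rw [Walk.support_concat, List.mem_append, List.mem_singleton] at hz
      rcases hz with hz | rfl
      · exact hp z hz
      · exact hw.2
    · rcases hT a ha w haw with h | rfl
      · exact hw.2 h
      · exact hw.1 hyR
  have huR : u ∈ R := by
    have := mem_univ u
    rw [← huniv, mem_union] at this
    exact this.resolve_right hu
  obtain ⟨p, hp⟩ := (mem_filter.1 huR).2
  exact ⟨_, p.bypass, p.bypass_isPath, rfl,
    fun w hw => hp w (p.support_bypass_subset_support hw)⟩

/-- A non-bipartite two-connected graph has a leaf block `T ∪ {y}` of its cut graph, with
attachment vertex `y`, and a path of the wrong parity with respect to `χ` from `y` to a vertex of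
`T` which is otherwise outside `T`. -/
theorem TwoConnected.exists_leafBlock (hG : TwoConnected G) (hcol : ¬ G.Colorable 2)
    {χ : V → Bool}
    (hB : ∀ X : Finset V, X.Nonempty → X ≠ univ →
      ∃ u ∈ X, ∃ w, w ∉ X ∧ (G.cutGraph χ).Adj u w) :
    ∃ (T : Finset V) (y : V), y ∉ T ∧ T.Nonempty ∧
      (∀ u ∈ T, ∀ w, (G.cutGraph χ).Adj u w → w ∈ T ∨ w = y) ∧
      (∀ L ⊂ T, L.Nonempty → ∀ z, ∃ v ∈ L, ∃ w, w ∉ L ∧ w ≠ z ∧ (G.cutGraph χ).Adj v w) ∧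
      ∃ t ∈ T, ∃ (S : Set V) (n : ℕ), G.PathIn S y t n ∧ ¬ (Even n ↔ χ y = χ t) ∧
        ∀ w ∈ S, w ∈ T → w = t := by
  let F : Finset (Finset V) := {T | T.Nonempty ∧ ∃ y, y ∉ T ∧
    ∀ u ∈ T, ∀ w, (G.cutGraph χ).Adj u w → w ∈ T ∨ w = y}
  have hcompl : ∀ y, ({y}ᶜ : Finset V) ∈ F := by
    intro y
    refine mem_filter.2 ⟨mem_univ _, ?_, y, by simp, fun u _ w _ => ?_⟩
    · rw [← card_pos, card_compl, card_singleton]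
      have := hG.1
      omega
    · rw [mem_compl, mem_singleton]
      tauto
  have hmin : ∀ T ∈ F, (∀ T' ∈ F, #T ≤ #T') → ∀ L ⊂ T, L.Nonempty → ∀ z,
      ∃ v ∈ L, ∃ w, w ∉ L ∧ w ≠ z ∧ (G.cutGraph χ).Adj v w := by
    intro T hTF hT L hL hLne z
    obtain ⟨-, -, y, hyT, -⟩ := mem_filter.1 hTF
    obtain ⟨z', hz', hzz⟩ : ∃ z', z' ∉ L ∧ (z ∉ L → z' = z) := by
      by_cases h : z ∈ L
      · exact ⟨y, fun h => hyT (hL.1 h), fun h' => absurd h h'⟩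
      · exact ⟨z, h, fun _ => rfl⟩
    by_contra! hcon
    have hLF : L ∈ F := by
      refine mem_filter.2 ⟨mem_univ _, hLne, z', hz', fun u hu w huw => ?_⟩
      by_contra! hw
      refine hcon u hu w hw.1 ?_ huw
      rintro rfl
      exact hw.2 (hzz hw.1).symm
    exact absurd (hT L hLF) (not_le.2 (card_lt_card hL))
  obtain ⟨y₀⟩ : Nonempty V := Fintype.card_pos_iff.1 (by have := hG.1; omega)
  obtain ⟨T, hTF, hTmin⟩ := exists_min_image F card ⟨_, hcompl y₀⟩
  obtain ⟨-, hTne, y, hyT, hT⟩ := mem_filter.1 hTF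
  by_cases hz : ∃ z, z ∉ T ∧ z ≠ y
  · obtain ⟨z, hzT, hzy⟩ := hz
    obtain ⟨t, ht, u, hu, huy, htu⟩ := hG.exists_adj_ne hTne hyT hzT hzy
    have hχtu : χ t = χ u := by
      by_contra hne
      exact (hT t ht u ⟨htu, hne⟩).elim hu huy
    obtain ⟨n, hn⟩ := exists_pathIn_compl hB hyT hT hu
    have hpar := hn.even_iff (χ := χ) fun _ _ h => (cutGraph_adj.1 h).2
    refine ⟨T, y, hyT, hTne, hT, hmin T hTF hTmin, t, ht, _, _,
      (hn.mono_graph (cutGraph_le G χ)).trans_adj htu.symm (PathIn.refl (Set.mem_singleton t)) ?_,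
      ?_, ?_⟩
    · simpa using ht
    · rw [add_zero, Nat.even_add_one, hpar, hχtu]
      tauto
    · rintro w (hw | hw) hwT
      · exact absurd hwT hw
      · exact hw
  · push Not at hz
    obtain ⟨t, y', hty, hχty⟩ : ∃ t y', G.Adj t y' ∧ χ t = χ y' := by
      by_contra! hcon
      refine hcol ?_
      have := (Coloring.mk χ fun {u v} h => hcon u v h).colorable
      simpa using this
    have hcard : #({y'}ᶜ : Finset V) = #T := by
      have hTy : T = {y}ᶜ := by
        ext w
        rw [mem_compl, mem_singleton]
        exact ⟨fun h h' => hyT (h' ▸ h), fun h => by_contra fun h' => h (hz w h')⟩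
      rw [hTy, card_compl, card_compl, card_singleton, card_singleton]
    refine ⟨{y'}ᶜ, y', by simp, (mem_filter.1 (hcompl y')).2.1, fun u _ w _ => ?_,
      hmin _ (hcompl y') (by rwa [hcard]), t, by simpa using hty.ne, _, _,
      PathIn.of_adj hty.symm, by simp [hχty], ?_⟩
    · rw [mem_compl, mem_singleton]
      tauto
    · rintro w (rfl | hw) hwT
      · simp at hwT
      · exact hw

theorem SimpleGraph.exists_pathIn_leafBlock {B : SimpleGraph V} {χ : V → Bool}
    (hχ : ∀ u v, B.Adj u v → χ u ≠ χ v) {k : ℕ} (hk : 1 ≤ k) {T : Finset V} {y t : V}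
    (hy : y ∉ T) (hT : ∀ u ∈ T, ∀ w, B.Adj u w → w ∈ T ∨ w = y)
    (htwo : ∀ L ⊂ T, L.Nonempty → ∀ z, ∃ v ∈ L, ∃ w, w ∉ L ∧ w ≠ z ∧ B.Adj v w)
    (hdeg : ∀ v, 12 * k + 2 ≤ #{w | B.Adj v w}) (ht : t ∈ T) :
    ∃ ℓ, 2 ≤ ℓ ∧ ∀ i < k, B.PathIn (insert y T : Set V) y t (ℓ + 2 * i) := by
  have hne : (T.erase t).Nonempty := by
    have hcard : #({y} : Finset V) < #{w | B.Adj t w} := by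
      have := hdeg t
      rw [card_singleton]
      omega
    obtain ⟨w, hw, hwy⟩ := exists_mem_notMem_of_card_lt_card hcard
    have htw : B.Adj t w := (mem_filter.1 hw).2
    exact ⟨w, mem_erase.2 ⟨htw.ne', (hT t ht w htw).resolve_right (by simpa using hwy)⟩⟩
  obtain ⟨K, hKT, hK, hconn, hclosed, -⟩ :=
    exists_connIn_sum_le B (fun _ => 0) 0 (T.erase t) hne (by simp)
  have hKT' : K ⊂ T := hKT.trans_ssubset (erase_ssubset ht)
  have htK : t ∉ K := fun h => by simpa using hKT h
  have hKnbr : ∀ u ∈ K, ∀ w, B.Adj u w → w ∈ K ∨ w ∈ ({t} : Finset V) ∨ w = y := by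
    intro u hu w huw
    by_cases hwt : w = t
    · simp [hwt]
    · exact (hT u (hKT'.1 hu) w huw).imp
        (fun h => hclosed u hu w (mem_erase.2 ⟨hwt, h⟩) huw) Or.inr
  have hyK : ∃ u ∈ K, B.Adj y u := by
    obtain ⟨v, hv, w, hwK, hwt, hvw⟩ := htwo K hKT' hK t
    have hwy : w = y := ((hKnbr v hv w hvw).resolve_left hwK).resolve_left (by simpa using hwt)
    exact ⟨v, hv, hwy ▸ hvw.symm⟩
  have hsparse : ∑ v ∈ K, #{a ∈ {t} | B.Adj v a} ≤ 4 * k * #K :=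
    calc ∑ v ∈ K, #{a ∈ {t} | B.Adj v a} ≤ ∑ v ∈ K, 1 :=
          sum_le_sum fun v _ => (card_filter_le _ _).trans (by simp)
      _ ≤ 4 * k * #K := by
          rw [sum_const, smul_eq_mul, mul_one]
          exact Nat.le_mul_of_pos_left _ (by omega)
  obtain ⟨ℓ, hℓ, h⟩ := exists_pathIn_of_connIn hχ K {t} y (χ t) hK hconn (by simpa using htK)
    (fun h => hy (hKT'.1 h)) (fun h => hy (mem_singleton.1 h ▸ ht)) hKnbr hyK (by simp)
    (fun v _ => hdeg v) (fun L hL => htwo L (hL.trans_ssubset hKT')) hsparse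
  refine ⟨ℓ, hℓ, fun i hi => ?_⟩
  obtain ⟨a, ha, hP⟩ := h i hi
  obtain rfl := mem_singleton.1 ha
  refine hP.mono ?_
  rintro w ((hw | hw) | hw)
  · exact Or.inl hw
  · exact Or.inr (hKT'.1 hw)
  · exact Or.inr (mem_singleton.1 hw ▸ ht)

theorem Int.exists_lt_add_two_mul_modEq {k : ℕ} (hk : 1 ≤ k) {a : ℕ} {m : ℤ}
    (h : Even a ↔ Even m) : ∃ i < k, ((a + 2 * i : ℕ) : ℤ) ≡ m [ZMOD k] := by
  have heven : Even (m - a) := by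
    rw [Int.even_sub, Int.even_coe_nat]
    exact h.symm
  obtain ⟨j, hj⟩ := heven
  have hk' : (k : ℤ) ≠ 0 := by omega
  have hnonneg := Int.emod_nonneg j hk'
  refine ⟨(j % k).toNat, ?_, ?_⟩
  · have := Int.emod_lt_of_pos j (show (0 : ℤ) < k by omega)
    omega
  · push_cast
    rw [Int.toNat_of_nonneg hnonneg]
    have hmod : a + 2 * (j % k) ≡ a + 2 * j [ZMOD k] := ((Int.mod_modEq j k).mul_left 2).add_left a
    rwa [show (a : ℤ) + 2 * j = m by linarith] at hmod

end TwoConnected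

theorem cycles_of_all_lengths_mod_k :
    ∃ d : ℝ, 0 < d ∧ ∀ k : ℕ, 1 ≤ k →
      ∀ (V : Type) [Fintype V] (G : SimpleGraph V),
        ¬ G.Colorable 2 →                       -- `G` is not bipartite
        TwoConnected G →
        (∀ v : V, d * k ≤ (Nat.card (G.neighborSet v) : ℝ)) →  -- minimum degree ≥ d * k
        ∀ m : ℤ, ∃ n : ℕ, HasCycleOfLength G n ∧ (n : ℤ) ≡ m [ZMOD (k : ℤ)] := by
  classical
  refine ⟨28, by norm_num, fun k hk V _ G hcol hG hdeg m => ?_⟩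
  obtain ⟨χ, hχ⟩ := G.exists_maxCut
  have hB : ∀ X : Finset V, X.Nonempty → X ≠ Finset.univ →
      ∃ u ∈ X, ∃ w, w ∉ X ∧ (G.cutGraph χ).Adj u w := fun X hX hX' =>
    SimpleGraph.exists_cutGraph_adj hχ (hG.exists_adj hX hX')
  have hdegB : ∀ v, 12 * k + 2 ≤ (Finset.univ.filter fun w => (G.cutGraph χ).Adj v w).card := by
    intro v
    have h1 := SimpleGraph.card_adj_le_two_mul_card_cutGraph_adj hχ v
    have h2 : Nat.card (G.neighborSet v) = (Finset.univ.filter fun w => G.Adj v w).card := by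
      rw [Nat.card_eq_fintype_card, ← Set.toFinset_card]
      congr 1
      ext w
      simp
    have h3 := hdeg v
    rw [h2] at h3
    have h4 : 28 * k ≤ (Finset.univ.filter fun w => G.Adj v w).card := by exact_mod_cast h3
    have h5 : 28 * k ≤ 2 * (Finset.univ.filter fun w => (G.cutGraph χ).Adj v w).card :=
      h4.trans (by convert h1)
    omega
  obtain ⟨T, y, hy, hTne, hT, htwo, hodd⟩ := hG.exists_leafBlock hcol hB
  obtain ⟨t, ht, S, n, hS, hpar, hST⟩ : ∃ t ∈ T, ∃ (S : Set V) (n : ℕ), G.PathIn S y t n ∧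
      ((Even n ↔ χ y = χ t) ↔ Even m) ∧ ∀ w ∈ S, w ∈ T → w = t := by
    by_cases hm : Even m
    · obtain ⟨t, ht, w, hw, htw⟩ := hB T hTne fun h => hy (h ▸ Finset.mem_univ y)
      obtain rfl := (hT t ht w htw).resolve_left hw
      refine ⟨t, ht, _, _, SimpleGraph.PathIn.of_adj htw.1.symm, ?_, ?_⟩
      · simp [hm, htw.2.symm]
      · rintro z (rfl | hz) hzT
        · exact absurd hzT hw
        · exact hz
    · obtain ⟨t, ht, S, n, hS, hpar, hST⟩ := hodd
      exact ⟨t, ht, S, n, hS, by simp only [hpar, hm], hST⟩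
  obtain ⟨ℓ, hℓ, hpaths⟩ := SimpleGraph.exists_pathIn_leafBlock (χ := χ) (fun _ _ h => (SimpleGraph.cutGraph_adj.1 h).2) hk hy hT
    htwo (fun v => by convert hdegB v) ht
  have hℓpar := (hpaths 0 (by omega)).even_iff (χ := χ) fun _ _ h =>
    (SimpleGraph.cutGraph_adj.1 h).2
  have heven : Even (ℓ + n) ↔ Even m := by
    rw [mul_zero, add_zero] at hℓpar
    rw [Nat.even_add, hℓpar, ← hpar]
    tauto
  obtain ⟨i, hi, hmod⟩ := Int.exists_lt_add_two_mul_modEq hk heven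
  refine ⟨ℓ + 2 * i + n, ?_, by rwa [add_right_comm]⟩
  refine ((hpaths i hi).mono_graph (G.cutGraph_le χ)).hasCycleOfLength hS.symm (by omega) ?_
  rintro w ⟨hw | hw, hwS⟩
  · exact Or.inl hw
  · exact Or.inr (hST w hwS hw)
end

section
/- Let C be a cycle with a chord (i.e., a graph consisting of a cycle together with an additional edge joining two non-consecutive vertices of the cycle), and let (A, B) be a partition of the vertex set of C with both A and B nonempty. Then C (with its chord) contains an (A, B)-path of every length l with 1 ≤ l < |C|, unless C is bipartite with bipartition (A, B). -/
/-- A property of integers which is invariant under translation by `d` and holds on a window of `d`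
consecutive integers holds everywhere. -/
lemma forall_of_forall_window {P : ℤ → Prop} {d : ℤ} (hd : 0 < d)
    (hP : ∀ i m, P (i + d * m) ↔ P i) (a : ℤ) (h : ∀ j, a ≤ j → j < a + d → P j) (x : ℤ) :
    P x := by
  have hx : x = (a + (x - a) % d) + d * ((x - a) / d) := by
    have := Int.emod_add_mul_ediv (x - a) d
    linarith
  rw [hx, hP]
  have := Int.emod_nonneg (x - a) hd.ne'
  have := Int.emod_lt_of_pos (x - a) hd
  exact h _ (by omega) (by omega)

/-- The periods of a predicate on `ℤ` having a nonzero period are the multiples of a positive one. -/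
lemma exists_pos_forall_period_iff_dvd (χ : ℤ → Prop) {n : ℤ} (hn : 0 < n)
    (hχ : ∀ i, χ (i + n) ↔ χ i) :
    ∃ d : ℤ, 0 < d ∧ ∀ t, (∀ i, χ (i + t) ↔ χ i) ↔ d ∣ t := by
  let H : AddSubgroup ℤ :=
    { carrier := {t | ∀ i, χ (i + t) ↔ χ i}
      zero_mem' := by simp
      add_mem' := by
        intro a b ha hb i
        rw [← add_assoc, hb, ha]
      neg_mem' := by
        intro a ha i
        rw [← ha (i + -a), neg_add_cancel_right] }
  obtain ⟨g, hg⟩ := Int.subgroup_cyclic H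
  have key : ∀ t, (∀ i, χ (i + t) ↔ χ i) ↔ g ∣ t := by
    intro t
    rw [← Int.mem_zmultiples_iff, AddSubgroup.zmultiples_eq_closure, ← hg]
    rfl
  have hg0 : g ≠ 0 := by
    rintro rfl
    have := (key n).1 hχ
    simp at this
    omega
  exact ⟨|g|, abs_pos.2 hg0, fun t => (key t).trans (abs_dvd g t).symm⟩

/-- The arithmetic core: a nonconstant `2`-colouring of the integers modulo `n` with no bichromatic
path of length `l` in the cycle with chord `0, r` is the proper colouring of that graph. -/
lemma alternating_of_chord_symmetries (χ : ℤ → Prop) {n r l : ℤ} (hr : 2 ≤ r) (hrn : r ≤ n - 2)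
    (hl : 1 ≤ l) (hln : l < n) (hn : ∀ i, χ (i + n) ↔ χ i) (harc : ∀ i, χ (i + l) ↔ χ i)
    (hnc : ¬ ∀ i, χ (i + 1) ↔ χ i)
    (hzig : ∀ j k : ℤ, 0 ≤ j → 0 ≤ k → j + k + 1 = l → j < n - r → k < r →
      (χ (-j) ↔ χ (r - k)))
    (hzag : ∀ j k : ℤ, 0 ≤ j → 0 ≤ k → j + k + 1 = l → j < r → k < n - r →
      (χ j ↔ χ (r + k)))
    (hout : ∀ j k : ℤ, 0 ≤ j → 0 ≤ k → j + k + 1 = l → j + k + r < n →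
      (χ (-j) ↔ χ (r + k)))
    (hin : ∀ j k : ℤ, 0 ≤ j → 0 ≤ k → j + k + 1 = l → j + k < r → (χ j ↔ χ (r - k))) :
    (∀ i, χ (i + 1) ↔ ¬ χ i) ∧ (χ r ↔ ¬ χ 0) := by
  obtain ⟨d, hd, hper⟩ := exists_pos_forall_period_iff_dvd χ (by omega) hn
  have hdn := (hper n).1 hn
  have hdl := (hper l).1 harc
  have hdl' : d ≤ l := Int.le_of_dvd (by omega) hdl
  have hdnl : d ≤ n - l := Int.le_of_dvd (by omega) (dvd_sub hdn hdl)
  have hmul : ∀ i m, χ (i + d * m) ↔ χ i := fun i m => (hper (d * m)).2 (dvd_mul_right d m) i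
  have hmul' : ∀ i m, χ (i - d * m) ↔ χ i := fun i m => by
    simpa [sub_eq_add_neg] using hmul i (-m)
  have hdr : d ≤ r := by
    by_contra! hlt
    have h : ∀ i, χ (i + (r - 1)) ↔ χ i := by
      intro i
      have := forall_of_forall_window (P := fun j => χ (-j) ↔ χ (r - 1 - j)) hd
        (fun i m => by
          rw [show -(i + d * m) = -i - d * m by ring,
            show r - 1 - (i + d * m) = (r - 1 - i) - d * m by ring, hmul', hmul']) 0
        (fun j hj hj' => by
          rw [hout j (l - 1 - j) (by omega) (by omega) (by omega) (by omega),
            ← harc (r - 1 - j)]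
          ring_nf) (-i)
      simp only [neg_neg] at this
      rw [this]
      ring_nf
    have := Int.le_of_dvd (by omega) ((hper _).1 h)
    omega
  have hdnr : d ≤ n - r := by
    by_contra! hlt
    have h : ∀ i, χ (i + (r + 1)) ↔ χ i := by
      intro i
      have := forall_of_forall_window (P := fun j => χ j ↔ χ (j + (r + 1))) hd
        (fun i m => by
          rw [show i + d * m + (r + 1) = i + (r + 1) + d * m by ring, hmul, hmul]) 0
        (fun j hj hj' => by
          rw [hin j (l - 1 - j) (by omega) (by omega) (by omega) (by omega),
            ← harc (r - (l - 1 - j))]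
          ring_nf) i
      exact this.symm
    have := Int.le_of_dvd (by omega) (dvd_sub hdn ((hper _).1 h))
    omega
  have h1 : ∀ j, χ (-j) ↔ χ (j + (r + 1)) :=
    forall_of_forall_window hd
      (fun i m => by
        rw [show -(i + d * m) = -i - d * m by ring,
          show i + d * m + (r + 1) = i + (r + 1) + d * m by ring, hmul, hmul']) (max 0 (l - r))
      (fun j hj hj' => by
        rw [hzig j (l - 1 - j) (by omega) (by omega) (by omega) (by omega) (by omega),
          ← harc (r - (l - 1 - j))]
        ring_nf)
  have h2 : ∀ j, χ j ↔ χ (r - 1 - j) :=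
    forall_of_forall_window hd
      (fun i m => by
        rw [show r - 1 - (i + d * m) = (r - 1 - i) - d * m by ring, hmul, hmul'])
      (max 0 (l - (n - r)))
      (fun j hj hj' => by
        rw [hzag j (l - 1 - j) (by omega) (by omega) (by omega) (by omega) (by omega),
          ← harc (r - 1 - j)]
        ring_nf)
  have htwo : ∀ i, χ (i + 2) ↔ χ i := by
    intro i
    rw [h2 i, show r - 1 - i = -(i + 1 - r) by ring, h1]
    ring_nf
  have hd2 : d = 2 := by
    have hdvd := (hper 2).1 htwo
    have := Int.le_of_dvd (by omega) hdvd
    have : d ≠ 1 := by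
      rintro rfl
      exact hnc ((hper 1).2 dvd_rfl)
    omega
  subst hd2
  have halt : ∀ i, χ (i + 1) ↔ ¬ χ i := by
    by_contra! hex
    obtain ⟨i, hi⟩ := hex
    have hi : χ (i + 1) ↔ χ i := by tauto
    refine hnc (forall_of_forall_window hd (fun i m => ?_) i fun j hj hj' => ?_)
    · rw [show i + 2 * m + 1 = i + 1 + 2 * m by ring, hmul, hmul]
    · obtain rfl | rfl : j = i ∨ j = i + 1 := by omega
      · exact hi
      · rw [hi, ← htwo i]
        ring_nf
  refine ⟨halt, ?_⟩
  rw [h2 0, sub_zero, ← halt, sub_add_cancel]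

/-- Consecutively adjacent, pairwise distinct vertices form a path. -/
lemma exists_isPath_of_forall_adj {V : Type*} {G : SimpleGraph V} (g : ℕ → V) (l : ℕ)
    (hadj : ∀ i < l, G.Adj (g i) (g (i + 1)))
    (hinj : ∀ i j, i < j → j ≤ l → g i ≠ g j) :
    ∃ p : G.Walk (g 0) (g l), p.IsPath ∧ p.length = l := by
  have key : ∀ m ≤ l, ∃ p : G.Walk (g 0) (g m), p.IsPath ∧ p.length = m ∧
      ∀ v ∈ p.support, ∃ i ≤ m, v = g i := by
    intro m
    induction m with
    | zero => exact fun _ => ⟨.nil, by simp⟩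
    | succ m ih =>
      intro hm
      obtain ⟨p, hp, hlen, hsupp⟩ := ih (by omega)
      refine ⟨p.concat (hadj m (by omega)), hp.concat ?_ _, by simp [hlen], ?_⟩
      · intro hmem
        obtain ⟨i, hi, h⟩ := hsupp _ hmem
        exact hinj i (m + 1) (by omega) hm h.symm
      · intro v hv
        rw [SimpleGraph.Walk.support_concat, List.mem_append,
          List.mem_singleton] at hv
        rcases hv with hv | rfl
        · obtain ⟨i, hi, h⟩ := hsupp v hv
          exact ⟨i, by omega, h⟩
        · exact ⟨m + 1, le_rfl, rfl⟩
  obtain ⟨p, hp, hlen, -⟩ := key l le_rfl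
  exact ⟨p, hp, hlen⟩

section CyclicIndexing

variable {V : Type*} {G : SimpleGraph V} {f : ℤ → V} {n : ℤ}

/-- Two arcs `-εj, …, 0` and `r, …, r + δk` of a cycle, joined by the chord `0, r`, form a path. -/
lemma exists_isPath_through_chord (hfn : ∀ a b, f a = f b → n ∣ a - b)
    (hf : ∀ a, G.Adj (f a) (f (a + 1))) {r : ℤ} (hchord : G.Adj (f 0) (f r))
    {ε δ : ℤ} (hε : ε = 1 ∨ ε = -1) (hδ : δ = 1 ∨ δ = -1) {j k : ℕ} (hj : j < n) (hk : k < n)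
    (hdisj : ∀ s t : ℕ, s ≤ j → t ≤ k → 0 < r + δ * t + ε * s ∧ r + δ * t + ε * s < n) :
    ∃ p : G.Walk (f (-(ε * j))) (f (r + δ * k)), p.IsPath ∧ p.length = j + k + 1 := by
  have hne : ∀ a b, 0 < b - a → b - a < n → f a ≠ f b := by
    intro a b h0 h1 h
    have := Int.le_of_dvd h0 (hfn b a h.symm)
    omega
  have hstep : ∀ {σ : ℤ}, σ = 1 ∨ σ = -1 → ∀ a, G.Adj (f a) (f (a + σ)) := by
    rintro σ (rfl | rfl) a
    · exact hf a
    · simpa using (hf (a + -1)).symm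
  let g : ℕ → V := fun t => if t ≤ j then f (ε * (t - j)) else f (r + δ * (t - j - 1))
  have hg : ∃ p : G.Walk (g 0) (g (j + k + 1)), p.IsPath ∧ p.length = j + k + 1 := by
    refine exists_isPath_of_forall_adj g _ (fun t ht => ?_) (fun s t hst ht => ?_)
    · rcases lt_trichotomy t j with h | rfl | h
      · simp only [g, if_pos h.le, if_pos (show t + 1 ≤ j from h)]
        have := hstep hε (ε * (t - j))
        rwa [show ε * ((t : ℤ) - j) + ε = ε * (((t + 1 : ℕ) : ℤ) - j) by push_cast; ring] at this
      · simpa [g] using hchord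
      · simp only [g, if_neg (show ¬ t ≤ j by omega), if_neg (show ¬ t + 1 ≤ j by omega)]
        have := hstep hδ (r + δ * (t - j - 1))
        rwa [show r + δ * ((t : ℤ) - j - 1) + δ = r + δ * (((t + 1 : ℕ) : ℤ) - j - 1) by
          push_cast; ring] at this
    · by_cases h1 : s ≤ j <;> by_cases h2 : t ≤ j
      · simp only [g, if_pos h1, if_pos h2]
        rcases hε with rfl | rfl
        · exact hne _ _ (by omega) (by omega)
        · exact (hne _ _ (by omega) (by omega)).symm
      · simp only [g, if_pos h1, if_neg h2]
        have := hdisj (j - s) (t - j - 1) (by omega) (by omega)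
        refine hne _ _ ?_ ?_ <;> rcases hε with rfl | rfl <;> rcases hδ with rfl | rfl <;> omega
      · omega
      · simp only [g, if_neg h1, if_neg h2]
        rcases hδ with rfl | rfl
        · exact hne _ _ (by omega) (by omega)
        · exact (hne _ _ (by omega) (by omega)).symm
  have h0 : g 0 = f (-(ε * j)) := by
    simp [g]
  have h1 : g (j + k + 1) = f (r + δ * k) := by
    simp only [g, if_neg (show ¬ j + k + 1 ≤ j by omega)]
    congr 1
    push_cast
    ring
  rwa [h0, h1] at hg

/-- If no path of length `l` in a cycle with chord `0, r` leaves or enters `A`, and `A` is a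
nontrivial set of vertices, then every edge has exactly one endpoint in `A`. -/
lemma alternating_of_forall_isPath (hper : ∀ a, f (a + n) = f a)
    (hfn : ∀ a b, f a = f b → n ∣ a - b) (hf : ∀ a, G.Adj (f a) (f (a + 1)))
    {r : ℤ} (hr : 2 ≤ r) (hrn : r ≤ n - 2) (hchord : G.Adj (f 0) (f r))
    {A : Set V} (hA : ¬ ∀ i, f (i + 1) ∈ A ↔ f i ∈ A) {l : ℕ} (hl : 1 ≤ l) (hln : l < n)
    (hpath : ∀ u v (p : G.Walk u v), p.IsPath → p.length = l → (u ∈ A ↔ v ∈ A)) :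
    (∀ i, f (i + 1) ∈ A ↔ f i ∉ A) ∧ (f r ∈ A ↔ f 0 ∉ A) := by
  have hthrough : ∀ {ε δ : ℤ}, ε = 1 ∨ ε = -1 → δ = 1 ∨ δ = -1 → ∀ {j k : ℤ}, 0 ≤ j → 0 ≤ k →
      j + k + 1 = l → (∀ s t : ℤ, 0 ≤ s → 0 ≤ t → s ≤ j → t ≤ k →
        0 < r + δ * t + ε * s ∧ r + δ * t + ε * s < n) →
      (f (-(ε * j)) ∈ A ↔ f (r + δ * k) ∈ A) := by
    intro ε δ hε hδ j k hj hk hjk hdisj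
    lift j to ℕ using hj
    lift k to ℕ using hk
    obtain ⟨p, hp, hlen⟩ := exists_isPath_through_chord hfn hf hchord hε hδ
      (j := j) (k := k) (by omega) (by omega)
      (fun s t hs ht => hdisj s t (by omega) (by omega) (by omega) (by omega))
    exact hpath _ _ p hp (by omega)
  refine alternating_of_chord_symmetries (fun i => f i ∈ A) hr hrn (l := l) (by omega) hln
    (fun i => by rw [hper]) (fun i => ?_) hA ?_ ?_ ?_ ?_
  · obtain ⟨p, hp, hlen⟩ := exists_isPath_of_forall_adj (G := G) (fun t : ℕ => f (i + t)) l
      (fun t _ => by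
        push_cast
        rw [← add_assoc]
        exact hf _)
      (fun s t hst ht h => by
        have := Int.le_of_dvd (by omega) (hfn _ _ h.symm)
        omega)
    simpa using (hpath _ _ p hp hlen).symm
  · intro j k hj hk hjk h1 h2
    simpa [sub_eq_add_neg] using hthrough (ε := 1) (δ := -1) (by simp) (by simp) hj hk hjk
      (fun s t _ _ _ _ => by omega)
  · intro j k hj hk hjk h1 h2
    simpa [sub_eq_add_neg] using hthrough (ε := -1) (δ := 1) (by simp) (by simp) hj hk hjk
      (fun s t _ _ _ _ => by omega)
  · intro j k hj hk hjk h1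
    simpa [sub_eq_add_neg] using hthrough (ε := 1) (δ := 1) (by simp) (by simp) hj hk hjk
      (fun s t _ _ _ _ => by omega)
  · intro j k hj hk hjk h1
    simpa [sub_eq_add_neg] using hthrough (ε := -1) (δ := -1) (by simp) (by simp) hj hk hjk
      (fun s t _ _ _ _ => by omega)

end CyclicIndexing

/-- The vertices of a cycle can be indexed by the integers modulo its length. -/
lemma SimpleGraph.Walk.IsCycle.exists_cyclic_indexing {V : Type*} {G : SimpleGraph V} {x : V}
    {c : G.Walk x x} (hc : c.IsCycle) :
    ∃ f : ℤ → V, (∀ a, f (a + c.length) = f a) ∧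
      (∀ a b, f a = f b → (c.length : ℤ) ∣ a - b) ∧
      (∀ a, s(f a, f (a + 1)) ∈ c.edges) ∧
      (∀ u v, s(u, v) ∈ c.edges → ∃ a, s(f a, f (a + 1)) = s(u, v)) ∧
      ∀ v ∈ c.support, ∃ a, f a = v := by
  have hn : (0 : ℤ) < c.length := by
    have := hc.three_le_length
    omega
  let f : ℤ → V := fun a => c.getVert (a % c.length).toNat
  have hnat : ∀ i : ℕ, i ≤ c.length → f i = c.getVert i := by
    intro i hi
    rcases hi.lt_or_eq with h | rfl
    · simp only [f]
      rw [Int.emod_eq_of_lt (by omega) (by omega), Int.toNat_natCast]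
    · simp [f]
  have hper : ∀ a m, f (a + c.length * m) = f a := by
    intro a m
    simp [f]
  have hrep : ∀ a : ℤ, ∃ i : ℕ, ∃ m : ℤ, i < c.length ∧ a = i + c.length * m := by
    intro a
    have h0 := Int.emod_nonneg a hn.ne'
    have h1 := Int.emod_lt_of_pos a hn
    refine ⟨(a % c.length).toNat, a / c.length, by omega, ?_⟩
    rw [Int.toNat_of_nonneg h0, Int.emod_add_mul_ediv]
  refine ⟨f, fun a => by simp [f], fun a b h => ?_, fun a => ?_, fun u v h => ?_, fun v h => ?_⟩
  · obtain ⟨i, m, hi, rfl⟩ := hrep a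
    obtain ⟨j, m', hj, rfl⟩ := hrep b
    rw [hper, hper, hnat i hi.le, hnat j hj.le] at h
    obtain rfl := hc.getVert_injOn' (by rw [Set.mem_ofPred_eq]; omega)
      (by rw [Set.mem_ofPred_eq]; omega) h
    exact ⟨m - m', by ring⟩
  · obtain ⟨i, m, hi, rfl⟩ := hrep a
    rw [add_right_comm, hper, hper, SimpleGraph.Walk.mk_mem_edges_iff_exists]
    refine ⟨i, hi, ?_⟩
    rw [← hnat i hi.le, ← hnat (i + 1) hi]
    push_cast
    rfl
  · obtain ⟨i, hi, h⟩ := c.mk_mem_edges_iff_exists.1 h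
    refine ⟨i, ?_⟩
    rw [← h, ← hnat i hi.le, ← hnat (i + 1) hi]
    push_cast
    rfl
  · obtain ⟨i, hi, hle⟩ := SimpleGraph.Walk.mem_support_iff_exists_getVert.1 h
    exact ⟨i, by rw [hnat i hle, hi]⟩


/-- Verstraëte's lemma: let `G` be a graph consisting of a (spanning) cycle `c`
together with a chord `e`, and let `(A, B)` be a nontrivial partition of its vertex
set.  Then `G` contains `(A, B)`-paths of every length `1 ≤ l < |C|`, unless the
cycle with its chord is bipartite with bipartition `(A, B)`. -/
theorem paths_of_all_lengths_in_chorded_cycle {V : Type} [Fintype V]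
    (G : SimpleGraph V) (x : V) (c : G.Walk x x) (e : Sym2 V)
    (hc : c.IsCycle)
    (hspan : ∀ v : V, v ∈ c.support)            -- the cycle passes through all vertices
    (heG : e ∈ G.edgeSet) (hec : e ∉ c.edges)   -- `e` is a chord of the cycle
    (hedges : G.edgeSet = {e' | e' ∈ c.edges} ∪ {e})  -- `G` is the cycle plus the chord
    (A B : Set V) (hA : A.Nonempty) (hB : B.Nonempty)
    (hpart : ∀ v : V, v ∈ A ↔ v ∉ B)            -- `(A, B)` is a partition of `V`
    (hnotbip : ¬ ∀ u v : V, G.Adj u v → (u ∈ A ↔ v ∈ B)) :  -- not bipartite w.r.t. `(A, B)`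
    ∀ l : ℕ, 1 ≤ l → l < Fintype.card V →
      ∃ (a b : V) (p : G.Walk a b), a ∈ A ∧ b ∈ B ∧ p.IsPath ∧ p.length = l := by
  intro l hl hlV
  by_contra! hno
  have hpath : ∀ u v (p : G.Walk u v), p.IsPath → p.length = l → (u ∈ A ↔ v ∈ A) := by
    intro u v p hp hlen
    by_cases hu : u ∈ A <;> by_cases hv : v ∈ A <;> simp only [hu, hv]
    · exact (hno u v p hu (by simpa [hpart] using hv) hp hlen).elim
    · exact (hno v u p.reverse hv (by simpa [hpart] using hu) hp.reverse (by simpa)).elim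
  obtain ⟨f, hper, hfn, hf, hfe, hfs⟩ := hc.exists_cyclic_indexing
  have hp : Function.Periodic f c.length := hper
  have hfV : ∀ v, ∃ a, f a = v := fun v => hfs v (hspan v)
  have hadj : ∀ a, G.Adj (f a) (f (a + 1)) := fun a => c.adj_of_mem_edges (hf a)
  have hn : (0 : ℤ) < c.length := by
    have := hc.three_le_length
    omega
  have hln : l < c.length := by
    refine hlV.trans_le ?_
    have := Fintype.card_le_of_surjective (fun i : Fin c.length => f i) fun v => by
      obtain ⟨a, rfl⟩ := hfV v
      have h0 := Int.emod_nonneg a hn.ne'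
      have h1 := Int.emod_lt_of_pos a hn
      refine ⟨⟨(a % c.length).toNat, by omega⟩, ?_⟩
      simp only [Int.toNat_of_nonneg h0]
      rw [Int.emod_def, mul_comm]
      exact hp.sub_int_mul_eq _
    simpa using this
  induction e using Sym2.ind with
  | _ u v =>
  obtain ⟨a, rfl⟩ := hfV u
  obtain ⟨b, rfl⟩ := hfV v
  obtain ⟨r, hr0, hrn, hr⟩ : ∃ r : ℤ, 0 ≤ r ∧ r < c.length ∧ f (r + a) = f b := by
    refine ⟨(b - a) % c.length, Int.emod_nonneg _ hn.ne', Int.emod_lt_of_pos _ hn, ?_⟩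
    rw [← hp.sub_int_mul_eq ((b - a) / c.length) (x := b), Int.emod_def]
    congr 1
    push_cast
    ring
  rw [← hr] at heG hec hedges
  have hne0 : r ≠ 0 := by
    rintro rfl
    simp at heG
  have hne1 : r ≠ 1 := by
    rintro rfl
    exact hec (by simpa [add_comm] using hf a)
  have hnen : r ≠ c.length - 1 := by
    rintro rfl
    refine hec ?_
    rw [show (c.length : ℤ) - 1 + a = a - 1 + c.length by ring, hper, Sym2.eq_swap]
    simpa using hf (a - 1)
  obtain ⟨halt, hchord⟩ := alternating_of_forall_isPath (G := G) (f := fun i => f (i + a))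
    (n := c.length) (r := r) (A := A) (fun i => by rw [add_right_comm, hper])
    (fun i j h => by simpa using hfn _ _ h)
    (fun i => by rw [add_right_comm]; exact hadj _) (by omega) (by omega)
    (by simpa using heG)
    (fun h => by
      obtain ⟨y, hy⟩ := hA
      obtain ⟨z, hz⟩ := hB
      obtain ⟨i, rfl⟩ := hfV y
      obtain ⟨j, rfl⟩ := hfV z
      have hall := forall_of_forall_window (P := fun t => f (t + a) ∈ A) one_pos
        (fun t m => by
          induction m using Int.induction_on with
          | zero => simp
          | succ m ih => rw [← ih, ← h (t + 1 * m)]; ring_nf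
          | pred m ih => rw [← ih, ← h (t + 1 * (-m - 1))]; ring_nf) (i - a)
        (fun t ht ht' => by
          obtain rfl : t = i - a := by omega
          simpa using hy) (j - a)
      simp only [sub_add_cancel] at hall
      exact (hpart _).1 hall hz)
    hl (by omega) hpath
  have hB' : ∀ v, v ∈ B ↔ v ∉ A := fun v => by simp [hpart]
  refine hnotbip fun u v huv => ?_
  have huv' : s(u, v) ∈ G.edgeSet := huv
  rw [hedges] at huv'
  rw [hB']
  rcases huv' with h | h
  · obtain ⟨t, ht⟩ := hfe u v h
    have := halt (t - a)
    rw [show t - a + 1 + a = t + 1 by ring, sub_add_cancel] at this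
    rcases Sym2.eq_iff.1 ht with ⟨rfl, rfl⟩ | ⟨rfl, rfl⟩ <;> tauto
  · simp only [zero_add] at hchord
    rcases Sym2.eq_iff.1 h with ⟨rfl, rfl⟩ | ⟨rfl, rfl⟩ <;> tauto
end

section
/- There exists an absolute constant C > 0 such that for every odd integer l ≥ 5, every natural number k ≥ 1, and every finite simple graph G containing no cycle of length l, if the minimum degree of G is at least (C·l/k)·|V(G)|, then the chromatic number of G is at most k. -/
/-- If every `R`-chain has fewer than `m` steps, then there is a map to `Fin m` that is strictly
increasing along `R`. -/
theorem exists_fin_strictMono_of_no_chain {V : Type*} (R : V → V → Prop) (m : ℕ) (hm : 0 < m)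
    (h : ∀ g : ℕ → V, ¬ ∀ i < m, R (g i) (g (i + 1))) :
    ∃ f : V → Fin m, ∀ x y, R x y → f x < f y := by
  classical
  let P : V → ℕ → Prop := fun x n => ∃ g : ℕ → V, g n = x ∧ ∀ i < n, R (g i) (g (i + 1))
  have hP0 : ∀ x, P x 0 := fun x => ⟨fun _ => x, rfl, by simp⟩
  refine ⟨fun x => ⟨Nat.findGreatest (P x) (m - 1), ?_⟩, fun x y hxy => ?_⟩
  · have := Nat.findGreatest_le (P := P x) (m - 1)
    omega
  · have hx : P x (Nat.findGreatest (P x) (m - 1)) :=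
      Nat.findGreatest_spec (P := P x) (Nat.zero_le _) (hP0 x)
    have hle := Nat.findGreatest_le (P := P x) (m - 1)
    rw [Fin.mk_lt_mk]
    generalize Nat.findGreatest (P x) (m - 1) = n at hx hle
    obtain ⟨g, hgn, hg⟩ := hx
    have hy : ∀ i < n + 1, R (Function.update g (n + 1) y i)
        (Function.update g (n + 1) y (i + 1)) := by
      intro i hi
      rw [Function.update_of_ne (by omega)]
      rcases Nat.lt_succ_iff_lt_or_eq.mp hi with hi | rfl
      · rw [Function.update_of_ne (by omega)]
        exact hg i hi
      · rw [Function.update_self, hgn]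
        exact hxy
    have hn : n + 1 ≤ m - 1 := by
      by_contra hcon
      exact h _ fun i hi => hy i (by omega)
    exact Nat.le_findGreatest hn ⟨_, Function.update_self .., hy⟩

/-- An injective sequence of consecutively adjacent vertices spans a path. -/
theorem exists_isPath_of_injOn {V : Type*} {G : SimpleGraph V} (g : ℕ → V) (m a : ℕ)
    (hadj : ∀ i, a ≤ i → i < a + m → G.Adj (g i) (g (i + 1)))
    (hinj : Set.InjOn g (Set.Icc a (a + m))) :
    ∃ p : G.Walk (g a) (g (a + m)), p.IsPath ∧ p.length = m ∧
      ∀ x ∈ p.support, ∃ i, a ≤ i ∧ i ≤ a + m ∧ g i = x := by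
  induction m generalizing a with
  | zero => exact ⟨.nil, by simp, rfl, fun x hx => ⟨a, le_rfl, le_rfl, by simpa [eq_comm] using hx⟩⟩
  | succ m ih =>
    have e : a + (m + 1) = a + 1 + m := by omega
    rw [e] at hadj hinj ⊢
    obtain ⟨p, hp, hl, hs⟩ := ih (a + 1) (fun i h1 h2 => hadj i (by omega) h2)
      (hinj.mono (Set.Icc_subset_Icc (by omega) le_rfl))
    refine ⟨.cons (hadj a le_rfl (by omega)) p, ?_, by simp [hl], ?_⟩
    · rw [SimpleGraph.Walk.cons_isPath_iff]
      refine ⟨hp, fun hmem => ?_⟩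
      obtain ⟨i, h1, h2, h3⟩ := hs _ hmem
      have := hinj ⟨by omega, h2⟩ ⟨le_rfl, by omega⟩ h3
      omega
    · intro x hx
      rw [SimpleGraph.Walk.support_cons, List.mem_cons] at hx
      rcases hx with rfl | hx
      · exact ⟨a, le_rfl, by omega, rfl⟩
      · obtain ⟨i, h1, h2, h3⟩ := hs _ hx
        exact ⟨i, by omega, h2, h3⟩

/-- Joining the ends of a path with at least two edges produces a cycle. -/
theorem SimpleGraph.Walk.IsPath.hasCycleOfLength {V : Type*} {G : SimpleGraph V} {u v : V}
    {p : G.Walk u v} (hp : p.IsPath) (h : G.Adj v u) {n : ℕ} (hn : 2 ≤ n) (hl : p.length = n) :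
    HasCycleOfLength G (n + 1) := by
  refine ⟨v, .cons h p, ?_, by simp [hl]⟩
  rw [SimpleGraph.Walk.cons_isCycle_iff]
  refine ⟨hp, fun he => ?_⟩
  rw [Sym2.eq_swap] at he
  have := hp.length_eq_one_of_mem_edges he
  omega

/-- A finite graph has a set of vertices with pairwise disjoint neighborhoods such that the
neighborhood of every vertex of positive degree meets the neighborhood of one of them. -/
theorem exists_maximal_disjoint_neighborFinset {V : Type*} [Fintype V] [DecidableEq V]
    (G : SimpleGraph V) [DecidableRel G.Adj] (hdeg : ∀ v, 0 < G.degree v) :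
    ∃ S : Finset V,
      (S : Set V).PairwiseDisjoint (fun s => G.neighborFinset s) ∧
      ∀ v, ∃ s ∈ S, ∃ w, G.Adj s w ∧ G.Adj w v := by
  classical
  obtain ⟨S, hS⟩ := (Set.toFinite {S : Finset V |
    (S : Set V).PairwiseDisjoint (fun s => G.neighborFinset s)}).exists_maximal
      ⟨∅, by simp⟩
  refine ⟨S, hS.prop, fun v => ?_⟩
  by_contra! hcon
  have hv : v ∉ S := fun hv => by
    obtain ⟨w, hw⟩ := (G.degree_pos_iff_exists_adj v).mp (hdeg v)
    exact hcon v hv w hw hw.symm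
  refine hv (hS.le_of_ge (y := insert v S) ?_ (Finset.subset_insert v S)
    (Finset.mem_insert_self v S))
  rw [Set.mem_ofPred_eq, Finset.coe_insert]
  refine hS.prop.insert fun s hs _ => ?_
  rw [Finset.disjoint_left]
  intro w hw hw'
  rw [SimpleGraph.mem_neighborFinset] at hw hw'
  exact hcon s hs w hw' hw.symm

/-- Consider a path `g` with `m` edges, each of whose vertices has a neighbor (its parent) off the
path, such that the parents are monotone along the path for some linear order. If the parents all
equal `s`, or are all adjacent to a vertex `s` off the path, then there is a cycle of length
`m + 2`. -/
theorem hasCycleOfLength_of_monotone_parents {V : Type*} {G : SimpleGraph V} {α : Type*}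
    [LinearOrder α] (e : V → α) (he : Function.Injective e) (g : ℕ → V) (p : V → V) (s : V)
    (m : ℕ) (hm : 3 ≤ m)
    (hadj : ∀ i < m, G.Adj (g i) (g (i + 1)))
    (hinj : Set.InjOn g (Set.Icc 0 m))
    (hmono : ∀ i < m, e (p (g i)) ≤ e (p (g (i + 1))))
    (hp : ∀ i ≤ m, G.Adj (p (g i)) (g i))
    (hpg : ∀ i ≤ m, ∀ j ≤ m, p (g i) ≠ g j)
    (hs : (∀ i ≤ m, p (g i) = s) ∨
      ((∀ i ≤ m, G.Adj s (p (g i))) ∧ ∀ i ≤ m, s ≠ g i)) :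
    HasCycleOfLength G (m + 2) := by
  have hmono' : ∀ i j, i ≤ j → j ≤ m → e (p (g i)) ≤ e (p (g j)) := by
    intro i j hij
    induction j, hij using Nat.le_induction with
    | base => exact fun _ => le_rfl
    | succ j _ ih => exact fun hj => (ih (by omega)).trans (hmono j (by omega))
  by_cases hconst : ∀ i < m, p (g i) = p (g (i + 1))
  · have hc : ∀ i ≤ m, p (g i) = p (g 0) := by
      intro i
      induction i with
      | zero => exact fun _ => rfl
      | succ i ih => exact fun hi => (hconst i (by omega)).symm.trans (ih (by omega))
    obtain ⟨q, hq, hl, hsup⟩ := exists_isPath_of_injOn (G := G) g m 0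
      (fun i _ hi => hadj i (by omega)) (by simpa using hinj)
    have hq' : (SimpleGraph.Walk.cons (hp 0 (by omega)) q).IsPath := by
      rw [SimpleGraph.Walk.cons_isPath_iff]
      refine ⟨hq, fun hmem => ?_⟩
      obtain ⟨i, -, hi, h⟩ := hsup _ hmem
      exact hpg 0 (by omega) i (by omega) h.symm
    refine hq'.hasCycleOfLength ?_ (n := m + 1) (by omega) (by simp [hl])
    rw [← hc (0 + m) (by omega)]
    exact (hp (0 + m) (by omega)).symm
  · push Not at hconst
    obtain ⟨j, hj, hne⟩ := hconst
    obtain ⟨hs1, hs2⟩ : (∀ i ≤ m, G.Adj s (p (g i))) ∧ ∀ i ≤ m, s ≠ g i := by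
      refine hs.resolve_left fun h => hne ?_
      rw [h j (by omega), h (j + 1) (by omega)]
    obtain ⟨a, ha1, ha2, ha3⟩ : ∃ a, a ≤ j ∧ j + 1 ≤ a + (m - 2) ∧ a + (m - 2) ≤ m :=
      ⟨min j 2, by omega, by omega, by omega⟩
    have hpne : p (g (a + (m - 2))) ≠ p (g a) := by
      intro h
      have h1 := hmono' a j ha1 (by omega)
      have h2 := hmono' (j + 1) _ ha2 ha3
      rw [h] at h2
      exact hne (he (le_antisymm (hmono j hj) (h2.trans h1)))
    obtain ⟨q, hq, hl, hsup⟩ := exists_isPath_of_injOn (G := G) g (m - 2) a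
      (fun i _ hi => hadj i (by omega))
      (hinj.mono (Set.Icc_subset_Icc (by omega) ha3))
    have hq3 : (SimpleGraph.Walk.cons (hs1 (a + (m - 2)) ha3).symm
        (.cons (hs1 a (by omega)) (.cons (hp a (by omega)) q))).IsPath := by
      simp only [SimpleGraph.Walk.cons_isPath_iff, SimpleGraph.Walk.support_cons, List.mem_cons,
        not_or]
      refine ⟨⟨⟨hq, fun hmem => ?_⟩, (hs1 a (by omega)).ne, fun hmem => ?_⟩,
        (hs1 _ ha3).ne', hpne, fun hmem => ?_⟩ <;> obtain ⟨i, -, hi, h⟩ := hsup _ hmem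
      · exact hpg a (by omega) i (by omega) h.symm
      · exact hs2 i (by omega) h.symm
      · exact hpg _ ha3 i (by omega) h.symm
    exact hq3.hasCycleOfLength (hp _ ha3).symm (n := m + 1) (by omega)
      (by simp only [SimpleGraph.Walk.length_cons, hl]; omega)

/-- If every vertex is joined to a vertex of `S` by a walk of length two, then a graph without
cycles of length `m + 2` has a proper coloring with `3 * m` colors for each element of `S`. -/
theorem colorable_of_dominating_second_neighborhoods {V : Type*} [Fintype V]
    (G : SimpleGraph V) (m : ℕ) (hm : 3 ≤ m) (hG : ¬ HasCycleOfLength G (m + 2)) (S : Finset V)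
    (hS : ∀ v, ∃ s ∈ S, ∃ w, G.Adj s w ∧ G.Adj w v) :
    G.Colorable (S.card * (3 * m)) := by
  classical
  choose s hsS w hsw hwv using hS
  let t : V → Fin 3 := fun v => if v = s v then 0 else if G.Adj (s v) v then 1 else 2
  let p : V → V := fun v => if G.Adj (s v) v then s v else w v
  let e := Fintype.equivFin V
  let key : V → Fin (Fintype.card V) ×ₗ Fin (Fintype.card V) := fun v => toLex (e (p v), e v)
  have hkey : Function.Injective key := fun x y h => by
    have h2 := congrArg (fun z => (ofLex z).2) h
    exact e.injective h2
  let R : V → V → Prop := fun x y => G.Adj x y ∧ s x = s y ∧ t x = t y ∧ key x < key y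
  have ht0 : ∀ v, t v = 0 ↔ v = s v := by
    intro v
    simp only [t]
    split_ifs with h1 h2
    · exact iff_of_true rfl h1
    · exact iff_of_false (by decide) h1
    · exact iff_of_false (by decide) h1
  have ht1 : ∀ v, v ≠ s v → (t v = 1 ↔ G.Adj (s v) v) := by
    intro v hv
    simp only [t, if_neg hv]
    split_ifs with h
    · exact iff_of_true rfl h
    · exact iff_of_false (by decide) h
  obtain ⟨f, hf⟩ := exists_fin_strictMono_of_no_chain R m (by omega) (by
    intro g hg
    have hsg : ∀ i ≤ m, s (g i) = s (g 0) := by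
      intro i
      induction i with
      | zero => exact fun _ => rfl
      | succ i ih => exact fun hi => (hg i (by omega)).2.1.symm.trans (ih (by omega))
    have htg : ∀ i ≤ m, t (g i) = t (g 0) := by
      intro i
      induction i with
      | zero => exact fun _ => rfl
      | succ i ih => exact fun hi => (hg i (by omega)).2.2.1.symm.trans (ih (by omega))
    have hkg : StrictMonoOn (fun i => key (g i)) (Set.Icc 0 m) := by
      intro i _ j hj hij
      have hjm : j ≤ m := hj.2
      clear hj
      induction j, hij using Nat.le_induction with
      | base => exact (hg i (by omega)).2.2.2
      | succ j _ ih => exact (ih (by omega)).trans (hg j (by omega)).2.2.2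
    have hinj : Set.InjOn g (Set.Icc 0 m) := fun i hi j hj h =>
      hkg.injOn hi hj (congrArg key h)
    have hne : ∀ i ≤ m, g i ≠ s (g 0) := by
      intro i hi h
      have h0 : t (g i) = 0 := (ht0 _).mpr (h.trans (hsg i hi).symm)
      have hall : ∀ j ≤ m, g j = s (g 0) := fun j hj =>
        ((ht0 _).mp ((htg j hj).trans ((htg i hi).symm.trans h0))).trans (hsg j hj)
      exact (hg 0 (by omega)).1.ne ((hall 0 (by omega)).trans (hall 1 (by omega)).symm)
    have hadj : ∀ i ≤ m, (G.Adj (s (g 0)) (g i) ↔ t (g 0) = 1) := by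
      intro i hi
      have := ht1 (g i) (by rw [hsg i hi]; exact hne i hi)
      rw [← htg i hi, this, hsg i hi]
    have hmono : ∀ i < m, e (p (g i)) ≤ e (p (g (i + 1))) := by
      intro i hi
      rcases Prod.Lex.toLex_lt_toLex.mp (hg i hi).2.2.2 with h | h
      · exact h.le
      · exact h.1.le
    by_cases h1 : t (g 0) = 1
    · have hp : ∀ i ≤ m, p (g i) = s (g 0) := by
        intro i hi
        simp only [p, hsg i hi, (hadj i hi).mpr h1, if_true]
      refine hG (hasCycleOfLength_of_monotone_parents e e.injective g p (s (g 0)) m hm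
        (fun i hi => (hg i hi).1) hinj hmono ?_ ?_ (.inl hp))
      · intro i hi
        rw [hp i hi]
        exact (hadj i hi).mpr h1
      · intro i hi j hj
        rw [hp i hi]
        exact (hne j hj).symm
    · have hn : ∀ i ≤ m, ¬ G.Adj (s (g 0)) (g i) := fun i hi h => h1 ((hadj i hi).mp h)
      have hp : ∀ i ≤ m, p (g i) = w (g i) := by
        intro i hi
        simp only [p, hsg i hi, hn i hi, if_false]
      have hsp : ∀ i ≤ m, G.Adj (s (g 0)) (p (g i)) := by
        intro i hi
        rw [hp i hi, ← hsg i hi]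
        exact hsw _
      refine hG (hasCycleOfLength_of_monotone_parents e e.injective g p (s (g 0)) m hm
        (fun i hi => (hg i hi).1) hinj hmono ?_ ?_ (.inr ⟨hsp, fun i hi => (hne i hi).symm⟩))
      · intro i hi
        rw [hp i hi]
        exact hwv _
      · intro i hi j hj h
        exact hn j hj (h ▸ hsp i hi))
  let c : G.Coloring (S × Fin 3 × Fin m) :=
    SimpleGraph.Coloring.mk (fun v => (⟨s v, hsS v⟩, t v, f v)) (by
      intro x y hxy h
      simp only [Prod.mk.injEq, Subtype.mk.injEq] at h
      rcases lt_trichotomy (key x) (key y) with hlt | heq | hlt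
      · exact (hf x y ⟨hxy, h.1, h.2.1, hlt⟩).ne h.2.2
      · exact hxy.ne (hkey heq)
      · exact (hf y x ⟨hxy.symm, h.1.symm, h.2.1.symm, hlt⟩).ne h.2.2.symm)
  simpa using c.colorable

/-- There is an absolute constant `C > 0` such that every `C_l`-free graph (for odd
`l ≥ 5`) with minimum degree at least `(C * l / k) * |V|` has chromatic number at
most `k`. -/
theorem chromatic_number_of_odd_cycle_free_graphs :
    ∃ C : ℝ, 0 < C ∧ ∀ (l k : ℕ), Odd l → 5 ≤ l → 1 ≤ k →
      ∀ (V : Type) [Fintype V] (G : SimpleGraph V),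
        ¬ HasCycleOfLength G l →
        (∀ v : V, C * l / k * (Fintype.card V) ≤ (Nat.card (G.neighborSet v) : ℝ)) →
        G.chromaticNumber ≤ (k : ℕ∞) := by
  refine ⟨3, by norm_num, fun l k _ hl hk V _ G hG hd => ?_⟩
  classical
  rw [SimpleGraph.chromaticNumber_le_iff_colorable]
  rcases isEmpty_or_nonempty V with hV | hV
  · exact SimpleGraph.Colorable.of_isEmpty k
  have hn : (0 : ℝ) < Fintype.card V := by exact_mod_cast Fintype.card_pos
  have hk' : (0 : ℝ) < k := by exact_mod_cast hk
  have hl' : (0 : ℝ) < l := by exact_mod_cast (by omega : 0 < l)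
  have hd' : ∀ v, 3 * (l : ℝ) / k * Fintype.card V ≤ G.degree v := fun v => by
    rw [← SimpleGraph.card_neighborSet_eq_degree, ← Nat.card_eq_fintype_card (α := G.neighborSet v)]
    exact hd v
  obtain ⟨S, hdis, hS⟩ := exists_maximal_disjoint_neighborFinset G fun v => by
    have : (0 : ℝ) < G.degree v := lt_of_lt_of_le (by positivity) (hd' v)
    exact_mod_cast this
  have hsum : ∑ v ∈ S, G.degree v ≤ Fintype.card V := by
    simp only [← SimpleGraph.card_neighborFinset_eq_degree]
    rw [← Finset.card_biUnion hdis]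
    exact Finset.card_le_univ _
  have hcard : (S.card : ℝ) * (3 * l / k * Fintype.card V) ≤ Fintype.card V := by
    calc (S.card : ℝ) * (3 * l / k * Fintype.card V)
        ≤ ∑ v ∈ S, (G.degree v : ℝ) := by
          rw [← nsmul_eq_mul]
          exact Finset.card_nsmul_le_sum _ _ _ fun v _ => hd' v
      _ ≤ Fintype.card V := by exact_mod_cast hsum
  have hle : (S.card : ℝ) * (3 * l) ≤ k := by
    have h1 : (S.card : ℝ) * (3 * l) / k ≤ 1 := by
      refine le_of_mul_le_mul_right ?_ hn
      calc (S.card : ℝ) * (3 * l) / k * Fintype.card V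
          = S.card * (3 * l / k * Fintype.card V) := by ring
        _ ≤ 1 * Fintype.card V := by rwa [one_mul]
    rwa [div_le_one hk'] at h1
  have hle' : S.card * (3 * l) ≤ k := by exact_mod_cast hle
  refine (colorable_of_dominating_second_neighborhoods G (l - 2) (by omega)
    (by rwa [Nat.sub_add_cancel (by omega)]) S hS).mono (le_trans ?_ hle')
  gcongr
  omega
end

section
/- Let l ≥ 5 be an odd integer and k ≥ 1 a natural number, and let N(l+1, k+1) denote the minimum number of vertices of a finite simple graph with girth at least l+1 and chromatic number at least k+1. Then for every t ≥ 1 there exists a finite simple graph G with more than t vertices such that G contains no odd cycle of length less than l+1 (in particular G contains no cycle of length l), the minimum degree of G is at least k·|V(G)|/N(l+1, k+1), and the chromatic number of G is greater than k. -/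
/-- `N g m` is the minimum number of vertices of a finite simple graph with girth at
least `g` and chromatic number at least `m`. -/
noncomputable def minOrderGirthChrom (g m : ℕ) : ℕ :=
  sInf {n : ℕ | ∃ G : SimpleGraph (Fin n),
    (g : ℕ∞) ≤ G.girth ∧ (m : ℕ∞) ≤ G.chromaticNumber}

namespace SimpleGraph

variable {V : Type*}

/-- If all odd cycles of `G` are longer than `L`, then every walk of length at most `L` can be
shortened to a path whose length has the same parity. -/
theorem Walk.exists_isPath_even_length_iff {G : SimpleGraph V} {L : ℕ}
    (hG : ∀ (v : V) (c : G.Walk v v), c.IsCycle → Odd c.length → L < c.length)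
    {u v : V} (p : G.Walk u v) (hp : p.length ≤ L) :
    ∃ q : G.Walk u v, q.IsPath ∧ q.length ≤ p.length ∧ (Even q.length ↔ Even p.length) := by
  classical
  induction p with
  | nil => exact ⟨Walk.nil, by simp⟩
  | @cons u w v h p ih =>
    rw [Walk.length_cons] at hp
    obtain ⟨q, hq, hle, hpar⟩ := ih (by omega)
    by_cases hu : u ∈ q.support
    · have hlen : (q.takeUntil u hu).length + (q.dropUntil u hu).length = q.length := by
        rw [← Walk.length_append, Walk.take_spec]
      have hodd : Odd (q.takeUntil u hu).length := by
        by_cases he : s(u, w) ∈ (q.takeUntil u hu).edges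
        · rw [(hq.takeUntil hu).length_eq_one_of_mem_edges (Sym2.eq_swap ▸ he)]
          exact odd_one
        · have hc : (Walk.cons h (q.takeUntil u hu)).IsCycle :=
            (Walk.cons_isCycle_iff _ h).2 ⟨hq.takeUntil hu, he⟩
          by_contra hev
          have := hG u _ hc (by
            rw [Walk.length_cons]
            exact (Nat.not_odd_iff_even.1 hev).add_one)
          rw [Walk.length_cons] at this
          omega
      refine ⟨q.dropUntil u hu, hq.dropUntil hu, ?_, ?_⟩
      · rw [Walk.length_cons]; omega
      · rw [Walk.length_cons, Nat.even_add_one, ← hpar, ← hlen, Nat.even_add]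
        have := Nat.not_even_iff_odd.2 hodd
        tauto
    · refine ⟨Walk.cons h q, (Walk.cons_isPath_iff h q).2 ⟨hq, hu⟩, ?_, ?_⟩
      · simpa using hle
      · simp only [Walk.length_cons, Nat.even_add_one, hpar]

/-- A closed walk which is at most as long as a strict lower bound for the lengths of odd cycles
has even length. -/
theorem Walk.even_length_of_forall_isCycle {G : SimpleGraph V} {L : ℕ}
    (hG : ∀ (v : V) (c : G.Walk v v), c.IsCycle → Odd c.length → L < c.length)
    {v : V} (p : G.Walk v v) (hp : p.length ≤ L) : Even p.length := by
  obtain ⟨q, hq, -, hpar⟩ := p.exists_isPath_even_length_iff hG hp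
  obtain rfl := Walk.eq_nil_iff_nil.2 (Walk.isPath_iff_nil.1 hq)
  simpa using hpar

/-- The balanced blow-up of a graph without short odd closed walks. -/
theorem exists_blowup [Fintype V] [Nonempty V] (H : SimpleGraph V) {l k d : ℕ}
    (hodd : ∀ (v : V) (c : H.Walk v v), Odd c.length → l < c.length)
    (hcol : ¬ H.Colorable k) (hdeg : ∀ v, d ≤ Nat.card (H.neighborSet v)) (t : ℕ) :
    ∃ G : SimpleGraph (Fin (Fintype.card V * (t + 1))),
      (∀ v (c : G.Walk v v), Odd c.length → l < c.length) ∧ ¬ G.Colorable k ∧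
      ∀ v, d * (t + 1) ≤ Nat.card (G.neighborSet v) := by
  let e : Fin (Fintype.card V * (t + 1)) ≃ V × Fin (t + 1) :=
    finProdFinEquiv.symm.trans ((Fintype.equivFin V).symm.prodCongr (Equiv.refl _))
  let G : SimpleGraph (Fin (Fintype.card V * (t + 1))) := H.comap fun x ↦ (e x).1
  let f : G →g H := ⟨fun x ↦ (e x).1, fun h ↦ h⟩
  let g : H →g G := ⟨fun v ↦ e.symm (v, 0), fun h ↦ by simpa [G] using h⟩
  refine ⟨G, fun v c hc ↦ ?_, fun h ↦ hcol (h.of_hom g), fun v ↦ ?_⟩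
  · simpa using hodd _ (c.map f) (by simpa using hc)
  · let φ : H.neighborSet (e v).1 × Fin (t + 1) → G.neighborSet v := fun x ↦
      ⟨e.symm (x.1.1, x.2), by
        simpa only [G, mem_neighborSet, comap_adj, Equiv.apply_symm_apply] using x.1.2⟩
    have hφ : Function.Injective φ := by
      rintro ⟨⟨a, ha⟩, i⟩ ⟨⟨b, hb⟩, j⟩ h
      simpa [φ] using h
    have := Nat.card_le_card_of_injective φ hφ
    rw [Nat.card_prod, Nat.card_fin] at this
    exact (Nat.mul_le_mul_right _ (hdeg _)).trans this

/-- A coloring with `k` colors extends to a deleted vertex of degree less than `k`. -/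
theorem Colorable.of_comap_succAbove {n k : ℕ} {H : SimpleGraph (Fin (n + 1))} {v : Fin (n + 1)}
    (hv : Nat.card (H.neighborSet v) < k) (h : (H.comap v.succAbove).Colorable k) :
    H.Colorable k := by
  classical
  obtain ⟨C⟩ := h
  obtain ⟨x, hx⟩ : ∃ x : Fin k, ∀ j, H.Adj v (v.succAbove j) → C j ≠ x := by
    by_contra! hcon
    choose f hf hfx using hcon
    have : Function.Injective fun x ↦ (⟨v.succAbove (f x), hf x⟩ : H.neighborSet v) := by
      intro x y hxy
      have : f x = f y := v.succAbove_right_injective (congrArg Subtype.val hxy)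
      rw [← hfx x, ← hfx y, this]
    have := Nat.card_le_card_of_injective _ this
    rw [Nat.card_fin] at this
    exact absurd hv this.not_gt
  refine ⟨Coloring.mk (v.insertNth (α := fun _ ↦ Fin k) x C) ?_⟩
  intro a b hab
  rcases Fin.eq_self_or_eq_succAbove v a with ha | ⟨i, rfl⟩ <;>
    rcases Fin.eq_self_or_eq_succAbove v b with hb | ⟨j, rfl⟩
  · exact absurd (ha.trans hb.symm) hab.ne
  · subst ha
    simpa using (hx j hab).symm
  · subst hb
    simpa using hx i hab.symm
  · simpa using C.valid (show (H.comap v.succAbove).Adj i j from hab)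

/-- A graph of minimum order among those of girth at least `g` and chromatic number more than
`k ≥ 2` has minimum degree at least `k`. -/
theorem le_card_neighborSet_of_minimal {g k n : ℕ} (hk : 2 ≤ k) {H : SimpleGraph (Fin n)}
    (hg : g ≤ H.girth) (hH : ¬ H.Colorable k)
    (hmin : ∀ m < n, ∀ G : SimpleGraph (Fin m), g ≤ G.girth → G.Colorable k) (v : Fin n) :
    k ≤ Nat.card (H.neighborSet v) := by
  obtain _ | n := n
  · exact v.elim0
  by_contra! hv
  have hG : ¬ (H.comap v.succAbove).Colorable k := fun h ↦ hH (.of_comap_succAbove hv h)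
  refine hG (hmin n (by omega) _ ?_)
  have hac : ¬ (H.comap v.succAbove).IsAcyclic := fun h ↦ hG (h.colorable_two.mono hk)
  obtain ⟨a, w, hw, hlen⟩ := exists_girth_eq_length.2 hac
  let f : H.comap v.succAbove →g H := ⟨v.succAbove, fun h ↦ h⟩
  have := girth_le_length (hw.map (f := f) Fin.succAbove_right_injective)
  rw [Walk.length_map] at this
  omega

/-- The shift graph: increasing `r + 1`-tuples are adjacent when one arises from the other by
dropping its first entry and appending a new last entry. -/
def shiftGraph (r n : ℕ) : SimpleGraph (Fin (r + 1) → Fin n) where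
  Adj a b := ∃ w : Fin (r + 2) → Fin n, StrictMono w ∧
    ((a = Fin.init w ∧ b = Fin.tail w) ∨ (b = Fin.init w ∧ a = Fin.tail w))
  symm := ⟨fun _ _ ⟨w, hw, h⟩ ↦ ⟨w, hw, h.symm⟩⟩
  loopless := ⟨by
    rintro a ⟨w, hw, h⟩
    have h' : (Fin.init w : Fin (r + 1) → Fin n) = Fin.tail w := by
      rcases h with ⟨h₁, h₂⟩ | ⟨h₁, h₂⟩ <;> exact h₁.symm.trans h₂
    have := congrFun h' 0
    simp only [Fin.init, Fin.tail] at this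
    exact absurd (hw.injective this) (by simp)⟩

theorem shiftGraph.strictMono_of_adj {r n : ℕ} {a b : Fin (r + 1) → Fin n}
    (h : (shiftGraph r n).Adj a b) : StrictMono a := by
  obtain ⟨w, hw, ⟨rfl, -⟩ | ⟨-, rfl⟩⟩ := h
  · exact hw.comp (Fin.strictMono_castSucc)
  · exact hw.comp (Fin.strictMono_succ)

/-- A walk of length `m` in the shift graph translates the middle entries by some `s` with
`|s| ≤ m` and `s ≡ m` modulo 2. -/
theorem shiftGraph.exists_shift {r n : ℕ} {a b : Fin (r + 1) → Fin n}
    (p : (shiftGraph r n).Walk a b) :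
    ∃ s : ℤ, |s| ≤ p.length ∧ (Even s ↔ Even p.length) ∧
      ∀ i j : Fin (r + 1), (p.length : ℤ) ≤ i → (i : ℤ) + p.length ≤ r →
        (j : ℤ) = i + s → a i = b j := by
  induction p with
  | nil => exact ⟨0, by simp, by simp, fun i j _ _ h ↦ by
      congr 1; ext; simp at h; omega⟩
  | @cons a c b h p ih =>
    obtain ⟨s, hs, hpar, hij⟩ := ih
    rw [Walk.length_cons]
    push_cast
    rw [abs_le] at hs
    obtain ⟨w, -, ⟨rfl, rfl⟩ | ⟨rfl, rfl⟩⟩ := h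
    · refine ⟨s - 1, ?_, ?_, ?_⟩
      · rw [abs_le]; omega
      · rw [Int.even_sub_one, Nat.even_add_one, hpar]
      · intro i j h₁ h₂ h₃
        rw [← hij ⟨i - 1, by omega⟩ j (by push_cast; omega) (by push_cast; omega)
          (by push_cast; omega)]
        simp only [Fin.init, Fin.tail]
        congr 1; ext; simp; omega
    · refine ⟨s + 1, ?_, ?_, ?_⟩
      · rw [abs_le]; omega
      · rw [Int.even_add_one, Nat.even_add_one, hpar]
      · intro i j h₁ h₂ h₃
        rw [← hij ⟨i + 1, by omega⟩ j (by push_cast; omega) (by push_cast; omega)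
          (by push_cast; omega)]
        simp only [Fin.init, Fin.tail]
        congr 1

/-- Odd closed walks in the shift graph of `2 * l + 1`-tuples are longer than `l`. -/
theorem shiftGraph.lt_length_of_odd {l n : ℕ} {a : Fin (2 * l + 1) → Fin n}
    (p : (shiftGraph (2 * l) n).Walk a a) (hp : Odd p.length) : l < p.length := by
  by_contra! hle
  have ha : StrictMono a := by
    cases p with
    | nil => simp at hp
    | cons h _ => exact strictMono_of_adj h
  obtain ⟨s, hs, hpar, hij⟩ := exists_shift p
  rw [abs_le] at hs
  have := ha.injective (hij ⟨l, by omega⟩ ⟨(l + s).toNat, by omega⟩ (by push_cast; omega)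
    (by push_cast; omega) (by push_cast; omega))
  rw [Fin.ext_iff] at this
  have hs0 : s = 0 := by simp only at this; omega
  exact Nat.not_even_iff_odd.2 hp (hpar.1 (by simp [hs0]))

theorem shiftGraph.exists_not_colorable (r k : ℕ) : ∃ n, ¬ (shiftGraph r n).Colorable k := by
  induction r generalizing k with
  | zero =>
    refine ⟨k + 1, ?_⟩
    rintro ⟨C⟩
    have hlt : ∀ x y : Fin (k + 1), x < y → C ![x] ≠ C ![y] := fun x y hxy ↦
      C.valid ⟨![x, y], by
        rw [Fin.strictMono_iff_lt_succ]
        intro i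
        fin_cases i
        exact hxy, .inl ⟨by ext i; fin_cases i; rfl, by ext i; fin_cases i; rfl⟩⟩
    have hinj : Function.Injective fun x : Fin (k + 1) ↦ C ![x] := by
      intro x y hxy
      rcases lt_trichotomy x y with h | h | h
      · exact absurd hxy (hlt x y h)
      · exact h
      · exact absurd hxy.symm (hlt y x h)
    have := Fintype.card_le_of_injective _ hinj
    simp at this
  | succ r ih =>
    obtain ⟨n, hn⟩ := ih (2 ^ k)
    refine ⟨n, fun ⟨C⟩ ↦ hn ?_⟩
    let D : (Fin (r + 1) → Fin n) → Set (Fin k) := fun a ↦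
      {c | ∃ x, StrictMono (Fin.snoc (α := fun _ ↦ Fin n) a x) ∧ C (Fin.snoc a x) = c}
    have hD : ∀ w : Fin (r + 2) → Fin n, StrictMono w → D (Fin.init w) ≠ D (Fin.tail w) := by
      intro w hw h
      have h₁ : C w ∈ D (Fin.init w) :=
        ⟨w (Fin.last _), by rwa [Fin.snoc_init_self], by rw [Fin.snoc_init_self]⟩
      rw [h] at h₁
      obtain ⟨x, hx, hC⟩ := h₁
      refine C.valid (v := w) (w := Fin.snoc (Fin.tail w) x) ?_ hC.symm
      have htail : Fin.tail (Fin.snoc (α := fun _ ↦ Fin n) w x) =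
          Fin.snoc (α := fun _ ↦ Fin n) (Fin.tail w) x := by
        rw [← Fin.cons_self_tail w, ← Fin.cons_snoc_eq_snoc_cons, Fin.tail_cons, Fin.tail_cons]
      refine ⟨Fin.snoc w x, ?_, .inl ⟨(Fin.init_snoc (α := fun _ ↦ Fin n) x w).symm, htail.symm⟩⟩
      rw [Fin.strictMono_iff_lt_succ]
      intro i
      refine Fin.cases ?_ (fun i ↦ ?_) i
      · have := hw (show (0 : Fin (r + 2)) < 1 by simp)
        rw [Fin.snoc_castSucc]
        have h1 : (Fin.succ 0 : Fin (r + 3)) = Fin.castSucc 1 := rfl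
        rw [h1, Fin.snoc_castSucc]
        exact this
      · have := hx (Fin.castSucc_lt_succ (i := i))
        rw [← htail] at this
        exact this
    have hcol := (Coloring.mk (G := shiftGraph r n) D (by
      rintro a b ⟨w, hw, ⟨rfl, rfl⟩ | ⟨rfl, rfl⟩⟩
      · exact hD w hw
      · exact (hD w hw).symm)).colorable
    simpa using hcol

end SimpleGraph

open SimpleGraph in
theorem blowup_lower_bound_construction (l k : ℕ) (hl : Odd l) (hl5 : 5 ≤ l)
    (hk : 1 ≤ k) :
    ∀ t : ℕ, 1 ≤ t → ∃ (n : ℕ) (G : SimpleGraph (Fin n)),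
      t < n ∧
      (∀ (v : Fin n) (c : G.Walk v v), c.IsCycle → Odd c.length →
        l + 1 ≤ c.length) ∧
      (∀ v : Fin n,
        (k : ℝ) * n / (minOrderGirthChrom (l + 1) (k + 1) : ℝ) ≤
          (Nat.card (G.neighborSet v) : ℝ)) ∧
      (k : ℕ∞) < G.chromaticNumber := by
  intro t _
  have hlt : ∀ {n m : ℕ} {G : SimpleGraph (Fin n)}, ((m + 1 : ℕ) : ℕ∞) ≤ G.chromaticNumber ↔
      ¬ G.Colorable m := fun {n m G} ↦ by
    rw [← chromaticNumber_le_iff_colorable, not_le, Nat.cast_add, Nat.cast_one,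
      ENat.add_one_le_iff (ENat.natCast_ne_top m)]
  set N := minOrderGirthChrom (l + 1) (k + 1)
  have hmem : N ≠ 0 → ∃ G : SimpleGraph (Fin N), l + 1 ≤ G.girth ∧ ¬ G.Colorable k := fun h ↦ by
    obtain ⟨G, hG, hGcol⟩ := Nat.sInf_mem (Nat.nonempty_of_pos_sInf (Nat.pos_of_ne_zero h))
    exact ⟨G, by exact_mod_cast hG, hlt.1 hGcol⟩
  obtain ⟨V, _, d, H, hodd, hcol, hdeg, hd⟩ : ∃ (V : Type) (_ : Fintype V) (d : ℕ)
      (H : SimpleGraph V), (∀ v (c : H.Walk v v), Odd c.length → l < c.length) ∧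
      ¬ H.Colorable k ∧ (∀ v, d ≤ Nat.card (H.neighborSet v)) ∧
      (N = 0 ∨ k * Fintype.card V ≤ d * N) := by
    obtain rfl | hk2 := hk.eq_or_lt
    · refine ⟨Fin 2, inferInstance, 1, ⊤, fun v c hc ↦ ?_, ?_, fun v ↦ ?_, ?_⟩
      · have := two_colorable_iff_forall_loop_even.1
          (colorable_of_fintype (⊤ : SimpleGraph (Fin 2))) v c
        exact absurd this (Nat.not_even_iff_odd.2 hc)
      · rw [colorable_one_iff]
        exact top_ne_bot
      · have : Nonempty ((⊤ : SimpleGraph (Fin 2)).neighborSet v) :=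
          (exists_ne v).elim fun w hw ↦ ⟨w, hw.symm⟩
        exact Nat.card_pos
      · by_contra! h
        obtain ⟨G, -, hG⟩ := hmem h.1
        refine hG ((colorable_of_fintype G).mono ?_)
        have := h.2
        simp only [Fintype.card_fin] at this ⊢
        omega
    · by_cases hN0 : N = 0
      · obtain ⟨n, hn⟩ := shiftGraph.exists_not_colorable (2 * l) k
        exact ⟨_, inferInstance, 0, shiftGraph (2 * l) n,
          fun _ ↦ shiftGraph.lt_length_of_odd, hn, fun _ ↦ Nat.zero_le _, .inl hN0⟩
      · obtain ⟨G, hG, hGcol⟩ := hmem hN0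
        refine ⟨Fin N, inferInstance, k, G, fun v c hc ↦ ?_, hGcol,
          le_card_neighborSet_of_minimal hk2 hG hGcol fun m hm G' hG' ↦ ?_, .inr (by simp)⟩
        · by_contra! hle
          have := c.even_length_of_forall_isCycle
            (fun _ w hw _ ↦ hG.trans (girth_le_length hw)) hle
          exact Nat.not_even_iff_odd.2 hc this
        · by_contra hcol
          exact Nat.notMem_of_lt_sInf hm ⟨G', by exact_mod_cast hG', hlt.2 hcol⟩
  have : Nonempty V := not_isEmpty_iff.1 fun _ ↦ hcol (.of_isEmpty k)
  obtain ⟨G, hG, hGcol, hGdeg⟩ := exists_blowup H hodd hcol hdeg t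
  refine ⟨_, G, ?_, fun v c _ hc ↦ hG v c hc, fun v ↦ ?_, ?_⟩
  · have := Fintype.card_pos (α := V)
    nlinarith
  · rcases hd with hd | hd
    · simp [hd]
    · refine le_trans ?_ (Nat.cast_le.2 (hGdeg v))
      refine div_le_of_le_mul₀ (by positivity) (by positivity) ?_
      have := Nat.mul_le_mul_right (t + 1) hd
      exact_mod_cast (by linarith : k * (Fintype.card V * (t + 1)) ≤ d * (t + 1) * N)
  · rw [← not_le, chromaticNumber_le_iff_colorable]
    exact hGcol
end
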